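/- Let m ≥ 1, θ > 1, and let f : ℝ^m → ℝ be locally Lipschitz continuous and bounded from below. Then for every λ ≤ inf_{ℝ^m} f the ergodic problem (EP)_λ admits a C² solution; in particular (EP) has infinitely many solutions. -/

import Mathlib

open Filter

noncomputable def lap {m : ℕ} (φ : EuclideanSpace ℝ (Fin m) → ℝ)
    (y : EuclideanSpace ℝ (Fin m)) : ℝ :=
  ∑ i : Fin m, iteratedFDeriv ℝ 2 φ y ![EuclideanSpace.single i 1, EuclideanSpace.single i 1]

def IsSubsolution {m : ℕ} (θ : ℝ) (f : EuclideanSpace ℝ (Fin m) → ℝ) (lam : ℝ)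
    (φ : EuclideanSpace ℝ (Fin m) → ℝ) : Prop :=
  ContDiff ℝ 2 φ ∧
    ∀ y, -(1/2) * lap φ y + (1/θ) * ‖gradient φ y‖ ^ θ ≤ f y - lam

def IsSupersolution {m : ℕ} (θ : ℝ) (f : EuclideanSpace ℝ (Fin m) → ℝ) (lam : ℝ)
    (φ : EuclideanSpace ℝ (Fin m) → ℝ) : Prop :=
  ContDiff ℝ 2 φ ∧
    ∀ y, -(1/2) * lap φ y + (1/θ) * ‖gradient φ y‖ ^ θ ≥ f y - lam

def IsSolution {m : ℕ} (θ : ℝ) (f : EuclideanSpace ℝ (Fin m) → ℝ) (lam : ℝ)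
    (φ : EuclideanSpace ℝ (Fin m) → ℝ) : Prop :=
  ContDiff ℝ 2 φ ∧
    ∀ y, -(1/2) * lap φ y + (1/θ) * ‖gradient φ y‖ ^ θ = f y - lam

noncomputable def lambdaStar {m : ℕ} (θ : ℝ) (f : EuclideanSpace ℝ (Fin m) → ℝ) : ℝ :=
  sSup {lam : ℝ | ∃ φ, IsSubsolution θ f lam φ}

def H0 {m : ℕ} (f : EuclideanSpace ℝ (Fin m) → ℝ) (α f₀ : ℝ) : Prop :=
  LocallyLipschitz f ∧ BddBelow (Set.range f) ∧
    ∀ y, DifferentiableAt ℝ f y →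
      (1 ≤ α → ‖gradient f y‖ ≤ f₀ * (1 + ‖y‖ ^ (α - 1))) ∧
      (α < 1 → ‖gradient f y‖ ≤ f₀)

def H1 {m : ℕ} (f : EuclideanSpace ℝ (Fin m) → ℝ) (α f₀ : ℝ) : Prop :=
  ∀ y, f₀⁻¹ * (‖y‖ ^ α + 1) ≤ f y ∧ f y ≤ f₀ * (‖y‖ ^ α + 1)

def MemPhi {m : ℕ} (γ : ℝ) (v : EuclideanSpace ℝ (Fin m) → ℝ) : Prop :=
  ContDiff ℝ 2 v ∧ ∃ c > 1, ∀ y, c⁻¹ * ‖y‖ ^ γ - c ≤ v y ∧ v y ≤ c * (1 + ‖y‖ ^ γ)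

def Coercive {m : ℕ} (f : EuclideanSpace ℝ (Fin m) → ℝ) : Prop :=
  Tendsto f (cocompact (EuclideanSpace ℝ (Fin m))) atTop



section
open Filter Topology

/-- Euclidean space. -/
abbrev EE (m : ℕ) := EuclideanSpace ℝ (Fin m)

noncomputable def ee {m : ℕ} (i : Fin m) : EE m := EuclideanSpace.single i 1

/-- directional derivative -/
noncomputable def pd {m : ℕ} (v : EE m) (φ : EE m → ℝ) : EE m → ℝ := fun x => fderiv ℝ φ x v

noncomputable def lpl {m : ℕ} (φ : EE m → ℝ) (x : EE m) : ℝ :=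
  ∑ i : Fin m, pd (ee i) (pd (ee i) φ) x

lemma norm_ee {m : ℕ} (i : Fin m) : ‖(ee i : EE m)‖ = 1 := by simp [ee]

lemma pd_contDiff {m : ℕ} {φ : EE m → ℝ} (h : ContDiff ℝ 2 φ) (v : EE m) :
    ContDiff ℝ 1 (pd v φ) := by
  unfold pd
  exact (h.fderiv_right (m := 1) (by norm_num)).clm_apply contDiff_const

lemma pd_continuous {m : ℕ} {φ : EE m → ℝ} (h : ContDiff ℝ 1 φ) (v : EE m) :
    Continuous (pd v φ) := by
  unfold pd
  exact (h.continuous_fderiv (by norm_num)).clm_apply continuous_const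

lemma lp_continuous {m : ℕ} {φ : EE m → ℝ} (h : ContDiff ℝ 2 φ) : Continuous (lpl φ) := by
  unfold lpl
  exact continuous_finsetSum _ fun i _ => pd_continuous (pd_contDiff h _) _

lemma lap_eq_lp {m : ℕ} {φ : EE m → ℝ} (h : ContDiff ℝ 2 φ) (y : EE m) : lap φ y = lpl φ y := by
  unfold lap lpl
  refine Finset.sum_congr rfl fun i _ => ?_
  rw [iteratedFDeriv_two_apply]
  simp only [Matrix.cons_val_zero, Matrix.cons_val_one]
  unfold pd
  have hd : DifferentiableAt ℝ (fderiv ℝ φ) y :=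
    (h.fderiv_right (m := 1) (by norm_num)).differentiable (by norm_num) y
  have := fderiv_clm_apply hd (differentiableAt_const (ee i : EE m))
  rw [this]
  simp [ee]

lemma C1.diff {m : ℕ} {φ : EE m → ℝ} (h : ContDiff ℝ 1 φ) : Differentiable ℝ φ :=
  h.differentiable (by norm_num)

lemma C2.diff {m : ℕ} {φ : EE m → ℝ} (h : ContDiff ℝ 2 φ) : Differentiable ℝ φ :=
  h.differentiable (by norm_num)

lemma C2.c1 {m : ℕ} {φ : EE m → ℝ} (h : ContDiff ℝ 2 φ) : ContDiff ℝ 1 φ :=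
  h.of_le (by norm_num)

lemma pd_add {m : ℕ} {φ ψ : EE m → ℝ} (h : Differentiable ℝ φ) (h' : Differentiable ℝ ψ)
    (v : EE m) : pd v (fun x => φ x + ψ x) = fun x => pd v φ x + pd v ψ x := by
  funext x; unfold pd; rw [fderiv_fun_add (h x) (h' x)]; rfl

lemma pd_sub {m : ℕ} {φ ψ : EE m → ℝ} (h : Differentiable ℝ φ) (h' : Differentiable ℝ ψ)
    (v : EE m) : pd v (fun x => φ x - ψ x) = fun x => pd v φ x - pd v ψ x := by
  funext x; unfold pd; rw [fderiv_fun_sub (h x) (h' x)]; rfl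

lemma pd_mul {m : ℕ} {φ ψ : EE m → ℝ} (h : Differentiable ℝ φ) (h' : Differentiable ℝ ψ)
    (v : EE m) : pd v (fun x => φ x * ψ x) = fun x => φ x * pd v ψ x + pd v φ x * ψ x := by
  funext x; unfold pd; rw [fderiv_fun_mul (h x) (h' x)]; simp; ring

lemma pd_const_mul {m : ℕ} {φ : EE m → ℝ} (h : Differentiable ℝ φ) (c : ℝ)
    (v : EE m) : pd v (fun x => c * φ x) = fun x => c * pd v φ x := by
  funext x; unfold pd; rw [fderiv_const_mul (h x)]; simp

lemma pd_shift {m : ℕ} (φ : EE m → ℝ) (z v : EE m) :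
    pd v (fun x => φ (x + z)) = fun x => pd v φ (x + z) := by
  funext x; unfold pd; rw [fderiv_comp_add_right]

lemma lp_shift {m : ℕ} (φ : EE m → ℝ) (z : EE m) (x : EE m) :
    lpl (fun x => φ (x + z)) x = lpl φ (x + z) := by
  unfold lpl; simp [pd_shift]

lemma lp_sub {m : ℕ} {φ ψ : EE m → ℝ} (h : ContDiff ℝ 2 φ) (h' : ContDiff ℝ 2 ψ) (x : EE m) :
    lpl (fun x => φ x - ψ x) x = lpl φ x - lpl ψ x := by
  unfold lpl
  rw [← Finset.sum_sub_distrib]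
  refine Finset.sum_congr rfl fun i _ => ?_
  rw [pd_sub (C2.diff h) (C2.diff h'), pd_sub (C1.diff (pd_contDiff h _)) (C1.diff (pd_contDiff h' _))]

lemma lp_add {m : ℕ} {φ ψ : EE m → ℝ} (h : ContDiff ℝ 2 φ) (h' : ContDiff ℝ 2 ψ) (x : EE m) :
    lpl (fun x => φ x + ψ x) x = lpl φ x + lpl ψ x := by
  unfold lpl
  rw [← Finset.sum_add_distrib]
  refine Finset.sum_congr rfl fun i _ => ?_
  rw [pd_add (C2.diff h) (C2.diff h'), pd_add (C1.diff (pd_contDiff h _)) (C1.diff (pd_contDiff h' _))]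

lemma lp_const_mul {m : ℕ} {φ : EE m → ℝ} (h : ContDiff ℝ 2 φ) (c : ℝ) (x : EE m) :
    lpl (fun x => c * φ x) x = c * lpl φ x := by
  unfold lpl
  rw [Finset.mul_sum]
  refine Finset.sum_congr rfl fun i _ => ?_
  rw [pd_const_mul (C2.diff h), pd_const_mul (C1.diff (pd_contDiff h _))]

lemma pdpd_mul {m : ℕ} {φ ψ : EE m → ℝ} (h : ContDiff ℝ 2 φ) (h' : ContDiff ℝ 2 ψ) (v x : EE m) :
    pd v (pd v (fun x => φ x * ψ x)) x =
      φ x * pd v (pd v ψ) x + 2 * (pd v φ x * pd v ψ x) + pd v (pd v φ) x * ψ x := by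
  have d1 := C2.diff h
  have d2 := C2.diff h'
  have e1 := C1.diff (pd_contDiff h v)
  have e2 := C1.diff (pd_contDiff h' v)
  rw [pd_mul d1 d2, pd_add (φ := fun x => φ x * pd v ψ x) (ψ := fun x => pd v φ x * ψ x) (d1.fun_mul e2) (e1.fun_mul d2), pd_mul d1 e2, pd_mul e1 d2]
  ring

lemma lp_mul {m : ℕ} {φ ψ : EE m → ℝ} (h : ContDiff ℝ 2 φ) (h' : ContDiff ℝ 2 ψ) (x : EE m) :
    lpl (fun x => φ x * ψ x) x =
      φ x * lpl ψ x + 2 * (∑ i, pd (ee i) φ x * pd (ee i) ψ x) + lpl φ x * ψ x := by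
  unfold lpl
  simp only [pdpd_mul h h', Finset.sum_add_distrib, Finset.mul_sum, Finset.sum_mul]

lemma inner_gradient {m : ℕ} (φ : EE m → ℝ) (x v : EE m) :
    inner ℝ (gradient φ x) v = pd v φ x := by
  unfold gradient pd; simp

lemma gradient_apply' {m : ℕ} (φ : EE m → ℝ) (x : EE m) (i : Fin m) :
    (gradient φ x) i = pd (ee i) φ x := by
  rw [← inner_gradient, ee, EuclideanSpace.inner_single_right]; simp

lemma norm_gradient {m : ℕ} (φ : EE m → ℝ) (x : EE m) : ‖gradient φ x‖ = ‖fderiv ℝ φ x‖ := by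
  unfold gradient; simp

lemma gradient_sub' {m : ℕ} {φ ψ : EE m → ℝ} (h : Differentiable ℝ φ) (h' : Differentiable ℝ ψ)
    (x : EE m) : gradient (fun x => φ x - ψ x) x = gradient φ x - gradient ψ x := by
  unfold gradient; rw [fderiv_fun_sub (h x) (h' x)]; simp

lemma gradient_shift {m : ℕ} (φ : EE m → ℝ) (z x : EE m) :
    gradient (fun x => φ (x + z)) x = gradient φ (x + z) := by
  unfold gradient; rw [fderiv_comp_add_right]

lemma gradient_contDiff {m : ℕ} {φ : EE m → ℝ} (h : ContDiff ℝ 2 φ) :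
    ContDiff ℝ 1 (gradient φ) := by
  unfold gradient
  exact (InnerProductSpace.toDual ℝ (EE m)).symm.toContinuousLinearEquiv.contDiff.comp
    (h.fderiv_right (m := 1) (by norm_num))

lemma gradient_continuous {m : ℕ} {φ : EE m → ℝ} (h : ContDiff ℝ 1 φ) :
    Continuous (gradient φ) := by
  unfold gradient
  exact (InnerProductSpace.toDual ℝ (EE m)).symm.continuous.comp
    (h.continuous_fderiv (by norm_num))

lemma abs_pd_le {m : ℕ} (φ : EE m → ℝ) (v x : EE m) : |pd v φ x| ≤ ‖gradient φ x‖ * ‖v‖ := by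
  rw [norm_gradient]; exact (fderiv ℝ φ x).le_opNorm v

lemma norm_sq_gradient {m : ℕ} (φ : EE m → ℝ) (x : EE m) :
    ‖gradient φ x‖ ^ 2 = ∑ i, pd (ee i) φ x ^ 2 := by
  rw [EuclideanSpace.norm_sq_eq]
  simp [gradient_apply']

lemma hasDerivAt_line {m : ℕ} {u : EE m → ℝ} (h : Differentiable ℝ u) (x v : EE m) (t : ℝ) :
    HasDerivAt (fun t : ℝ => u (x + t • v)) (pd v u (x + t • v)) t := by
  have h1 : HasDerivAt (fun t : ℝ => x + t • v) v t := by
    simpa using ((hasDerivAt_id t).smul_const v).const_add x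
  exact ((h (x + t • v)).hasFDerivAt.comp_hasDerivAt t h1)

lemma localMax_pd {m : ℕ} {u : EE m → ℝ} {x : EE m}
    (hx : IsLocalMax u x) (v : EE m) : pd v u x = 0 := by
  unfold pd; rw [hx.fderiv_eq_zero]; rfl

lemma localMax_gradient {m : ℕ} {u : EE m → ℝ} {x : EE m}
    (hx : IsLocalMax u x) : gradient u x = 0 := by
  unfold gradient; rw [hx.fderiv_eq_zero]; simp

lemma localMax_pdpd {m : ℕ} {u : EE m → ℝ} (h : ContDiff ℝ 2 u) {x : EE m}
    (hx : IsLocalMax u x) (v : EE m) : pd v (pd v u) x ≤ 0 := by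
  by_contra hpos
  push Not at hpos
  set g : ℝ → ℝ := fun t => u (x + t • v) with hg
  have d1 : deriv g = fun t => pd v u (x + t • v) := by
    funext t; exact (hasDerivAt_line (C2.diff h) x v t).deriv
  have d2 : deriv (deriv g) = fun t => pd v (pd v u) (x + t • v) := by
    rw [d1]; funext t; exact (hasDerivAt_line (C1.diff (pd_contDiff h v)) x v t).deriv
  have hmin : IsLocalMin g 0 := by
    apply isLocalMin_of_deriv_deriv_pos
    · rw [d2]; simpa using hpos
    · rw [d1]; simpa using localMax_pd hx v
    · exact (hasDerivAt_line (C2.diff h) x v 0).continuousAt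
  have hmax : IsLocalMax g 0 := by
    have hc : ContinuousAt (fun t : ℝ => x + t • v) 0 := by fun_prop
    have : Tendsto (fun t : ℝ => x + t • v) (𝓝 0) (𝓝 x) := by simpa [ContinuousAt] using hc
    have := this.eventually hx
    unfold IsLocalMax IsMaxFilter
    simpa [hg] using this
  have heq : g =ᶠ[𝓝 0] fun _ => g 0 := by
    filter_upwards [hmin, hmax] with t h1 h2
    exact le_antisymm h2 h1
  have : deriv (deriv g) 0 = 0 := by
    have := heq.deriv.deriv.eq_of_nhds
    simpa using this
  rw [d2] at this
  simp at this
  linarith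

lemma localMax_lp {m : ℕ} {u : EE m → ℝ} (h : ContDiff ℝ 2 u) {x : EE m}
    (hx : IsLocalMax u x) : lpl u x ≤ 0 :=
  Finset.sum_nonpos fun _ _ => localMax_pdpd h hx _

lemma contDiff_normsq {m : ℕ} {n : WithTop ℕ∞} : ContDiff ℝ n (fun x : EE m => ‖x‖ ^ 2) :=
  contDiff_norm_sq ℝ

lemma pd_normsq {m : ℕ} (v : EE m) : pd v (fun x : EE m => ‖x‖ ^ 2) = fun x => 2 * inner ℝ x v := by
  funext x; unfold pd
  have := (hasStrictFDerivAt_norm_sq x).hasFDerivAt.fderiv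
  rw [this]; simp

lemma pd_inner {m : ℕ} (v w : EE m) : pd v (fun x : EE m => inner ℝ x w) = fun _ => inner ℝ v w := by
  funext x; unfold pd
  have : HasFDerivAt (fun x : EE m => inner ℝ x w) (innerSL ℝ w) x := by
    have := (innerSL ℝ w).hasFDerivAt (x := x)
    refine this.congr_of_eventuallyEq (Eventually.of_forall fun y => ?_)
    simp [real_inner_comm]
  rw [this.fderiv]; simp [real_inner_comm]

lemma differentiable_innerL {m : ℕ} (w : EE m) : Differentiable ℝ (fun x : EE m => (inner ℝ x w : ℝ)) :=
  fun x => (differentiableAt_fun_id.inner ℝ (differentiableAt_const w))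

lemma lp_normsq {m : ℕ} (x : EE m) : lpl (fun x : EE m => ‖x‖ ^ 2) x = 2 * m := by
  unfold lpl
  simp only [pd_normsq]
  simp only [pd_const_mul (differentiable_innerL _), pd_inner]
  simp [norm_ee, mul_comm]

lemma gradient_normsq {m : ℕ} (x : EE m) :
    gradient (fun x : EE m => ‖x‖ ^ 2) x = (2 : ℝ) • x := by
  apply ext_inner_right ℝ
  intro v
  rw [inner_gradient, pd_normsq, inner_smul_left]; simp

/-- Maximum principle on the whole space. -/
lemma max_principle {m : ℕ} {u : EE m → ℝ} (hu : ContDiff ℝ 2 u) {S c A L : ℝ} (hc : 0 < c)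
    (hL : 0 ≤ L) (hS : ∀ x, |u x| ≤ S)
    (h : ∀ x, c * u x - (1/2) * lpl u x ≤ A + L * ‖gradient u x‖) : ∀ x, c * u x ≤ A := by
  intro x0
  have hS0 : 0 ≤ S := (abs_nonneg _).trans (hS 0)
  have key : ∀ δ : ℝ, 0 < δ →
      c * u x0 ≤ A + L * (2 * Real.sqrt (2 * S * δ)) + δ * m + c * (δ * ‖x0‖ ^ 2) := by
    intro δ hδ
    set w : EE m → ℝ := fun x => u x - δ * ‖x‖ ^ 2 with hw
    have hwc : ContDiff ℝ 2 w := hu.sub (contDiff_const.mul contDiff_normsq)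
    have hlim : Tendsto w (cocompact (EE m)) atBot := by
      have h1 : Tendsto (fun x : EE m => S - δ * ‖x‖ ^ 2) (cocompact (EE m)) atBot := by
        have : Tendsto (fun x : EE m => δ * ‖x‖ ^ 2) (cocompact (EE m)) atTop :=
          ((tendsto_pow_atTop two_ne_zero).comp (tendsto_norm_cocompact_atTop)).const_mul_atTop hδ
        simpa [sub_eq_add_neg] using tendsto_atBot_add_const_left _ S (tendsto_neg_atTop_atBot.comp this)
      refine tendsto_atBot_mono (fun x => ?_) h1
      have := (abs_le.1 (hS x)).2
      simp only [hw]; linarith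
    obtain ⟨y, hy⟩ := hwc.continuous.exists_forall_ge hlim
    have hmax : IsLocalMax w y := Eventually.of_forall hy
    have hδn : ContDiff ℝ 2 (fun x : EE m => δ * ‖x‖ ^ 2) := contDiff_const.mul contDiff_normsq
    have g0 := localMax_gradient hmax
    rw [hw, gradient_sub' (C2.diff hu) (C2.diff hδn)] at g0
    have g1 : gradient (fun x : EE m => δ * ‖x‖ ^ 2) y = (2 * δ) • y := by
      apply ext_inner_right ℝ
      intro v
      rw [inner_gradient, pd_const_mul (C2.diff contDiff_normsq), pd_normsq, inner_smul_left]
      simp; ring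
    have l0 := localMax_lp hwc hmax
    rw [hw, lp_sub hu hδn, lp_const_mul contDiff_normsq, lp_normsq] at l0
    have hgy : ‖gradient u y‖ = 2 * (δ * ‖y‖) := by
      rw [sub_eq_zero.1 g0, g1, norm_smul, Real.norm_of_nonneg (by positivity)]; ring
    have hb : δ * ‖y‖ ^ 2 ≤ 2 * S := by
      have h0 := hy 0
      simp only [hw] at h0
      have := (abs_le.1 (hS y)).2
      have := (abs_le.1 (hS 0)).1
      simp at h0; linarith
    have hb2 : δ * ‖y‖ ≤ Real.sqrt (2 * S * δ) := by
      apply Real.le_sqrt_of_sq_le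
      nlinarith
    have hyx := hy x0
    simp only [hw] at hyx
    have hh := h y
    rw [hgy] at hh
    have : L * (2 * (δ * ‖y‖)) ≤ L * (2 * Real.sqrt (2 * S * δ)) := by gcongr
    have hyn : 0 ≤ δ * ‖y‖ ^ 2 := by positivity
    have h3 : c * u x0 ≤ c * u y + c * (δ * ‖x0‖ ^ 2) := by
      rw [← mul_add]; apply mul_le_mul_of_nonneg_left _ hc.le; linarith
    nlinarith
  have hlim : Tendsto (fun δ : ℝ => A + L * (2 * Real.sqrt (2 * S * δ)) + δ * m + c * (δ * ‖x0‖ ^ 2))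
      (𝓝[>] 0) (𝓝 A) := by
    have : Continuous (fun δ : ℝ => A + L * (2 * Real.sqrt (2 * S * δ)) + δ * m + c * (δ * ‖x0‖ ^ 2)) := by
      fun_prop
    have := this.tendsto 0
    simp at this
    exact this.mono_left nhdsWithin_le_nhds
  exact ge_of_tendsto hlim (by filter_upwards [self_mem_nhdsWithin] with δ hδ using key δ hδ)

end

section
open Filter Topology MeasureTheory Set

noncomputable def gauZ (m : ℕ) : ℝ := ∫ z : EE m, Real.exp (-(1/2) * ‖z‖ ^ 2)

/-- the standard Gaussian density -/
noncomputable def gau {m : ℕ} (z : EE m) : ℝ := (gauZ m)⁻¹ * Real.exp (-(1/2) * ‖z‖ ^ 2)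

lemma integrable_exp_normsq {m : ℕ} {b : ℝ} (hb : 0 < b) :
    Integrable (fun z : EE m => Real.exp (-b * ‖z‖ ^ 2)) := by
  have := GaussianFourier.integrable_cexp_neg_mul_sq_norm_add (V := EE m) (b := (b : ℂ))
    (by simpa using hb) 0 0
  have h2 := this.norm
  refine h2.congr (Eventually.of_forall fun z => ?_)
  simp only [Complex.norm_exp]
  congr 1
  simp
  left
  norm_cast

lemma gauZ_pos (m : ℕ) : 0 < gauZ m := by
  unfold gauZ
  have := GaussianFourier.integral_rexp_neg_mul_sq_norm (V := EE m) (b := 1/2) (by norm_num)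
  rw [this]; positivity

lemma gau_pos {m : ℕ} (z : EE m) : 0 < gau z := by
  have := gauZ_pos m
  unfold gau; positivity

lemma gau_integral {m : ℕ} : ∫ z : EE m, gau z = 1 := by
  unfold gau
  rw [integral_const_mul]
  exact inv_mul_cancel₀ (gauZ_pos m).ne'

lemma gau_contDiff {m : ℕ} {n : WithTop ℕ∞} : ContDiff ℝ n (gau : EE m → ℝ) := by
  unfold gau
  exact contDiff_const.mul (Real.contDiff_exp.comp (contDiff_const.mul contDiff_normsq))

lemma pd_gau {m : ℕ} (v : EE m) : pd v (gau : EE m → ℝ) = fun z => -(inner ℝ z v * gau z) := by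
  funext z
  have h1 : HasFDerivAt (fun z : EE m => ‖z‖ ^ 2) (2 • innerSL ℝ z) z :=
    (hasStrictFDerivAt_norm_sq z).hasFDerivAt
  have h2 := ((h1.const_mul (-(1/2))).exp).const_mul ((gauZ m)⁻¹)
  unfold pd
  have h3 : fderiv ℝ (gau : EE m → ℝ) z = _ := h2.fderiv
  rw [h3]
  simp [gau]; ring

/-- integrable majorant -/
noncomputable def gmaj {m : ℕ} (z : EE m) : ℝ := (1 + ‖z‖) ^ 3 * gau z

lemma gau_continuous {m : ℕ} : Continuous (gau : EE m → ℝ) := (gau_contDiff (n := 0)).continuous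

lemma gmaj_continuous {m : ℕ} : Continuous (gmaj : EE m → ℝ) := by
  unfold gmaj
  exact ((continuous_const.add continuous_norm).pow 3).mul gau_continuous

lemma gmaj_nonneg {m : ℕ} (z : EE m) : 0 ≤ gmaj z := by
  have := gau_pos z
  unfold gmaj; positivity

lemma gmaj_integrable {m : ℕ} : Integrable (gmaj : EE m → ℝ) := by
  have h := (integrable_exp_normsq (m := m) (b := 1/4) (by norm_num)).const_mul
    ((gauZ m)⁻¹ * Real.exp 9)
  refine h.mono' gmaj_continuous.aestronglyMeasurable (Eventually.of_forall fun z => ?_)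
  rw [Real.norm_of_nonneg (gmaj_nonneg z)]
  unfold gmaj gau
  have hZ := gauZ_pos m
  have h1 : 1 + ‖z‖ ≤ Real.exp ‖z‖ := by linarith [Real.add_one_le_exp ‖z‖]
  have h2 : (1 + ‖z‖) ^ 3 ≤ Real.exp (3 * ‖z‖) := by
    calc (1 + ‖z‖) ^ 3 ≤ Real.exp ‖z‖ ^ 3 := by gcongr
      _ = Real.exp (3 * ‖z‖) := by rw [← Real.exp_nat_mul]; norm_num
  have h3 : Real.exp (3 * ‖z‖) * Real.exp (-(1/2) * ‖z‖ ^ 2) ≤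
      Real.exp 9 * Real.exp (-(1/4) * ‖z‖ ^ 2) := by
    rw [← Real.exp_add, ← Real.exp_add]
    apply Real.exp_le_exp.2
    nlinarith [sq_nonneg (‖z‖ / 2 - 3)]
  calc (1 + ‖z‖) ^ 3 * ((gauZ m)⁻¹ * Real.exp (-(1/2) * ‖z‖ ^ 2))
      ≤ Real.exp (3 * ‖z‖) * ((gauZ m)⁻¹ * Real.exp (-(1/2) * ‖z‖ ^ 2)) := by gcongr
    _ = (gauZ m)⁻¹ * (Real.exp (3 * ‖z‖) * Real.exp (-(1/2) * ‖z‖ ^ 2)) := by ring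
    _ ≤ (gauZ m)⁻¹ * (Real.exp 9 * Real.exp (-(1/4) * ‖z‖ ^ 2)) := by gcongr
    _ = _ := by ring

lemma gau_le_gmaj {m : ℕ} (z : EE m) : gau z ≤ gmaj z := by
  have := gau_pos z
  unfold gmaj
  have h : 1 ≤ (1 + ‖z‖) ^ 3 := one_le_pow₀ (by linarith [norm_nonneg z])
  nlinarith

noncomputable def g1 {m : ℕ} (v : EE m) (z : EE m) : ℝ := inner ℝ z v * gau z
noncomputable def g2 {m : ℕ} (v w : EE m) (z : EE m) : ℝ :=
  (inner ℝ z v * inner ℝ z w - inner ℝ v w) * gau z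

lemma g1_contDiff {m : ℕ} (v : EE m) : ContDiff ℝ 1 (g1 v) := by
  unfold g1
  exact (contDiff_id.inner ℝ contDiff_const).mul gau_contDiff

lemma g2_continuous {m : ℕ} (v w : EE m) : Continuous (g2 v w) := by
  unfold g2
  have := gau_continuous (m := m)
  fun_prop

lemma pd_g1 {m : ℕ} (v w : EE m) : pd w (g1 v) = fun z => - g2 v w z := by
  unfold g1
  rw [pd_mul (differentiable_innerL v) (C1.diff gau_contDiff), pd_gau, pd_inner]
  funext z
  unfold g2
  rw [real_inner_comm v w]
  ring

lemma g1_bound {m : ℕ} (v z : EE m) : |g1 v z| ≤ ‖v‖ * (‖z‖ * gau z) := by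
  have := gau_pos z
  unfold g1
  rw [abs_mul, abs_of_pos this]
  have h := abs_real_inner_le_norm z v
  calc _ ≤ (‖z‖ * ‖v‖) * gau z := by gcongr
    _ = _ := by ring

lemma g1_bound' {m : ℕ} (v z : EE m) : |g1 v z| ≤ ‖v‖ * gmaj z := by
  refine (g1_bound v z).trans ?_
  have := gau_pos z
  unfold gmaj
  have : ‖z‖ ≤ (1 + ‖z‖) ^ 3 := by
    have := norm_nonneg z
    nlinarith [mul_nonneg this this, mul_nonneg this (mul_nonneg this this)]
  gcongr

lemma g2_bound {m : ℕ} (v w z : EE m) : |g2 v w z| ≤ ‖v‖ * ‖w‖ * ((1 + ‖z‖ ^ 2) * gau z) := by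
  have := gau_pos z
  unfold g2
  rw [abs_mul, abs_of_pos this]
  have h : |inner ℝ z v * inner ℝ z w - inner ℝ v w| ≤ ‖v‖ * ‖w‖ * (1 + ‖z‖ ^ 2) := by
    have h1 := abs_real_inner_le_norm z v
    have h2 := abs_real_inner_le_norm z w
    have h3 := abs_real_inner_le_norm v w
    calc _ ≤ |inner ℝ z v * inner ℝ z w| + |inner ℝ v w| := abs_sub _ _
      _ ≤ (‖z‖ * ‖v‖) * (‖z‖ * ‖w‖) + ‖v‖ * ‖w‖ := by rw [abs_mul]; gcongr
      _ = _ := by ring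
  calc _ ≤ (‖v‖ * ‖w‖ * (1 + ‖z‖ ^ 2)) * gau z := by gcongr
    _ = _ := by ring

lemma g2_bound' {m : ℕ} (v w z : EE m) : |g2 v w z| * (1 + ‖z‖) ≤ ‖v‖ * ‖w‖ * gmaj z := by
  have h := g2_bound v w z
  have := gau_pos z
  have hz := norm_nonneg z
  calc |g2 v w z| * (1 + ‖z‖) ≤ (‖v‖ * ‖w‖ * ((1 + ‖z‖ ^ 2) * gau z)) * (1 + ‖z‖) := by gcongr
    _ = ‖v‖ * ‖w‖ * (((1 + ‖z‖ ^ 2) * (1 + ‖z‖)) * gau z) := by ring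
    _ ≤ ‖v‖ * ‖w‖ * ((1 + ‖z‖) ^ 3 * gau z) := by
        gcongr
        nlinarith
    _ = _ := by unfold gmaj; ring

lemma g2_bound'' {m : ℕ} (v w z : EE m) : |g2 v w z| ≤ ‖v‖ * ‖w‖ * gmaj z := by
  refine le_trans ?_ (g2_bound' v w z)
  nlinarith [abs_nonneg (g2 v w z), norm_nonneg z]

lemma gau_integrable {m : ℕ} : Integrable (gau : EE m → ℝ) :=
  gmaj_integrable.mono' gau_continuous.aestronglyMeasurable (Eventually.of_forall fun z => by
    rw [Real.norm_of_nonneg (gau_pos z).le]; exact gau_le_gmaj z)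

lemma g1_integrable {m : ℕ} (v : EE m) : Integrable (g1 v) :=
  (gmaj_integrable.const_mul ‖v‖).mono' (g1_contDiff v).continuous.aestronglyMeasurable
    (Eventually.of_forall fun z => g1_bound' v z)

lemma g2_integrable {m : ℕ} (v w : EE m) : Integrable (g2 v w) :=
  (gmaj_integrable.const_mul (‖v‖ * ‖w‖)).mono' (g2_continuous v w).aestronglyMeasurable
    (Eventually.of_forall fun z => g2_bound'' v w z)

/-- bounded `C¹` functions with bounded derivative -/
def CB1 {m : ℕ} (F : EE m → ℝ) : Prop :=
  ContDiff ℝ 1 F ∧ ∃ B, ∀ x, |F x| ≤ B ∧ ‖fderiv ℝ F x‖ ≤ B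

lemma integrable_mul_bdd {α : Type*} [MeasurableSpace α] {μ : Measure α} {κ F : α → ℝ}
    (hκ : Integrable κ μ) (hF : AEStronglyMeasurable F μ) {B : ℝ} (hB : ∀ x, |F x| ≤ B) :
    Integrable (fun x => κ x * F x) μ := by
  exact hκ.mul_bdd hF (c := B) (Eventually.of_forall hB)

lemma abs_integral_mul_le {α : Type*} [MeasurableSpace α] {μ : Measure α} {κ F : α → ℝ}
    (hκ : Integrable κ μ) {B : ℝ} (hB : ∀ x, |F x| ≤ B) :
    |∫ x, κ x * F x ∂μ| ≤ B * ∫ x, |κ x| ∂μ := by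
  rw [← integral_const_mul, ← Real.norm_eq_abs]
  refine norm_integral_le_of_norm_le (hκ.abs.const_mul B) (Eventually.of_forall fun x => ?_)
  rw [Real.norm_eq_abs, abs_mul, mul_comm]
  gcongr
  exact hB x

lemma CB1.pd_bound {m : ℕ} {F : EE m → ℝ} (hF : CB1 F) (v : EE m) :
    ∃ B, ∀ x, |pd v F x| ≤ B := by
  obtain ⟨_, B, hB⟩ := hF
  refine ⟨B * ‖v‖, fun x => ?_⟩
  refine ((fderiv ℝ F x).le_opNorm v).trans ?_
  gcongr
  exact (hB x).2

lemma pd_affine {m : ℕ} {F : EE m → ℝ} (hF : ContDiff ℝ 1 F) (x w : EE m) (r : ℝ) (z : EE m) :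
    fderiv ℝ (fun z => F (x + r • z)) z w = r * pd w F (x + r • z) := by
  have h1 : HasFDerivAt (fun z : EE m => x + r • z) (r • ContinuousLinearMap.id ℝ (EE m)) z :=
    ((hasFDerivAt_id z).const_smul r).const_add x
  have := ((C1.diff hF (x + r • z)).hasFDerivAt.comp z h1).fderiv
  have h2 : fderiv ℝ (fun z => F (x + r • z)) z = _ := this
  rw [h2]
  simp [pd]

lemma ibp {m : ℕ} {η F : EE m → ℝ} (hη : ContDiff ℝ 1 η) (hi : Integrable η) (w : EE m)
    (hi' : Integrable (pd w η)) (hF : CB1 F) (x : EE m) (r : ℝ) :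
    ∫ z, η z * (r * pd w F (x + r • z)) = - ∫ z, pd w η z * F (x + r • z) := by
  obtain ⟨B, hB⟩ := hF.2
  obtain ⟨B', hB'⟩ := hF.pd_bound w
  have hc : Continuous fun z : EE m => x + r • z := by fun_prop
  have e := fun z => (pd_affine hF.1 x w r z).symm
  simp only [e]
  apply integral_mul_fderiv_eq_neg_fderiv_mul_of_integrable
  · exact integrable_mul_bdd hi' (hF.1.continuous.comp hc).aestronglyMeasurable fun z => (hB _).1
  · simp only [← e]
    refine integrable_mul_bdd hi
      (continuous_const.mul ((pd_continuous hF.1 w).comp hc)).aestronglyMeasurable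
      (B := |r| * B') fun z => ?_
    rw [abs_mul]; gcongr; exact hB' _
  · exact integrable_mul_bdd hi (hF.1.continuous.comp hc).aestronglyMeasurable fun z => (hB _).1
  · exact fun z _ => C1.diff hη z
  · intro z _
    exact ((C1.diff hF.1).comp (by fun_prop : Differentiable ℝ fun z : EE m => x + r • z)) z

lemma ibp_gau {m : ℕ} {F : EE m → ℝ} (hF : CB1 F) (x v : EE m) (r : ℝ) :
    ∫ z, gau z * (r * pd v F (x + r • z)) = ∫ z, g1 v z * F (x + r • z) := by
  rw [ibp gau_contDiff gau_integrable v (by rw [pd_gau]; exact (g1_integrable v).neg) hF, pd_gau,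
    ← integral_neg]
  refine integral_congr_ae (Eventually.of_forall fun z => ?_)
  simp [g1]

lemma ibp_g1 {m : ℕ} {F : EE m → ℝ} (hF : CB1 F) (x v w : EE m) (r : ℝ) :
    ∫ z, g1 v z * (r * pd w F (x + r • z)) = ∫ z, g2 v w z * F (x + r • z) := by
  rw [ibp (g1_contDiff v) (g1_integrable v) w (by rw [pd_g1]; exact (g2_integrable v w).neg) hF,
    pd_g1, ← integral_neg]
  refine integral_congr_ae (Eventually.of_forall fun z => ?_)
  simp

lemma integral_g2 {m : ℕ} (v w : EE m) : ∫ z, g2 v w z = 0 := by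
  have hF : CB1 (fun _ : EE m => (1 : ℝ)) := ⟨contDiff_const, 1, fun x => by simp⟩
  have := ibp_g1 hF 0 v w 1
  have h0 : pd w (fun _ : EE m => (1 : ℝ)) = fun _ => 0 := by funext x; simp [pd]
  rw [h0] at this
  simpa using this.symm

end

section
open Filter Topology MeasureTheory Set

noncomputable def nu (m : ℕ) : Measure (ℝ × EE m) :=
  ((volume : Measure ℝ).restrict (Ioi 0)).prod (volume : Measure (EE m))

noncomputable def AA {m : ℕ} (κ : ℝ × EE m → ℝ) (F : EE m → ℝ) (x : EE m) : ℝ :=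
  ∫ p, κ p * F (x + p.1 • p.2) ∂(nu m)

lemma contDiff1_of_pd {m : ℕ} {φ : EE m → ℝ} (h : Differentiable ℝ φ)
    (h2 : ∀ v, Continuous (pd v φ)) : ContDiff ℝ 1 φ := by
  have := (contDiff_succ_iff_fderiv_apply (𝕜 := ℝ) (n := 0) (f := φ)).2 ⟨h, by simp, fun y => contDiff_zero.2 (h2 y)⟩
  simpa using this

lemma contDiff2_of_pd {m : ℕ} {φ : EE m → ℝ} (h : Differentiable ℝ φ)
    (h2 : ∀ v, ContDiff ℝ 1 (pd v φ)) : ContDiff ℝ 2 φ := by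
  have := (contDiff_succ_iff_fderiv_apply (𝕜 := ℝ) (n := 1) (f := φ)).2 ⟨h, by simp, fun y => h2 y⟩
  rwa [one_add_one_eq_two] at this

lemma cont_shift {m : ℕ} (x : EE m) : Continuous fun p : ℝ × EE m => x + p.1 • p.2 := by fun_prop

lemma AA_int {m : ℕ} {κ : ℝ × EE m → ℝ} (hκ : Integrable κ (nu m)) {F : EE m → ℝ}
    (hF : Continuous F) {B : ℝ} (hB : ∀ x, |F x| ≤ B) (x : EE m) :
    Integrable (fun p => κ p * F (x + p.1 • p.2)) (nu m) :=
  integrable_mul_bdd hκ (hF.comp (cont_shift x)).aestronglyMeasurable fun _ => hB _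

lemma AA_bound {m : ℕ} {κ : ℝ × EE m → ℝ} (hκ : Integrable κ (nu m)) {F : EE m → ℝ}
    {B : ℝ} (hB : ∀ x, |F x| ≤ B) (x : EE m) :
    |AA κ F x| ≤ B * ∫ p, |κ p| ∂(nu m) :=
  abs_integral_mul_le hκ fun _ => hB _

lemma AA_continuous {m : ℕ} {κ : ℝ × EE m → ℝ} (hκ : Integrable κ (nu m)) {F : EE m → ℝ}
    (hF : Continuous F) {B : ℝ} (hB : ∀ x, |F x| ≤ B) : Continuous (AA κ F) := by
  unfold AA
  refine continuous_of_dominated (bound := fun p => B * |κ p|) (fun x => (AA_int hκ hF hB x).1)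
    (fun x => Eventually.of_forall fun p => ?_) (hκ.abs.const_mul B)
    (Eventually.of_forall fun p => ?_)
  · rw [Real.norm_eq_abs, abs_mul, mul_comm]; gcongr; exact hB _
  · exact continuous_const.mul (hF.comp (by fun_prop))

lemma AA_hasFDerivAt {m : ℕ} {κ : ℝ × EE m → ℝ} (hκ : Integrable κ (nu m)) {F : EE m → ℝ}
    (hF : CB1 F) (x : EE m) : Integrable (fun p => κ p • fderiv ℝ F (x + p.1 • p.2)) (nu m) ∧
    HasFDerivAt (AA κ F) (∫ p, κ p • fderiv ℝ F (x + p.1 • p.2) ∂(nu m)) x := by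
  obtain ⟨hC, B, hB⟩ := hF
  have hc1 : Continuous (fderiv ℝ F) := hC.continuous_fderiv (by norm_num)
  have hm : AEStronglyMeasurable (fun p => κ p • fderiv ℝ F (x + p.1 • p.2)) (nu m) :=
    hκ.1.smul (hc1.comp (cont_shift x)).aestronglyMeasurable
  have hb : ∀ p : ℝ × EE m, ∀ y, ‖κ p • fderiv ℝ F (y + p.1 • p.2)‖ ≤ B * |κ p| := by
    intro p y
    rw [norm_smul, Real.norm_eq_abs, mul_comm]; gcongr; exact (hB _).2
  refine ⟨(hκ.abs.const_mul B).mono' hm (Eventually.of_forall fun p => hb p x), ?_⟩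
  refine hasFDerivAt_integral_of_dominated_of_fderiv_le (s := univ) (bound := fun p => B * |κ p|)
    univ_mem (Eventually.of_forall fun y => (AA_int hκ hC.continuous (fun z => (hB z).1) y).1)
    (AA_int hκ hC.continuous (fun z => (hB z).1) x) hm
    (Eventually.of_forall fun p y _ => hb p y) (hκ.abs.const_mul B)
    (Eventually.of_forall fun p y _ => ?_)
  have h1 : HasFDerivAt (fun y : EE m => F (y + p.1 • p.2)) (fderiv ℝ F (y + p.1 • p.2)) y := by
    have := (C1.diff hC (y + p.1 • p.2)).hasFDerivAt
    rwa [hasFDerivAt_comp_add_right]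
  simpa using h1.const_mul (κ p)

lemma AA_pd {m : ℕ} {κ : ℝ × EE m → ℝ} (hκ : Integrable κ (nu m)) {F : EE m → ℝ}
    (hF : CB1 F) (v : EE m) : pd v (AA κ F) = AA κ (pd v F) := by
  funext x
  have := AA_hasFDerivAt hκ hF x
  unfold pd
  rw [this.2.fderiv, ContinuousLinearMap.integral_apply this.1]
  rfl

lemma AA_C1 {m : ℕ} {κ : ℝ × EE m → ℝ} (hκ : Integrable κ (nu m)) {F : EE m → ℝ}
    (hF : CB1 F) : ContDiff ℝ 1 (AA κ F) := by
  refine contDiff1_of_pd (fun x => (AA_hasFDerivAt hκ hF x).2.differentiableAt) fun v => ?_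
  rw [AA_pd hκ hF]
  obtain ⟨B, hB⟩ := hF.pd_bound v
  exact AA_continuous hκ (pd_continuous hF.1 v) hB

/-! the kernels -/
noncomputable def k0 {m : ℕ} (K : ℝ) (p : ℝ × EE m) : ℝ :=
  (2 * (p.1 * Real.exp (-K * p.1 ^ 2))) * gau p.2
noncomputable def k1 {m : ℕ} (K : ℝ) (v : EE m) (p : ℝ × EE m) : ℝ :=
  (2 * Real.exp (-K * p.1 ^ 2)) * g1 v p.2

lemma int_exp {K : ℝ} (hK : 0 < K) : IntegrableOn (fun r : ℝ => Real.exp (-K * r ^ 2)) (Ioi 0) := by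
  have := integrableOn_rpow_mul_exp_neg_mul_sq hK (s := 0) (by norm_num)
  simpa using this

lemma int_rexp {K : ℝ} (hK : 0 < K) :
    IntegrableOn (fun r : ℝ => r * Real.exp (-K * r ^ 2)) (Ioi 0) := by
  have := integrableOn_rpow_mul_exp_neg_mul_sq hK (s := 1) (by norm_num)
  simpa using this

lemma k0_int {m : ℕ} {K : ℝ} (hK : 0 < K) : Integrable (k0 K) (nu m) :=
  ((int_rexp hK).const_mul 2).mul_prod gau_integrable

lemma k1_int {m : ℕ} {K : ℝ} (hK : 0 < K) (v : EE m) : Integrable (k1 K v) (nu m) :=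
  ((int_exp hK).const_mul 2).mul_prod (g1_integrable v)

noncomputable def c1 (m : ℕ) : ℝ := ∫ z : EE m, gmaj z

lemma c1_nonneg (m : ℕ) : 0 ≤ c1 m := integral_nonneg gmaj_nonneg

lemma k1_norm {m : ℕ} {K : ℝ} (hK : 0 < K) (v : EE m) :
    ∫ p, |k1 K v p| ∂(nu m) ≤ 2 * (Real.sqrt (Real.pi / K) / 2) * (‖v‖ * c1 m) := by
  have e : (fun p : ℝ × EE m => |k1 K v p|) =
      fun p => (2 * Real.exp (-K * p.1 ^ 2)) * |g1 v p.2| := by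
    funext p; unfold k1; rw [abs_mul, abs_of_pos (by positivity)]
  rw [e]
  unfold nu
  rw [integral_prod_mul (fun r : ℝ => 2 * Real.exp (-K * r ^ 2)) (fun z => |g1 v z|),
    integral_const_mul, integral_gaussian_Ioi]
  gcongr
  unfold c1
  rw [← integral_const_mul]
  exact integral_mono (g1_integrable v).abs (gmaj_integrable.const_mul _) (g1_bound' v)

noncomputable def GG {m : ℕ} (K : ℝ) (F : EE m → ℝ) : EE m → ℝ := AA (k0 K) F

lemma AA_fubini {m : ℕ} {a : ℝ → ℝ} {b : EE m → ℝ} (ha : IntegrableOn a (Ioi 0))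
    (hb : Integrable b) {F : EE m → ℝ} (hF : Continuous F) {B : ℝ} (hB : ∀ x, |F x| ≤ B) (x : EE m) :
    AA (fun p => a p.1 * b p.2) F x = ∫ r in Ioi (0:ℝ), a r * ∫ z, b z * F (x + r • z) := by
  unfold AA nu
  have hκ : Integrable (fun p : ℝ × EE m => a p.1 * b p.2) (nu m) := ha.mul_prod hb
  have := AA_int hκ hF hB x
  unfold nu at this
  rw [integral_prod _ this]
  refine integral_congr_ae (Eventually.of_forall fun r => ?_)
  simp only
  rw [← integral_const_mul]
  refine integral_congr_ae (Eventually.of_forall fun z => ?_)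
  simp only; ring

lemma GG_pd {m : ℕ} {K : ℝ} (hK : 0 < K) {F : EE m → ℝ} (hF : CB1 F) (v : EE m) :
    pd v (GG K F) = AA (k1 K v) F := by
  unfold GG
  rw [AA_pd (k0_int hK) hF]
  funext x
  obtain ⟨B, hB⟩ := hF.pd_bound v
  obtain ⟨B', hB'⟩ := hF.2
  unfold k0 k1
  rw [AA_fubini (a := fun r => 2 * (r * Real.exp (-K * r ^ 2))) ((int_rexp hK).const_mul 2) gau_integrable (pd_continuous hF.1 v) hB,
    AA_fubini (a := fun r => 2 * Real.exp (-K * r ^ 2)) ((int_exp hK).const_mul 2) (g1_integrable v) hF.1.continuous fun x => (hB' x).1]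
  refine integral_congr_ae (Eventually.of_forall fun r => ?_)
  simp only
  rw [← ibp_gau hF x v r, ← integral_const_mul, ← integral_const_mul]
  refine integral_congr_ae (Eventually.of_forall fun z => ?_)
  simp only; ring

lemma GG_pdpd {m : ℕ} {K : ℝ} (hK : 0 < K) {F : EE m → ℝ} (hF : CB1 F) (v w : EE m) :
    pd w (pd v (GG K F)) = AA (k1 K v) (pd w F) := by
  rw [GG_pd hK hF, AA_pd (k1_int hK v) hF]

lemma GG_C2 {m : ℕ} {K : ℝ} (hK : 0 < K) {F : EE m → ℝ} (hF : CB1 F) : ContDiff ℝ 2 (GG K F) := by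
  refine contDiff2_of_pd (C1.diff (AA_C1 (k0_int hK) hF)) fun v => ?_
  rw [GG_pd hK hF]
  exact AA_C1 (k1_int hK v) hF

lemma GG_bound {m : ℕ} {K : ℝ} (hK : 0 < K) {F : EE m → ℝ} {B : ℝ} (hB : ∀ x, |F x| ≤ B) :
    ∃ S, ∀ x, |GG K F x| ≤ S := ⟨_, AA_bound (k0_int hK) hB⟩

lemma GG_pd_bound {m : ℕ} {K : ℝ} (hK : 0 < K) {F : EE m → ℝ} (hF : CB1 F) {B : ℝ}
    (hB0 : 0 ≤ B) (hB : ∀ x, |F x| ≤ B) (v x : EE m) :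
    |pd v (GG K F) x| ≤ B * (Real.sqrt (Real.pi / K) * c1 m * ‖v‖) := by
  rw [GG_pd hK hF]
  refine (AA_bound (k1_int hK v) hB x).trans ?_
  gcongr
  refine (k1_norm hK v).trans (le_of_eq ?_)
  ring

lemma sum_ee {m : ℕ} (z : EE m) : z = ∑ i, z i • (ee i : EE m) := by
  ext j
  simp [ee, Pi.single_apply]

lemma sum_g1_pd {m : ℕ} (F : EE m → ℝ) (z y : EE m) :
    ∑ i, g1 (ee i) z * pd (ee i) F y = gau z * pd z F y := by
  have : pd z F y = ∑ i, z i * pd (ee i) F y := by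
    unfold pd
    conv_lhs => rw [sum_ee z]
    rw [map_sum]; simp
  rw [this, Finset.mul_sum]
  refine Finset.sum_congr rfl fun i _ => ?_
  unfold g1 ee
  rw [EuclideanSpace.inner_single_right]; simp; ring

noncomputable def MM {m : ℕ} (F : EE m → ℝ) (x : EE m) (r : ℝ) : ℝ := ∫ z, gau z * F (x + r • z)
noncomputable def MD {m : ℕ} (F : EE m → ℝ) (x : EE m) (r : ℝ) : ℝ :=
  ∫ z, gau z * pd z F (x + r • z)

lemma MM_deriv {m : ℕ} {F : EE m → ℝ} (hF : CB1 F) (x : EE m) (r : ℝ) :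
    HasDerivAt (MM F x) (MD F x r) r := by
  obtain ⟨hC, B, hB⟩ := hF
  have hi : ∀ r : ℝ, Integrable (fun z => gau z * F (x + r • z)) := fun r =>
    integrable_mul_bdd gau_integrable (hC.continuous.comp (by fun_prop)).aestronglyMeasurable
      fun z => (hB _).1
  have hc1 : Continuous (fderiv ℝ F) := hC.continuous_fderiv (by norm_num)
  refine (hasDerivAt_integral_of_dominated_loc_of_deriv_le (s := univ)
    (bound := fun z => B * gmaj z) (F' := fun r z => gau z * pd z F (x + r • z)) univ_mem
    (Eventually.of_forall fun r => (hi r).1) (hi r) ?_ ?_ (gmaj_integrable.const_mul _) ?_).2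
  · apply Continuous.aestronglyMeasurable
    apply gau_continuous.mul
    unfold pd
    exact (hc1.comp (by fun_prop)).clm_apply continuous_id
  · refine Eventually.of_forall fun z r _ => ?_
    have h0 := gau_pos z
    rw [Real.norm_eq_abs, abs_mul, abs_of_pos h0]
    have h1 : |pd z F (x + r • z)| ≤ B * ‖z‖ :=
      ((fderiv ℝ F _).le_opNorm z).trans (by gcongr; exact (hB _).2)
    have hB0 : 0 ≤ B := (abs_nonneg _).trans (hB 0).1
    calc gau z * |pd z F (x + r • z)| ≤ gau z * (B * ‖z‖) := by gcongr
      _ = B * (‖z‖ * gau z) := by ring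
      _ ≤ B * ((1 + ‖z‖) ^ 3 * gau z) := by
        have : ‖z‖ ≤ (1 + ‖z‖) ^ 3 := by
          have := norm_nonneg z
          nlinarith [mul_nonneg this this, mul_nonneg this (mul_nonneg this this)]
        gcongr
      _ = _ := rfl
  · refine Eventually.of_forall fun z r _ => ?_
    exact (hasDerivAt_line (C1.diff hC) x z r).const_mul _

lemma MM_bound {m : ℕ} {F : EE m → ℝ} {B : ℝ} (hB : ∀ x, |F x| ≤ B) (x : EE m) (r : ℝ) :
    |MM F x r| ≤ B := by
  refine (abs_integral_mul_le gau_integrable fun z => hB _).trans ?_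
  have : (fun z : EE m => |gau z|) = gau := by funext z; exact abs_of_pos (gau_pos z)
  rw [this, gau_integral, mul_one]

lemma GG_lpl {m : ℕ} {K : ℝ} (hK : 0 < K) {F : EE m → ℝ} (hF : CB1 F) (x : EE m) :
    IntegrableOn (fun r => 2 * Real.exp (-K * r ^ 2) * MD F x r) (Ioi 0) ∧
    lpl (GG K F) x = ∫ r in Ioi (0:ℝ), 2 * Real.exp (-K * r ^ 2) * MD F x r := by
  unfold lpl
  simp only [GG_pdpd hK hF]
  have hInteg : ∀ i : Fin m, Integrable (fun p : ℝ × EE m =>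
      k1 K (ee i) p * pd (ee i) F (x + p.1 • p.2)) (nu m) := fun i => by
    obtain ⟨B, hB⟩ := hF.pd_bound (ee i)
    exact AA_int (k1_int hK _) (pd_continuous hF.1 _) hB x
  have hs : ∑ i, AA (k1 K (ee i)) (pd (ee i) F) x =
      ∫ p, ∑ i, k1 K (ee i) p * pd (ee i) F (x + p.1 • p.2) ∂(nu m) := by
    unfold AA
    rw [integral_finsetSum _ fun i _ => hInteg i]
  have hi : Integrable (fun p : ℝ × EE m => ∑ i, k1 K (ee i) p * pd (ee i) F (x + p.1 • p.2)) (nu m) :=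
    integrable_finsetSum _ fun i _ => hInteg i
  have he : (fun p : ℝ × EE m => ∑ i, k1 K (ee i) p * pd (ee i) F (x + p.1 • p.2)) =
      fun p => 2 * Real.exp (-K * p.1 ^ 2) * (gau p.2 * pd p.2 F (x + p.1 • p.2)) := by
    funext p
    rw [← sum_g1_pd, Finset.mul_sum]
    refine Finset.sum_congr rfl fun i _ => ?_
    unfold k1; ring
  rw [he] at hi
  rw [hs, he]
  unfold nu at hi ⊢
  have e2 : (fun r => ∫ z : EE m, 2 * Real.exp (-K * r ^ 2) * (gau z * pd z F (x + r • z))) =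
    fun r => 2 * Real.exp (-K * r ^ 2) * MD F x r := by
    funext r; unfold MD; rw [← integral_const_mul]
  constructor
  · have := hi.integral_prod_left
    simp only at this
    rw [e2] at this
    exact this
  · rw [integral_prod _ hi]
    simp only
    rw [e2]

lemma GG_eq {m : ℕ} {K : ℝ} (hK : 0 < K) {F : EE m → ℝ} (hF : CB1 F) (x : EE m) :
    K * GG K F x - (1/2) * lpl (GG K F) x = F x := by
  obtain ⟨B, hB⟩ := hF.2
  obtain ⟨hi, he⟩ := GG_lpl hK hF x
  have h0 : GG K F x = ∫ r in Ioi (0:ℝ), 2 * (r * Real.exp (-K * r ^ 2)) * MM F x r := by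
    unfold GG k0
    rw [AA_fubini (a := fun r => 2 * (r * Real.exp (-K * r ^ 2))) ((int_rexp hK).const_mul 2) gau_integrable hF.1.continuous fun x => (hB x).1]
    rfl
  have hMc : Continuous (MM F x) :=
    continuous_iff_continuousAt.2 fun r => (MM_deriv hF x r).continuousAt
  have hi0 : IntegrableOn (fun r => 2 * (r * Real.exp (-K * r ^ 2)) * MM F x r) (Ioi 0) :=
    integrable_mul_bdd ((int_rexp hK).const_mul 2) hMc.aestronglyMeasurable fun r => MM_bound (fun x => (hB x).1) x r
  have hd : ∀ r ∈ Ici (0:ℝ), HasDerivAt (fun r => -(Real.exp (-K * r ^ 2) * MM F x r))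
      (K * (2 * (r * Real.exp (-K * r ^ 2)) * MM F x r) -
        (1/2) * (2 * Real.exp (-K * r ^ 2) * MD F x r)) r := by
    intro r _
    have h1 : HasDerivAt (fun r : ℝ => Real.exp (-K * r ^ 2))
        (Real.exp (-K * r ^ 2) * (-K * (2 * r))) r := by
      have := ((hasDerivAt_pow 2 r).const_mul (-K)).exp
      simpa using this
    have := (h1.mul (MM_deriv hF x r)).neg
    refine HasDerivAt.congr_deriv this ?_
    ring
  have hlim : Tendsto (fun r => -(Real.exp (-K * r ^ 2) * MM F x r)) atTop (𝓝 0) := by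
    have h1 : Tendsto (fun r : ℝ => Real.exp (-K * r ^ 2)) atTop (𝓝 0) := by
      apply Real.tendsto_exp_atBot.comp
      exact (tendsto_pow_atTop two_ne_zero).const_mul_atTop_of_neg (by linarith)
    have h2 : Tendsto (fun r : ℝ => Real.exp (-K * r ^ 2) * MM F x r) atTop (𝓝 0) := by
      apply squeeze_zero_norm (a := fun r : ℝ => Real.exp (-K * r ^ 2) * B)
      · intro r
        rw [norm_mul, Real.norm_of_nonneg (Real.exp_pos _).le]
        gcongr
        exact MM_bound (fun x => (hB x).1) x r
      · simpa using h1.mul_const B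
    simpa using h2.neg
  have := integral_Ioi_of_hasDerivAt_of_tendsto' hd ((hi0.const_mul K).sub (hi.const_mul (1/2))) hlim
  rw [integral_sub (hi0.const_mul K) (hi.const_mul (1/2)), integral_const_mul, integral_const_mul,
    ← h0, ← he] at this
  rw [this]
  simp [MM, integral_mul_const, gau_integral]

end

section
open Filter Topology MeasureTheory Set

lemma GG_unique {m : ℕ} {K : ℝ} (hK : 0 < K) {F u : EE m → ℝ} (hF : CB1 F)
    (hu : ContDiff ℝ 2 u) {S : ℝ} (hS : ∀ x, |u x| ≤ S)
    (h : ∀ x, K * u x - (1/2) * lpl u x = F x) : u = GG K F := by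
  obtain ⟨B, hB⟩ := hF.2
  obtain ⟨S', hS'⟩ := GG_bound (K := K) hK (F := F) fun x => (hB x).1
  have hG := GG_C2 hK hF
  have h1 := max_principle (hu.sub hG) (S := S + S') (A := 0) hK le_rfl
    (fun x => (abs_sub _ _).trans (add_le_add (hS x) (hS' x))) (fun x => by
      rw [lp_sub hu hG]
      linarith [h x, GG_eq hK hF x])
  have h2 := max_principle (hG.sub hu) (S := S' + S) (A := 0) hK le_rfl
    (fun x => (abs_sub _ _).trans (add_le_add (hS' x) (hS x))) (fun x => by
      rw [lp_sub hG hu]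
      linarith [h x, GG_eq hK hF x])
  funext x
  have a := h1 x
  have b := h2 x
  have a' : u x - GG K F x ≤ 0 := by
    by_contra hh; push Not at hh; linarith [mul_pos hK hh]
  have b' : GG K F x - u x ≤ 0 := by
    by_contra hh; push Not at hh; linarith [mul_pos hK hh]
  linarith

lemma interp {X P a b s : ℝ} (hP : 0 ≤ P) (ha : 0 ≤ a) (hb : 0 ≤ b) (hs : 0 ≤ s)
    (h1 : X ≤ P * a ^ s) (h2 : X ≤ P * b ^ s) : X ≤ P * (a * b) ^ (s / 2) := by
  have key : ∀ a b : ℝ, 0 ≤ a → a ≤ b → a ^ s ≤ (a * b) ^ (s / 2) := by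
    intro a b ha hab
    calc a ^ s = (a * a) ^ (s / 2) := by
          rw [← pow_two, ← Real.rpow_natCast_mul ha]; congr 1; push_cast; ring
      _ ≤ _ := by gcongr
  rcases le_total a b with h | h
  · exact h1.trans (mul_le_mul_of_nonneg_left (key a b ha h) hP)
  · refine h2.trans (mul_le_mul_of_nonneg_left ?_ hP)
    rw [mul_comm a b]; exact key b a hb h

lemma slice_diff {m : ℕ} {F : EE m → ℝ} (hF : CB1 F) {B : ℝ} (hB : ∀ x, |F x| ≤ B) (v : EE m)
    {r : ℝ} (hr : 0 < r) (x y : EE m) :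
    |(∫ z, g1 v z * F (y + r • z)) - ∫ z, g1 v z * F (x + r • z)| ≤
      2 * (B * (‖v‖ * c1 m)) * (‖y - x‖ / r) ^ (1/2 : ℝ) := by
  have hB0 : 0 ≤ B := (abs_nonneg _).trans (hB 0)
  have hc := c1_nonneg m
  have hg1 : ∫ z, |g1 v z| ≤ ‖v‖ * c1 m := by
    unfold c1
    rw [← integral_const_mul]
    exact integral_mono (g1_integrable v).abs (gmaj_integrable.const_mul _) (g1_bound' v)
  have hb1 : ∀ x, |∫ z, g1 v z * F (x + r • z)| ≤ B * (‖v‖ * c1 m) := fun x =>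
    (abs_integral_mul_le (g1_integrable v) fun _ => hB _).trans (by gcongr)
  set w := y - x with hw
  have hi : ∀ x, Integrable (fun z => g1 v z * F (x + r • z)) := fun x =>
    integrable_mul_bdd (g1_integrable v) (hF.1.continuous.comp (by fun_prop)).aestronglyMeasurable
      fun z => hB _
  obtain ⟨B', hB'⟩ := hF.pd_bound w
  have hder : ∀ t : ℝ, HasDerivAt (fun t : ℝ => ∫ z, g1 v z * F ((x + t • w) + r • z))
      (∫ z, g1 v z * pd w F ((x + t • w) + r • z)) t := by
    intro t
    refine (hasDerivAt_integral_of_dominated_loc_of_deriv_le (s := univ)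
      (bound := fun z => B' * |g1 v z|) (F' := fun t z => g1 v z * pd w F ((x + t • w) + r • z)) univ_mem
      (Eventually.of_forall fun t => (hi _).1) (hi _) ?_ ?_ ((g1_integrable v).abs.const_mul _) ?_).2
    · exact ((g1_contDiff v).continuous.mul
        ((pd_continuous hF.1 w).comp (by fun_prop))).aestronglyMeasurable
    · refine Eventually.of_forall fun z t _ => ?_
      rw [norm_mul, mul_comm]; exact mul_le_mul_of_nonneg_right (hB' _) (norm_nonneg _)
    · refine Eventually.of_forall fun z t _ => ?_
      have := (hasDerivAt_line (C1.diff hF.1) (x + r • z) w t).const_mul (g1 v z)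
      simpa only [add_right_comm] using this
  have hg2 : ∫ z, |g2 v w z| ≤ ‖v‖ * ‖w‖ * c1 m := by
    unfold c1
    rw [← integral_const_mul]
    exact integral_mono (g2_integrable v w).abs (gmaj_integrable.const_mul _) (g2_bound'' v w)
  have hbd : ∀ t : ℝ, ‖∫ z, g1 v z * pd w F ((x + t • w) + r • z)‖ ≤ B * (‖v‖ * ‖w‖ * c1 m) / r := by
    intro t
    rw [Real.norm_eq_abs, le_div_iff₀ hr]
    have := ibp_g1 hF (x + t • w) v w r
    have e : (∫ z, g1 v z * (r * pd w F ((x + t • w) + r • z))) =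
        r * ∫ z, g1 v z * pd w F ((x + t • w) + r • z) := by
      rw [← integral_const_mul]
      refine integral_congr_ae (Eventually.of_forall fun z => ?_)
      simp only; ring
    rw [e] at this
    have h3 : |∫ z, g2 v w z * F ((x + t • w) + r • z)| ≤ B * (‖v‖ * ‖w‖ * c1 m) :=
      (abs_integral_mul_le (g2_integrable v w) fun _ => hB _).trans (by gcongr)
    rw [← this, abs_mul, abs_of_pos hr] at h3
    linarith
  have hmv := norm_image_sub_le_of_norm_deriv_le_segment_01'
    (f := fun t : ℝ => ∫ z, g1 v z * F ((x + t • w) + r • z))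
    (f' := fun t => ∫ z, g1 v z * pd w F ((x + t • w) + r • z))
    (fun t _ => (hder t).hasDerivWithinAt) (fun t _ => hbd t)
  simp only [one_smul, zero_smul, add_zero] at hmv
  rw [show x + w = y by simp [hw]] at hmv
  have := interp (X := |(∫ z, g1 v z * F (y + r • z)) - ∫ z, g1 v z * F (x + r • z)|)
    (P := 2 * (B * (‖v‖ * c1 m))) (a := 1) (b := ‖w‖ / r) (s := 1) (by positivity) (by norm_num)
    (by positivity) (by norm_num) ?_ ?_
  · simpa using this
  · rw [Real.rpow_one]
    have := hb1 x; have := hb1 y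
    exact (abs_sub _ _).trans (by linarith)
  · rw [Real.rpow_one]
    refine hmv.trans ?_
    rw [div_eq_mul_inv, div_eq_mul_inv]
    have : 0 ≤ B * (‖v‖ * c1 m) * (‖w‖ * r⁻¹) := by positivity
    nlinarith

lemma int_s {s : ℝ} (hs : -1 < s) :
    IntegrableOn (fun r : ℝ => r ^ s * Real.exp (-1 * r ^ 2)) (Ioi 0) :=
  integrableOn_rpow_mul_exp_neg_mul_sq one_pos hs

lemma Icont {m : ℕ} {b F : EE m → ℝ} (hb : Integrable b) (hF : Continuous F) {B : ℝ}
    (hB : ∀ x, |F x| ≤ B) (x : EE m) : Continuous fun r : ℝ => ∫ z, b z * F (x + r • z) := by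
  refine continuous_of_dominated (bound := fun z => B * |b z|) (fun r => ?_)
    (fun r => Eventually.of_forall fun z => ?_) (hb.abs.const_mul B)
    (Eventually.of_forall fun z => ?_)
  · exact (integrable_mul_bdd hb (hF.comp (by fun_prop)).aestronglyMeasurable fun z => hB _).1
  · rw [norm_mul, mul_comm]; exact mul_le_mul_of_nonneg_right (hB _) (norm_nonneg _)
  · exact continuous_const.mul (hF.comp (by fun_prop))

lemma AA_diff_bound {m : ℕ} {v : EE m} {F : EE m → ℝ} (hF : Continuous F) {B : ℝ}
    (hB : ∀ x, |F x| ≤ B) (x y : EE m) {D s : ℝ} (hs : -1 < s)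
    (h : ∀ r : ℝ, 0 < r → |(∫ z, g1 v z * F (y + r • z)) - ∫ z, g1 v z * F (x + r • z)| ≤ D * r ^ s) :
    |AA (k1 1 v) F y - AA (k1 1 v) F x| ≤
      D * (2 * ∫ r in Ioi (0:ℝ), r ^ s * Real.exp (-1 * r ^ 2)) := by
  unfold k1
  have ha : IntegrableOn (fun r : ℝ => 2 * Real.exp (-1 * r ^ 2)) (Ioi 0) :=
    (int_exp one_pos).const_mul 2
  have hI : ∀ x, IntegrableOn (fun r : ℝ => 2 * Real.exp (-1 * r ^ 2) * ∫ z, g1 v z * F (x + r • z)) (Ioi 0) := by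
    intro x
    exact integrable_mul_bdd ha (Icont (g1_integrable v) hF hB x).aestronglyMeasurable
      (fun r => abs_integral_mul_le (g1_integrable v) fun _ => hB _)
  rw [AA_fubini (a := fun r => 2 * Real.exp (-1 * r ^ 2)) ha (g1_integrable v) hF hB,
    AA_fubini (a := fun r => 2 * Real.exp (-1 * r ^ 2)) ha (g1_integrable v) hF hB,
    ← integral_sub (hI y) (hI x), ← integral_const_mul, ← integral_const_mul, ← Real.norm_eq_abs]
  refine norm_integral_le_of_norm_le (((int_s hs).const_mul 2).const_mul D) ?_
  rw [ae_restrict_iff' measurableSet_Ioi]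
  refine Eventually.of_forall fun r hr => ?_
  rw [← mul_sub, norm_mul, Real.norm_of_nonneg (by positivity)]
  calc _ ≤ 2 * Real.exp (-1 * r ^ 2) * (D * r ^ s) := by
        gcongr; exact h r hr
    _ = _ := by ring

noncomputable def cS (s : ℝ) : ℝ := 2 * ∫ r in Ioi (0:ℝ), r ^ s * Real.exp (-1 * r ^ 2)

lemma cS_nonneg (s : ℝ) : 0 ≤ cS s := by
  unfold cS
  have : 0 ≤ ∫ r in Ioi (0:ℝ), r ^ s * Real.exp (-1 * r ^ 2) :=
    setIntegral_nonneg measurableSet_Ioi fun r hr => by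
      have : (0:ℝ) < r := hr
      positivity
  linarith

/-- first a priori estimate -/
lemma est1 {m : ℕ} {F : EE m → ℝ} (hF : CB1 F) {B : ℝ} (hB : ∀ x, |F x| ≤ B) (v x y : EE m) :
    |pd v (GG 1 F) y - pd v (GG 1 F) x| ≤
      2 * (B * (‖v‖ * c1 m)) * cS (-(1/2)) * ‖y - x‖ ^ (1/2 : ℝ) := by
  rw [GG_pd one_pos hF]
  have := AA_diff_bound (v := v) hF.1.continuous hB x y
    (D := 2 * (B * (‖v‖ * c1 m)) * ‖y - x‖ ^ (1/2 : ℝ)) (s := -(1/2)) (by norm_num) (fun r hr => by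
      refine (slice_diff hF hB v hr x y).trans (le_of_eq ?_)
      rw [Real.div_rpow (norm_nonneg _) hr.le, Real.rpow_neg hr.le]; ring)
  refine this.trans (le_of_eq ?_)
  unfold cS; ring

/-- second a priori estimate -/
lemma est2 {m : ℕ} {F : EE m → ℝ} (hF : CB1 F) {B : ℝ} (hB0 : 0 ≤ B)
    (hB : ∀ x y, |F y - F x| ≤ B * ‖y - x‖ ^ (1/2 : ℝ)) (v w x y : EE m) :
    |pd w (pd v (GG 1 F)) y - pd w (pd v (GG 1 F)) x| ≤
      2 * (B * (‖v‖ * ‖w‖ * c1 m)) * cS (-(3/4)) * ‖y - x‖ ^ (1/4 : ℝ) := by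
  rw [GG_pdpd one_pos hF]
  obtain ⟨S, hS⟩ := hF.2
  obtain ⟨B', hB'⟩ := hF.pd_bound w
  have := AA_diff_bound (v := v) (pd_continuous hF.1 w) hB' x y
    (D := 2 * (B * (‖v‖ * ‖w‖ * c1 m)) * ‖y - x‖ ^ (1/4 : ℝ)) (s := -(3/4)) (by norm_num) (fun r hr => by
      have e : ∀ x, ∫ z, g1 v z * pd w F (x + r • z) =
          r⁻¹ * ∫ z, g2 v w z * (F (x + r • z) - F x) := by
        intro x
        have h1 := ibp_g1 hF x v w r
        have h2 : ∫ z, g2 v w z * (F (x + r • z) - F x) = ∫ z, g2 v w z * F (x + r • z) := by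
          simp only [mul_sub]
          rw [integral_sub, integral_mul_const, integral_g2]
          · ring
          · exact integrable_mul_bdd (g2_integrable v w) (hF.1.continuous.comp (by fun_prop)).aestronglyMeasurable fun z => (hS _).1
          · exact (g2_integrable v w).mul_const _
        rw [h2, ← h1, ← integral_const_mul]
        refine integral_congr_ae (Eventually.of_forall fun z => ?_)
        simp only; field_simp
      have hInteg : ∀ x, Integrable fun z => g2 v w z * (F (x + r • z) - F x) := fun x =>
        integrable_mul_bdd (g2_integrable v w) (((hF.1.continuous.comp (by fun_prop)).sub continuous_const).aestronglyMeasurable) (B := S + S) fun z => (abs_sub _ _).trans (add_le_add (hS _).1 (hS _).1)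
      rw [e y, e x, ← mul_sub, ← integral_sub (hInteg y) (hInteg x), abs_mul, abs_of_pos (inv_pos.2 hr)]
      have hb : |∫ z, (g2 v w z * (F (y + r • z) - F y) - g2 v w z * (F (x + r • z) - F x))| ≤
          2 * B * (r * ‖y - x‖) ^ (1/4 : ℝ) * (‖v‖ * ‖w‖ * c1 m) := by
        unfold c1
        rw [← integral_const_mul, ← integral_const_mul, ← Real.norm_eq_abs]
        refine norm_integral_le_of_norm_le ((gmaj_integrable.const_mul _).const_mul _)
          (Eventually.of_forall fun z => ?_)
        rw [← mul_sub, norm_mul, Real.norm_eq_abs, Real.norm_eq_abs]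
        have hD : |F (y + r • z) - F y - (F (x + r • z) - F x)| ≤
            2 * B * ((r * ‖z‖) * ‖y - x‖) ^ (1/4 : ℝ) := by
          have := interp (X := |F (y + r • z) - F y - (F (x + r • z) - F x)|) (P := 2 * B)
            (a := r * ‖z‖) (b := ‖y - x‖) (s := 1/2) (by positivity) (by positivity) (by positivity)
            (by norm_num) ?_ ?_
          · norm_num at this ⊢; exact this
          · have h1 := hB y (y + r • z)
            have h2 := hB x (x + r • z)
            simp only [add_sub_cancel_left, norm_smul, Real.norm_of_nonneg hr.le] at h1 h2
            exact (abs_sub _ _).trans (by linarith)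
          · have h1 := hB x y
            have h2 := hB (x + r • z) (y + r • z)
            simp only [add_sub_add_right_eq_sub] at h2
            rw [show F (y + r • z) - F y - (F (x + r • z) - F x) =
              (F (y + r • z) - F (x + r • z)) - (F y - F x) by ring]
            exact (abs_sub _ _).trans (by linarith)
        have hz : ‖z‖ ^ (1/4 : ℝ) ≤ 1 + ‖z‖ := by
          calc ‖z‖ ^ (1/4 : ℝ) ≤ (1 + ‖z‖) ^ (1/4 : ℝ) := by
                have := norm_nonneg z
                gcongr; linarith
            _ ≤ (1 + ‖z‖) ^ (1 : ℝ) := by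
                apply Real.rpow_le_rpow_of_exponent_le
                · linarith [norm_nonneg z]
                · norm_num
            _ = _ := Real.rpow_one _
        have e3 : ((r * ‖z‖) * ‖y - x‖) ^ (1/4 : ℝ) = (r * ‖y - x‖) ^ (1/4 : ℝ) * ‖z‖ ^ (1/4 : ℝ) := by
          rw [← Real.mul_rpow (by positivity) (by positivity)]; congr 1; ring
        rw [e3] at hD
        calc |g2 v w z| * |F (y + r • z) - F y - (F (x + r • z) - F x)|
            ≤ |g2 v w z| * (2 * B * ((r * ‖y - x‖) ^ (1/4 : ℝ) * (1 + ‖z‖))) := by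
              gcongr
              refine hD.trans ?_
              gcongr
          _ = 2 * B * (r * ‖y - x‖) ^ (1/4 : ℝ) * (|g2 v w z| * (1 + ‖z‖)) := by ring
          _ ≤ 2 * B * (r * ‖y - x‖) ^ (1/4 : ℝ) * (‖v‖ * ‖w‖ * gmaj z) := by
              gcongr ?_ * ?_
              exact g2_bound' v w z
      calc _ ≤ r⁻¹ * (2 * B * (r * ‖y - x‖) ^ (1/4 : ℝ) * (‖v‖ * ‖w‖ * c1 m)) := by gcongr
        _ = _ := by
          rw [Real.mul_rpow hr.le (norm_nonneg _), show (-(3/4) : ℝ) = 1/4 - 1 by norm_num,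
            Real.rpow_sub hr, Real.rpow_one]
          ring)
  refine this.trans (le_of_eq ?_)
  unfold cS; ring

end

section
open Filter Topology MeasureTheory Set

def LB {m : ℕ} (g : ℕ → EE m → ℝ) : Prop :=
  ∀ R : ℝ, ∃ M : ℝ, 0 ≤ M ∧ ∀ n, ∀ x, ‖x‖ ≤ R → |g n x| ≤ M

def LHa {m : ℕ} (α : ℝ) (g : ℕ → EE m → ℝ) : Prop :=
  ∀ R : ℝ, ∃ M : ℝ, 0 ≤ M ∧ ∀ n, ∀ x y, ‖x‖ ≤ R → ‖y‖ ≤ R → |g n y - g n x| ≤ M * ‖y - x‖ ^ α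

def Cut {m : ℕ} (a : EE m → ℝ) : Prop := ContDiff ℝ 1 a ∧ HasCompactSupport a

lemma CB1.of_cut {m : ℕ} {F : EE m → ℝ} (h : Cut F) : CB1 F := by
  refine ⟨h.1, ?_⟩
  obtain ⟨A, hA⟩ := h.1.continuous.bounded_above_of_compact_support h.2
  obtain ⟨B, hB⟩ := (h.1.continuous_fderiv (by norm_num)).bounded_above_of_compact_support
    (h.2.fderiv (𝕜 := ℝ))
  exact ⟨max A B, fun x => ⟨(hA x).trans (le_max_left _ _), (hB x).trans (le_max_right _ _)⟩⟩

lemma Cut.mul {m : ℕ} {a b : EE m → ℝ} (h : Cut a) (hb : ContDiff ℝ 1 b) :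
    Cut (fun x => a x * b x) := ⟨h.1.mul hb, h.2.mul_right⟩

lemma Cut.add {m : ℕ} {a b : EE m → ℝ} (h : Cut a) (hb : Cut b) :
    Cut (fun x => a x + b x) := ⟨h.1.add hb.1, h.2.add hb.2⟩

lemma Cut.const_mul {m : ℕ} {a : EE m → ℝ} (h : Cut a) (c : ℝ) :
    Cut (fun x => c * a x) := ⟨contDiff_const.mul h.1, h.2.mul_left⟩

lemma Cut.sum {m : ℕ} {ι : Type*} (s : Finset ι) {a : ι → EE m → ℝ} (h : ∀ i, Cut (a i)) :
    Cut (fun x => ∑ i ∈ s, a i x) := by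
  classical
  induction s using Finset.induction with
  | empty =>
    simp only [Finset.sum_empty]
    exact ⟨contDiff_const, HasCompactSupport.zero⟩
  | insert i s hi ih =>
    simp only [Finset.sum_insert hi]
    exact (h i).add ih

lemma Cut.props {m : ℕ} {a : EE m → ℝ} (h : Cut a) : ∃ R A : ℝ, 0 ≤ A ∧ (∀ x, R < ‖x‖ → a x = 0) ∧
    (∀ x, |a x| ≤ A) ∧ ∀ x y, |a y - a x| ≤ 2 * A * ‖y - x‖ ^ (1/2 : ℝ) := by
  obtain ⟨R, hR⟩ := h.2.isCompact.isBounded.subset_closedBall 0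
  obtain ⟨-, A, hA⟩ := CB1.of_cut h
  have hA0 : 0 ≤ A := (abs_nonneg _).trans (hA 0).1
  refine ⟨R, A, hA0, fun x hx => ?_, fun x => (hA x).1, fun x y => ?_⟩
  · by_contra hne
    have := hR (subset_tsupport a hne)
    simp at this
    linarith
  · have h1 : |a y - a x| ≤ A * ‖y - x‖ :=
      convex_univ.norm_image_sub_le_of_norm_fderiv_le (fun x _ => C1.diff h.1 x)
        (fun x _ => (hA x).2) (mem_univ x) (mem_univ y)
    have := interp (X := |a y - a x|) (P := 2 * A) (a := 1) (b := ‖y - x‖) (s := 1) (by positivity)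
      (by norm_num) (by positivity) (by norm_num) ?_ ?_
    · simpa using this
    · simp only [Real.rpow_one]
      refine (abs_sub _ _).trans ?_
      linarith [(hA x).1, (hA y).1]
    · simp only [Real.rpow_one]
      nlinarith [norm_nonneg (y - x), mul_nonneg hA0 (norm_nonneg (y - x))]

lemma cutB {m : ℕ} {a : EE m → ℝ} (h : Cut a) {b : ℕ → EE m → ℝ} (hb : LB b) :
    ∃ C, 0 ≤ C ∧ ∀ n x, |a x * b n x| ≤ C := by
  obtain ⟨R, A, hA0, h0, hA, -⟩ := h.props
  obtain ⟨M, hM0, hM⟩ := hb R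
  refine ⟨A * M, by positivity, fun n x => ?_⟩
  rcases le_or_gt ‖x‖ R with hx | hx
  · rw [abs_mul]; gcongr
    · exact hA x
    · exact hM n x hx
  · rw [h0 x hx]; simp; positivity

lemma cutH {m : ℕ} {a : EE m → ℝ} (h : Cut a) {b : ℕ → EE m → ℝ} (hb : LB b) (hb2 : LHa (1/2) b) :
    ∃ C, 0 ≤ C ∧ ∀ n x y, |a y * b n y - a x * b n x| ≤ C * ‖y - x‖ ^ (1/2 : ℝ) := by
  obtain ⟨R, A, hA0, h0, hA, hL⟩ := h.props
  obtain ⟨M, hM0, hM⟩ := hb R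
  obtain ⟨N, hN0, hN⟩ := hb2 R
  refine ⟨A * N + 2 * A * M, by positivity, fun n x y => ?_⟩
  have ht : 0 ≤ ‖y - x‖ ^ (1/2 : ℝ) := by positivity
  have key : ∀ x y, ‖x‖ ≤ R → |a y * b n x - a x * b n x| ≤ 2 * A * M * ‖y - x‖ ^ (1/2 : ℝ) := by
    intro x y hx
    rw [← sub_mul, abs_mul]
    calc _ ≤ (2 * A * ‖y - x‖ ^ (1/2 : ℝ)) * M := by
          gcongr
          · exact hL x y
          · exact hM n x hx
      _ = _ := by ring
  have hz : 0 ≤ A * N * ‖y - x‖ ^ (1/2 : ℝ) := by positivity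
  rcases le_or_gt ‖x‖ R with hx | hx
  · have k1 := key x y hx
    rcases le_or_gt ‖y‖ R with hy | hy
    · have : |a y * (b n y - b n x)| ≤ A * (N * ‖y - x‖ ^ (1/2 : ℝ)) := by
        rw [abs_mul]; gcongr
        · exact hA y
        · exact hN n x y hx hy
      rw [show a y * b n y - a x * b n x = a y * (b n y - b n x) + (a y * b n x - a x * b n x) by ring]
      refine (abs_add_le _ _).trans ?_
      linarith
    · rw [h0 y hy] at k1 ⊢
      simp only [zero_mul] at k1 ⊢
      linarith
  · rcases le_or_gt ‖y‖ R with hy | hy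
    · have k1 := key y x hy
      rw [h0 x hx] at k1 ⊢
      simp only [zero_mul, sub_zero, zero_sub, abs_neg] at k1 ⊢
      rw [norm_sub_rev]
      rw [norm_sub_rev] at hz
      linarith
    · rw [h0 x hx, h0 y hy]; simp; positivity

/-- cutoff -/
lemma exists_cut (m : ℕ) (R : ℝ) (hR : 0 ≤ R) : ∃ χ : EE m → ℝ, ContDiff ℝ 3 χ ∧ HasCompactSupport χ ∧
    (∀ x, ‖x‖ < R + 1 → χ x = 1) ∧ (∀ x, R + 2 ≤ ‖x‖ → χ x = 0) ∧ (∀ x, 0 ≤ χ x) ∧ (∀ x, χ x ≤ 1) := by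
  let b : ContDiffBump (0 : EE m) := ⟨R + 1, R + 2, by linarith, by linarith⟩
  refine ⟨b, b.contDiff, b.hasCompactSupport, fun x hx => ?_, fun x hx => ?_, fun x => b.nonneg, fun x => b.le_one⟩
  · apply b.one_of_mem_closedBall
    simpa [b] using hx.le
  · apply b.zero_of_le_dist
    simpa [b] using hx

lemma cut_pd {m : ℕ} {χ : EE m → ℝ} (h : ContDiff ℝ 2 χ) (hs : HasCompactSupport χ) (v : EE m) :
    Cut (pd v χ) := ⟨pd_contDiff h v, (hs.fderiv_apply (𝕜 := ℝ) v)⟩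

lemma pd_contDiff2 {m : ℕ} {φ : EE m → ℝ} (h : ContDiff ℝ 3 φ) (v : EE m) :
    ContDiff ℝ 2 (pd v φ) := by
  unfold pd
  exact (h.fderiv_right (m := 2) (by norm_num)).clm_apply contDiff_const

lemma cut_lpl {m : ℕ} {χ : EE m → ℝ} (h : ContDiff ℝ 3 χ) (hs : HasCompactSupport χ) :
    Cut (lpl χ) :=
  Cut.sum _ fun i => cut_pd (pd_contDiff2 h _) (hs.fderiv_apply (𝕜 := ℝ) _) _

/-- the localized right-hand side -/
noncomputable def FF {m : ℕ} (χ φ : EE m → ℝ) (x : EE m) : ℝ :=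
  χ x * φ x + ((-(1/2)) * (χ x * lpl φ x) + ((-1) * (∑ i, pd (ee i) χ x * pd (ee i) φ x) +
    (-(1/2)) * (lpl χ x * φ x)))

lemma FF_cut {m : ℕ} {χ φ : EE m → ℝ} (h : ContDiff ℝ 3 χ) (hs : HasCompactSupport χ)
    (hφ : ContDiff ℝ 2 φ) (hl : ContDiff ℝ 1 (lpl φ)) : Cut (FF χ φ) := by
  have hc : Cut χ := ⟨h.of_le (by norm_num), hs⟩
  have h2 : ContDiff ℝ 2 χ := h.of_le (by norm_num)
  exact (hc.mul (C2.c1 hφ)).add (((hc.mul hl).const_mul _).add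
    (((Cut.sum _ fun i => (cut_pd h2 hs _).mul (pd_contDiff hφ _)).const_mul _).add
    (((cut_lpl h hs).mul (C2.c1 hφ)).const_mul _)))

lemma FF_rep {m : ℕ} {χ φ : EE m → ℝ} (h : ContDiff ℝ 3 χ) (hs : HasCompactSupport χ)
    (hφ : ContDiff ℝ 2 φ) (hl : ContDiff ℝ 1 (lpl φ)) :
    (fun x => χ x * φ x) = GG 1 (FF χ φ) := by
  have h2 : ContDiff ℝ 2 χ := h.of_le (by norm_num)
  have hc : Cut χ := ⟨h.of_le (by norm_num), hs⟩
  obtain ⟨-, S, hS⟩ := CB1.of_cut (hc.mul (C2.c1 hφ))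
  refine GG_unique one_pos (CB1.of_cut (FF_cut h hs hφ hl)) (h2.mul hφ) (fun x => (hS x).1) fun x => ?_
  rw [lp_mul h2 hφ]
  unfold FF; ring

lemma fin_bound {ι X : Type*} [Fintype ι] (f : ι → X → ℝ) (w : X → ℝ) (h : ∀ i, ∃ C, 0 ≤ C ∧ ∀ x, |f i x| ≤ C * w x) :
    ∃ C, 0 ≤ C ∧ ∀ x, |∑ i, f i x| ≤ C * w x := by
  choose C hC0 hC using h
  refine ⟨∑ i, C i, Finset.sum_nonneg fun i _ => hC0 i, fun x => ?_⟩
  refine (Finset.abs_sum_le_sum_abs _ _).trans ?_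
  rw [Finset.sum_mul]
  exact Finset.sum_le_sum fun i _ => hC i x

structure Fam {m : ℕ} (φ : ℕ → EE m → ℝ) : Prop where
  c2 : ∀ n, ContDiff ℝ 2 (φ n)
  l1 : ∀ n, ContDiff ℝ 1 (lpl (φ n))
  b0 : LB φ
  b1 : LB (fun n x => ‖gradient (φ n) x‖)
  b2 : LB (fun n => lpl (φ n))

lemma LB_pd {m : ℕ} {φ : ℕ → EE m → ℝ} (h : LB (fun n x => ‖gradient (φ n) x‖)) (v : EE m) :
    LB (fun n => pd v (φ n)) := by
  intro R
  obtain ⟨M, hM0, hM⟩ := h R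
  refine ⟨M * ‖v‖, by positivity, fun n x hx => (abs_pd_le _ _ _).trans ?_⟩
  gcongr
  exact (le_abs_self _).trans (hM n x hx)

lemma Fam.FF_bound {m : ℕ} {φ : ℕ → EE m → ℝ} (H : Fam φ) {χ : EE m → ℝ} (h : ContDiff ℝ 3 χ)
    (hs : HasCompactSupport χ) : ∃ C, 0 ≤ C ∧ ∀ n x, |FF χ (φ n) x| ≤ C := by
  have h2 : ContDiff ℝ 2 χ := h.of_le (by norm_num)
  have hc : Cut χ := ⟨h.of_le (by norm_num), hs⟩
  obtain ⟨C1, p1, hC1⟩ := cutB hc H.b0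
  obtain ⟨C2, p2, hC2⟩ := cutB hc H.b2
  obtain ⟨C3, p3, hC3⟩ := cutB (cut_lpl h hs) H.b0
  obtain ⟨C4, p4, hC4⟩ := fin_bound (fun i (p : ℕ × EE m) => pd (ee i) χ p.2 * pd (ee i) (φ p.1) p.2)
    (fun _ => 1) fun i => by
      obtain ⟨C, h, h'⟩ := cutB (cut_pd h2 hs (ee i)) (LB_pd H.b1 (ee i))
      exact ⟨C, h, fun p => by simpa using h' p.1 p.2⟩
  refine ⟨C1 + C2 + C3 + C4, by positivity, fun n x => ?_⟩
  have a1 := abs_le.1 (hC1 n x)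
  have a2 := abs_le.1 (hC2 n x)
  have a3 := abs_le.1 (hC3 n x)
  have a4 := abs_le.1 (hC4 (n, x))
  unfold FF
  simp only [mul_one] at a4
  rw [abs_le]
  constructor <;> linarith [a1.1, a1.2, a2.1, a2.2, a3.1, a3.2, a4.1, a4.2]

lemma LHa_of_grad {m : ℕ} {φ : ℕ → EE m → ℝ} (hd : ∀ n, Differentiable ℝ (φ n))
    (h : LB (fun n x => ‖gradient (φ n) x‖)) : LHa (1/2) φ := by
  intro R
  obtain ⟨M, hM0, hM⟩ := h R
  refine ⟨M * (2 * |R|) ^ (1/2 : ℝ), by positivity, fun n x y hx hy => ?_⟩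
  have h1 : |φ n y - φ n x| ≤ M * ‖y - x‖ :=
    (convex_closedBall (0 : EE m) R).norm_image_sub_le_of_norm_fderiv_le (fun x _ => hd n x)
      (fun x hx => by
        rw [← norm_gradient]; exact (le_abs_self _).trans (hM n x (by simpa using hx)))
        (by simpa using hx) (by simpa using hy)
  refine h1.trans ?_
  rw [mul_assoc]
  gcongr
  have h2 : ‖y - x‖ ≤ 2 * |R| := (norm_sub_le _ _).trans (by linarith [le_abs_self R])
  calc ‖y - x‖ = ‖y - x‖ ^ (1/2 : ℝ) * ‖y - x‖ ^ (1/2 : ℝ) := by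
        rw [← Real.rpow_add_of_nonneg (norm_nonneg _) (by norm_num) (by norm_num)]; norm_num
    _ ≤ _ := by gcongr

lemma Fam.FF_hol {m : ℕ} {φ : ℕ → EE m → ℝ} (H : Fam φ) (H1 : ∀ v, LHa (1/2) (fun n => pd v (φ n)))
    (H2 : LHa (1/2) (fun n => lpl (φ n))) {χ : EE m → ℝ} (h : ContDiff ℝ 3 χ)
    (hs : HasCompactSupport χ) : ∃ C, 0 ≤ C ∧ ∀ n x y,
      |FF χ (φ n) y - FF χ (φ n) x| ≤ C * ‖y - x‖ ^ (1/2 : ℝ) := by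
  have h2 : ContDiff ℝ 2 χ := h.of_le (by norm_num)
  have hc : Cut χ := ⟨h.of_le (by norm_num), hs⟩
  have H0 := LHa_of_grad (fun n => C2.diff (H.c2 n)) H.b1
  obtain ⟨C1, p1, hC1⟩ := cutH hc H.b0 H0
  obtain ⟨C2, p2, hC2⟩ := cutH hc H.b2 H2
  obtain ⟨C3, p3, hC3⟩ := cutH (cut_lpl h hs) H.b0 H0
  obtain ⟨C4, p4, hC4⟩ := fin_bound (fun i (p : ℕ × EE m × EE m) =>
    pd (ee i) χ p.2.2 * pd (ee i) (φ p.1) p.2.2 - pd (ee i) χ p.2.1 * pd (ee i) (φ p.1) p.2.1)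
    (fun p => ‖p.2.2 - p.2.1‖ ^ (1/2 : ℝ)) fun i => by
      obtain ⟨C, h, h'⟩ := cutH (cut_pd h2 hs (ee i)) (LB_pd H.b1 (ee i)) (H1 (ee i))
      exact ⟨C, h, fun p => by simpa using h' p.1 p.2.1 p.2.2⟩
  refine ⟨C1 + C2 + C3 + C4, by positivity, fun n x y => ?_⟩
  have a1 := abs_le.1 (hC1 n x y)
  have a2 := abs_le.1 (hC2 n x y)
  have a3 := abs_le.1 (hC3 n x y)
  have a4 := abs_le.1 (hC4 (n, x, y))
  unfold FF
  rw [Finset.sum_sub_distrib] at a4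
  simp only at a4
  have ht : 0 ≤ ‖y - x‖ ^ (1/2 : ℝ) := by positivity
  have q1 := mul_nonneg p1 ht
  have q2 := mul_nonneg p2 ht
  have q3 := mul_nonneg p3 ht
  have q4 := mul_nonneg p4 ht
  rw [abs_le]
  constructor <;> linarith [a1.1, a1.2, a2.1, a2.2, a3.1, a3.2, a4.1, a4.2]

lemma cut_eventually {m : ℕ} {R : ℝ} {χ φ : EE m → ℝ} (h1 : ∀ x, ‖x‖ < R + 1 → χ x = 1) {x : EE m}
    (hx : ‖x‖ ≤ R) : (fun x => χ x * φ x) =ᶠ[𝓝 x] φ := by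
  have : ∀ᶠ y in 𝓝 x, ‖y‖ < R + 1 :=
    continuous_norm.continuousAt.eventually_lt continuousAt_const (by linarith)
  filter_upwards [this] with y hy
  rw [h1 y hy, one_mul]

lemma pd_congr {m : ℕ} {φ ψ : EE m → ℝ} {x : EE m} (h : φ =ᶠ[𝓝 x] ψ) (v : EE m) :
    pd v φ =ᶠ[𝓝 x] pd v ψ := by
  filter_upwards [h.fderiv (𝕜 := ℝ)] with y hy
  unfold pd; rw [hy]

lemma Fam.loc1 {m : ℕ} {φ : ℕ → EE m → ℝ} (H : Fam φ) (v : EE m) :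
    LHa (1/2) (fun n => pd v (φ n)) := by
  intro R
  obtain ⟨χ, h3, hs, hone, -⟩ := exists_cut m |R| (abs_nonneg R)
  obtain ⟨C, hC0, hC⟩ := H.FF_bound h3 hs
  refine ⟨2 * (C * (‖v‖ * c1 m)) * cS (-(1/2)), ?_, fun n x y hx hy => ?_⟩
  · have := c1_nonneg m; have := cS_nonneg (-(1/2)); positivity
  · have hF := CB1.of_cut (FF_cut h3 hs (H.c2 n) (H.l1 n))
    have := est1 hF (hC n) v x y
    rw [← FF_rep h3 hs (H.c2 n) (H.l1 n)] at this
    rwa [(pd_congr (cut_eventually hone (hx.trans (le_abs_self R))) v).eq_of_nhds,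
      (pd_congr (cut_eventually hone (hy.trans (le_abs_self R))) v).eq_of_nhds] at this

lemma Fam.loc2 {m : ℕ} (hm : 1 ≤ m) {φ : ℕ → EE m → ℝ} (H : Fam φ)
    (H2 : LHa (1/2) (fun n => lpl (φ n))) (v w : EE m) :
    LHa (1/4) (fun n => pd w (pd v (φ n))) ∧ LB (fun n => pd w (pd v (φ n))) := by
  have key : ∀ R : ℝ, ∃ M, 0 ≤ M ∧ ∀ n, (∀ x y, ‖x‖ ≤ R → ‖y‖ ≤ R →
      |pd w (pd v (φ n)) y - pd w (pd v (φ n)) x| ≤ M * ‖y - x‖ ^ (1/4:ℝ)) ∧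
      ∀ x, ‖x‖ ≤ R → |pd w (pd v (φ n)) x| ≤ M * (2 * |R| + 3) ^ (1/4:ℝ) := by
    intro R
    obtain ⟨χ, h3, hs, hone, hzero, -⟩ := exists_cut m |R| (abs_nonneg R)
    obtain ⟨C, hC0, hC⟩ := H.FF_hol H.loc1 H2 h3 hs
    refine ⟨2 * (C * (‖v‖ * ‖w‖ * c1 m)) * cS (-(3/4)), ?_, fun n => ?_⟩
    · have := c1_nonneg m; have := cS_nonneg (-(3/4)); positivity
    have hF := CB1.of_cut (FF_cut h3 hs (H.c2 n) (H.l1 n))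
    have hloc : ∀ x, ‖x‖ ≤ R → pd w (pd v (fun x => χ x * φ n x)) x = pd w (pd v (φ n)) x :=
      fun x hx => (pd_congr (pd_congr (cut_eventually hone (hx.trans (le_abs_self R))) v) w).eq_of_nhds
    have hest := est2 hF hC0 (hC n) v w
    rw [← FF_rep h3 hs (H.c2 n) (H.l1 n)] at hest
    constructor
    · intro x y hx hy
      have := hest x y
      rwa [hloc x hx, hloc y hy] at this
    · intro x hx
      set y : EE m := (|R| + 3) • ee ⟨0, hm⟩ with hy
      have hyn : ‖y‖ = |R| + 3 := by
        rw [hy, norm_smul, norm_ee, Real.norm_of_nonneg (by positivity), mul_one]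
      have hev : (fun x => χ x * φ n x) =ᶠ[𝓝 y] fun _ => 0 := by
        have : ∀ᶠ z in 𝓝 y, |R| + 2 < ‖z‖ :=
          continuousAt_const.eventually_lt continuous_norm.continuousAt (by linarith)
        filter_upwards [this] with z hz
        rw [hzero z hz.le, zero_mul]
      have h0 : pd w (pd v (fun x => χ x * φ n x)) y = 0 := by
        rw [(pd_congr (pd_congr hev v) w).eq_of_nhds]
        unfold pd; simp
      have := hest y x
      rw [h0, sub_zero, hloc x hx] at this
      refine this.trans ?_
      have := c1_nonneg m; have := cS_nonneg (-(3/4))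
      gcongr
      refine (norm_sub_le _ _).trans ?_
      rw [hyn]; linarith [le_abs_self R]
  refine ⟨fun R => ?_, fun R => ?_⟩
  · obtain ⟨M, hM0, hM⟩ := key R
    exact ⟨M, hM0, fun n => (hM n).1⟩
  · obtain ⟨M, hM0, hM⟩ := key R
    exact ⟨_, by positivity, fun n => (hM n).2⟩

lemma LB.lim {m : ℕ} {g : ℕ → EE m → ℝ} (h : LB g) (l : Ultrafilter ℕ) :
    ∃ G : EE m → ℝ, ∀ x, Tendsto (fun n => g n x) l (𝓝 (G x)) := by
  have : ∀ x, ∃ y : ℝ, Tendsto (fun n => g n x) l (𝓝 y) := by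
    intro x
    obtain ⟨M, -, hM⟩ := h ‖x‖
    have hc : IsCompact (Icc (-M) M) := isCompact_Icc
    obtain ⟨y, -, hy⟩ := hc.ultrafilter_le_nhds (l.map fun n => g n x) (by
      rw [le_principal_iff]
      exact Eventually.of_forall (f := (l : Filter ℕ)) fun n => abs_le.1 (hM n x le_rfl))
    exact ⟨y, hy⟩
  choose G hG using this
  exact ⟨G, hG⟩

lemma lim_diff {m : ℕ} {g : ℕ → EE m → ℝ} (hg : ∀ n, ContDiff ℝ 1 (g n)) {α : ℝ} (hα : 0 < α)
    (hH : ∀ v, LHa α (fun n => pd v (g n))) (l : Filter ℕ) [l.NeBot] {G : EE m → ℝ}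
    (hG : ∀ x, Tendsto (fun n => g n x) l (𝓝 (G x))) {D : EE m → EE m → ℝ}
    (hD : ∀ v x, Tendsto (fun n => pd v (g n) x) l (𝓝 (D v x))) :
    ContDiff ℝ 1 G ∧ ∀ v, pd v G = D v := by
  have hDc : ∀ v, Continuous (D v) := by
    intro v
    rw [continuous_iff_continuousAt]
    intro x
    obtain ⟨M, hM0, hM⟩ := hH v (‖x‖ + 1)
    have hb : ∀ᶠ y in 𝓝 x, |D v y - D v x| ≤ M * ‖y - x‖ ^ α := by
      have : ∀ᶠ y in 𝓝 x, ‖y‖ < ‖x‖ + 1 :=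
        continuous_norm.continuousAt.eventually_lt continuousAt_const (by linarith)
      filter_upwards [this] with y hy
      exact le_of_tendsto ((hD v y).sub (hD v x)).abs
        (Eventually.of_forall fun n => hM n x y (by linarith) hy.le)
    have hz : Tendsto (fun y => M * ‖y - x‖ ^ α) (𝓝 x) (𝓝 0) := by
      have : Continuous fun y : EE m => M * ‖y - x‖ ^ α :=
        continuous_const.mul ((by fun_prop : Continuous fun y : EE m => ‖y - x‖).rpow_const fun _ => Or.inr hα.le)
      have := this.tendsto x
      simpa [Real.zero_rpow hα.ne'] using this
    rw [ContinuousAt, tendsto_iff_norm_sub_tendsto_zero]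
    exact squeeze_zero' (Eventually.of_forall fun _ => norm_nonneg _) hb hz
  have hder : ∀ x, ∃ L : EE m →L[ℝ] ℝ, HasFDerivAt G L x ∧ ∀ v, L v = D v x := by
    intro x
    let L0 : EE m →ₗ[ℝ] ℝ :=
      { toFun := fun v => D v x
        map_add' := fun v w => tendsto_nhds_unique (hD (v + w) x)
          (((hD v x).add (hD w x)).congr fun n => by simp [pd])
        map_smul' := fun c v => tendsto_nhds_unique (hD (c • v) x)
          (((hD v x).const_mul c).congr fun n => by simp [pd]) }
    refine ⟨LinearMap.toContinuousLinearMap L0, ?_, fun v => rfl⟩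
    have hu : ∃ C, 0 ≤ C ∧ ∀ n w, ‖w‖ ≤ 1 →
        |pd w (g n) (x + w) - pd w (g n) x| ≤ C * ‖w‖ ^ α * ‖w‖ ∧
        ∀ t ∈ Icc (0:ℝ) 1, |pd w (g n) (x + t • w) - pd w (g n) x| ≤ C * ‖w‖ ^ α * ‖w‖ := by
      choose M hM0 hM using fun i : Fin m => hH (ee i) (‖x‖ + 1)
      refine ⟨∑ i, M i, Finset.sum_nonneg fun i _ => hM0 i, fun n w hw => ?_⟩
      have hb : ∀ t ∈ Icc (0:ℝ) 1, |pd w (g n) (x + t • w) - pd w (g n) x| ≤ (∑ i, M i) * ‖w‖ ^ α * ‖w‖ := by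
        intro t ht
        have e : ∀ y, pd w (g n) y = ∑ i, w i * pd (ee i) (g n) y := by
          intro y
          unfold pd
          conv_lhs => rw [sum_ee w]
          rw [map_sum]; simp
        rw [e, e, ← Finset.sum_sub_distrib]
        refine (Finset.abs_sum_le_sum_abs _ _).trans ?_
        rw [Finset.sum_mul, Finset.sum_mul]
        refine Finset.sum_le_sum fun i _ => ?_
        rw [← mul_sub, abs_mul]
        have h1 : |w i| ≤ ‖w‖ := EuclideanSpace.norm_eq w ▸ (by
          have := PiLp.norm_apply_le w i
          rw [EuclideanSpace.norm_eq] at this; exact this)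
        have htw : ‖t • w‖ ≤ ‖w‖ := by
          rw [norm_smul, Real.norm_of_nonneg ht.1]
          exact mul_le_of_le_one_left (norm_nonneg _) ht.2
        have h2 := hM i n x (x + t • w) (by linarith) ((norm_add_le _ _).trans (by linarith))
        rw [add_sub_cancel_left] at h2
        have h3 : ‖t • w‖ ^ α ≤ ‖w‖ ^ α := by gcongr
        calc _ ≤ ‖w‖ * (M i * ‖t • w‖ ^ α) := by gcongr
          _ ≤ ‖w‖ * (M i * ‖w‖ ^ α) := by gcongr; exact hM0 i
          _ = _ := by ring
      exact ⟨by simpa using hb 1 (by simp), hb⟩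
    obtain ⟨C, hC0, hC⟩ := hu
    have ht : ∀ w : EE m, ‖w‖ ≤ 1 → |G (x + w) - G x - D w x| ≤ C * ‖w‖ ^ α * ‖w‖ := by
      intro w hw
      refine le_of_tendsto (((hG (x + w)).sub (hG x)).sub (hD w x)).abs (Eventually.of_forall fun n => ?_)
      have := norm_image_sub_le_of_norm_deriv_le_segment_01'
        (f := fun t : ℝ => g n (x + t • w) - t * pd w (g n) x)
        (f' := fun t => pd w (g n) (x + t • w) - 1 * pd w (g n) x) (C := C * ‖w‖ ^ α * ‖w‖)
        (fun t _ => ((hasDerivAt_line (C1.diff (hg n)) x w t).sub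
          ((hasDerivAt_id t).mul_const _)).hasDerivWithinAt) (fun t ht => by
            rw [one_mul]
            exact (hC n w hw).2 t ⟨ht.1, ht.2.le⟩)
      simp only [one_smul, zero_smul, add_zero, one_mul, zero_mul, sub_zero] at this
      rw [Real.norm_eq_abs] at this
      rwa [sub_right_comm] at this
    rw [hasFDerivAt_iff_isLittleO_nhds_zero, Asymptotics.isLittleO_iff]
    intro c hc
    have hz : Tendsto (fun w : EE m => C * ‖w‖ ^ α) (𝓝 0) (𝓝 0) := by
      have : Continuous fun w : EE m => C * ‖w‖ ^ α :=
        continuous_const.mul (continuous_norm.rpow_const fun _ => Or.inr hα.le)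
      have := this.tendsto 0
      simpa [Real.zero_rpow hα.ne'] using this
    filter_upwards [hz.eventually_lt_const hc, Metric.closedBall_mem_nhds (0 : EE m) one_pos] with w h1 h2
    refine (ht w (by simpa using h2)).trans ?_
    gcongr
  choose L hL hLD using hder
  have hpd : ∀ v, pd v G = D v := by
    intro v; funext x; unfold pd; rw [(hL x).fderiv, hLD]
  refine ⟨contDiff1_of_pd (fun x => (hL x).differentiableAt) fun v => ?_, hpd⟩
  rw [hpd]; exact hDc v

/-- compactness -/
lemma Fam.compact {m : ℕ} (hm : 1 ≤ m) {φ : ℕ → EE m → ℝ} (H : Fam φ)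
    (H2 : (∀ v, LHa (1/2) (fun n => pd v (φ n))) → LHa (1/2) (fun n => lpl (φ n)))
    (l : Ultrafilter ℕ) : ∃ ψ : EE m → ℝ, ContDiff ℝ 2 ψ ∧
      (∀ x, Tendsto (fun n => φ n x) l (𝓝 (ψ x))) ∧
      (∀ v x, Tendsto (fun n => pd v (φ n) x) l (𝓝 (pd v ψ x))) ∧
      (∀ x, Tendsto (fun n => lpl (φ n) x) l (𝓝 (lpl ψ x))) := by
  obtain ⟨ψ, hψ⟩ := H.b0.lim l
  choose D hD using fun v => (LB_pd H.b1 v).lim l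
  have h2 := H.loc2 hm (H2 H.loc1)
  choose E hE using fun v w => (h2 v w).2.lim l
  have a1 := lim_diff (fun n => C2.c1 (H.c2 n)) (by norm_num) H.loc1 l hψ hD
  have a2 := fun v => lim_diff (fun n => pd_contDiff (H.c2 n) v) (by norm_num) (fun w => (h2 v w).1) l (hD v) (hE v)
  refine ⟨ψ, contDiff2_of_pd (C1.diff a1.1) fun v => ?_, hψ, fun v x => ?_, fun x => ?_⟩
  · rw [a1.2 v]; exact (a2 v).1
  · rw [a1.2 v]; exact hD v x
  · unfold lpl
    refine tendsto_finsetSum _ fun i _ => ?_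
    rw [a1.2, (a2 _).2]; exact hE _ _ x

lemma grad_tendsto {m : ℕ} {φ : ℕ → EE m → ℝ} {ψ : EE m → ℝ} {l : Filter ℕ} {x : EE m}
    (h : ∀ v, Tendsto (fun n => pd v (φ n) x) l (𝓝 (pd v ψ x))) :
    Tendsto (fun n => gradient (φ n) x) l (𝓝 (gradient ψ x)) := by
  have e : ∀ f : EE m → ℝ, gradient f x = ∑ i, pd (ee i) f x • (ee i : EE m) := by
    intro f
    conv_lhs => rw [sum_ee (gradient f x)]
    simp [gradient_apply']
  simp only [e]
  exact tendsto_finsetSum _ fun i _ => (h _).smul_const _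

end

section
open Filter Topology MeasureTheory Set

lemma AA_CB1 {m : ℕ} {κ : ℝ × EE m → ℝ} (hκ : Integrable κ (nu m)) {F : EE m → ℝ}
    (hF : CB1 F) : CB1 (AA κ F) := by
  obtain ⟨B, hB⟩ := hF.2
  refine ⟨AA_C1 hκ hF, B * ∫ p, |κ p| ∂(nu m), fun x => ⟨AA_bound hκ (fun x => (hB x).1) x, ?_⟩⟩
  rw [(AA_hasFDerivAt hκ hF x).2.fderiv, ← integral_const_mul]
  refine norm_integral_le_of_norm_le (hκ.abs.const_mul B) (Eventually.of_forall fun p => ?_)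
  rw [norm_smul, Real.norm_eq_abs, mul_comm]; gcongr; exact (hB _).2

lemma GG_CB1 {m : ℕ} {K : ℝ} (hK : 0 < K) {F : EE m → ℝ} (hF : CB1 F) : CB1 (GG K F) :=
  AA_CB1 (k0_int hK) hF

lemma GG_pd_CB1 {m : ℕ} {K : ℝ} (hK : 0 < K) {F : EE m → ℝ} (hF : CB1 F) (v : EE m) :
    CB1 (pd v (GG K F)) := by
  rw [GG_pd hK hF]; exact AA_CB1 (k1_int hK v) hF

lemma gradient_sum {m : ℕ} (f : EE m → ℝ) (x : EE m) :
    gradient f x = ∑ i, pd (ee i) f x • (ee i : EE m) := by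
  conv_lhs => rw [sum_ee (gradient f x)]
  simp [gradient_apply']

lemma Cut.lip {m : ℕ} {H : EE m → ℝ} (h : Cut H) : ∃ L, 0 ≤ L ∧ (∀ p, |H p| ≤ L) ∧
    (∀ p, ‖fderiv ℝ H p‖ ≤ L) ∧ ∀ p q, |H p - H q| ≤ L * ‖p - q‖ := by
  obtain ⟨-, A, hA⟩ := CB1.of_cut h
  exact ⟨A, (abs_nonneg _).trans (hA 0).1, fun p => (hA p).1, fun p => (hA p).2, fun p q =>
    convex_univ.norm_image_sub_le_of_norm_fderiv_le (fun x _ => C1.diff h.1 x)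
        (fun x _ => (hA x).2) (mem_univ q) (mem_univ p)⟩

lemma H_CB1 {m : ℕ} {H : EE m → ℝ} (hH : Cut H) {φ : EE m → ℝ} (hφ : ContDiff ℝ 2 φ)
    (hp : ∀ v, CB1 (pd v φ)) : CB1 (fun x => H (gradient φ x)) := by
  obtain ⟨L, hL0, hL1, hL2, -⟩ := hH.lip
  have hg := gradient_contDiff hφ
  choose B hB using fun i : Fin m => (hp (ee i)).2
  refine ⟨hH.1.comp hg, L + L * ∑ i, B i, fun x => ⟨?_, ?_⟩⟩
  · have : 0 ≤ ∑ i, B i := Finset.sum_nonneg fun i _ => (abs_nonneg _).trans (hB i 0).1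
    exact (hL1 _).trans (by nlinarith)
  · have h1 : HasFDerivAt (gradient φ) (∑ i, (fderiv ℝ (pd (ee i) φ) x).smulRight (ee i : EE m)) x := by
      have : gradient φ = fun x => ∑ i, pd (ee i) φ x • (ee i : EE m) := by
        funext x; exact gradient_sum φ x
      rw [this]
      exact HasFDerivAt.fun_sum fun i _ => ((C1.diff (hp (ee i)).1 x).hasFDerivAt).smul_const _
    have h2 := (C1.diff hH.1 (gradient φ x)).hasFDerivAt.comp x h1
    have h3 : fderiv ℝ (fun x => H (gradient φ x)) x = _ := h2.fderiv
    rw [h3]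
    refine (ContinuousLinearMap.opNorm_comp_le _ _).trans ?_
    have h4 : ‖∑ i, (fderiv ℝ (pd (ee i) φ) x).smulRight (ee i : EE m)‖ ≤ ∑ i, B i := by
      refine (norm_sum_le _ _).trans (Finset.sum_le_sum fun i _ => ?_)
      rw [ContinuousLinearMap.norm_smulRight_apply, norm_ee, mul_one]
      exact (hB i x).2
    calc _ ≤ L * ∑ i, B i := by gcongr; exact hL2 _
      _ ≤ _ := by linarith

lemma CB1.sub {m : ℕ} {F G : EE m → ℝ} (hF : CB1 F) (hG : CB1 G) : CB1 (fun x => F x - G x) := by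
  obtain ⟨h1, A, hA⟩ := hF
  obtain ⟨h2, B, hB⟩ := hG
  refine ⟨h1.sub h2, A + B, fun x => ⟨(abs_sub _ _).trans (add_le_add (hA x).1 (hB x).1), ?_⟩⟩
  rw [fderiv_fun_sub (C1.diff h1 x) (C1.diff h2 x)]
  exact (norm_sub_le _ _).trans (add_le_add (hA x).2 (hB x).2)

lemma CB1.add_const_mul {m : ℕ} {F G : EE m → ℝ} (hF : CB1 F) (hG : CB1 G) (c : ℝ) :
    CB1 (fun x => F x + c * G x) := by
  obtain ⟨h1, A, hA⟩ := hF
  obtain ⟨h2, B, hB⟩ := hG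
  refine ⟨h1.add (contDiff_const.mul h2), A + |c| * B, fun x => ⟨(abs_add_le _ _).trans (add_le_add (hA x).1 ?_), ?_⟩⟩
  · rw [abs_mul]; gcongr; exact (hB x).1
  · rw [fderiv_fun_add (C1.diff h1 x) ((C1.diff h2 x).const_mul c), fderiv_const_mul (C1.diff h2 x)]
    refine (norm_add_le _ _).trans (add_le_add (hA x).2 ?_)
    rw [norm_smul]; gcongr
    · exact le_rfl
    · exact (hB x).2

lemma GG_sub {m : ℕ} {K : ℝ} (hK : 0 < K) {F G : EE m → ℝ} (hF : CB1 F) (hG : CB1 G) (x : EE m) :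
    GG K F x - GG K G x = GG K (fun x => F x - G x) x := by
  obtain ⟨A, hA⟩ := hF.2
  obtain ⟨B, hB⟩ := hG.2
  unfold GG AA
  rw [← integral_sub (AA_int (k0_int hK) hF.1.continuous (fun x => (hA x).1) x)
    (AA_int (k0_int hK) hG.1.continuous (fun x => (hB x).1) x)]
  simp only [mul_sub]

lemma grad_le {m : ℕ} {φ : EE m → ℝ} {x : EE m} {C : ℝ} (hC : 0 ≤ C) (h : ∀ v, |pd v φ x| ≤ C * ‖v‖) :
    ‖gradient φ x‖ ≤ C := by
  rw [norm_gradient]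
  exact ContinuousLinearMap.opNorm_le_bound _ hC h

lemma lip_ball {m : ℕ} {H : EE m → ℝ} (hH : ContDiff ℝ 1 H) (R : ℝ) : ∃ L, 0 ≤ L ∧
    (∀ p, ‖p‖ ≤ R → |H p| ≤ L) ∧ ∀ p q, ‖p‖ ≤ R → ‖q‖ ≤ R → |H p - H q| ≤ L * ‖p - q‖ := by
  have hc := isCompact_closedBall (0 : EE m) R
  obtain ⟨A, hA⟩ := hc.exists_bound_of_continuousOn (f := fderiv ℝ H) (hH.continuous_fderiv (by norm_num)).continuousOn
  obtain ⟨B, hB⟩ := hc.exists_bound_of_continuousOn hH.continuous.continuousOn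
  refine ⟨max (max A B) 0, le_max_right _ _, fun p hp => ?_, fun p q hp hq => ?_⟩
  · exact (hB p (by simpa using hp)).trans ((le_max_right _ _).trans (le_max_left _ _))
  · exact (convex_closedBall (0 : EE m) R).norm_image_sub_le_of_norm_fderiv_le (fun x _ => C1.diff hH x)
      (fun x hx => (hA x hx).trans ((le_max_left _ _).trans (le_max_left _ _)))
      (by simpa using hq) (by simpa using hp)

lemma LB_comp {m : ℕ} {H : EE m → ℝ} (hH : ContDiff ℝ 1 H) {φ : ℕ → EE m → ℝ}
    (h : LB (fun n x => ‖gradient (φ n) x‖)) : LB (fun n x => H (gradient (φ n) x)) := by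
  intro R
  obtain ⟨M, hM0, hM⟩ := h R
  obtain ⟨L, hL0, hL, -⟩ := lip_ball hH M
  exact ⟨L, hL0, fun n x hx => hL _ ((le_abs_self _).trans (hM n x hx))⟩

lemma LHa_comp {m : ℕ} {H : EE m → ℝ} (hH : ContDiff ℝ 1 H) {φ : ℕ → EE m → ℝ} {α : ℝ}
    (h : LB (fun n x => ‖gradient (φ n) x‖)) (h2 : ∀ v, LHa α (fun n => pd v (φ n))) :
    LHa α (fun n x => H (gradient (φ n) x)) := by
  intro R
  obtain ⟨M, hM0, hM⟩ := h R
  obtain ⟨L, hL0, -, hL⟩ := lip_ball hH M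
  choose N hN0 hN using fun i : Fin m => h2 (ee i) R
  have hs : 0 ≤ ∑ i, N i := Finset.sum_nonneg fun i _ => hN0 i
  refine ⟨L * ∑ i, N i, by positivity, fun n x y hx hy => ?_⟩
  refine (hL _ _ ((le_abs_self _).trans (hM n y hy)) ((le_abs_self _).trans (hM n x hx))).trans ?_
  rw [mul_assoc]
  gcongr
  rw [gradient_sum, gradient_sum, ← Finset.sum_sub_distrib, Finset.sum_mul]
  refine (norm_sum_le _ _).trans (Finset.sum_le_sum fun i _ => ?_)
  rw [← sub_smul, norm_smul, norm_ee, mul_one]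
  exact hN i n x y hx hy

lemma LHa.add_mul {m : ℕ} {α : ℝ} {f g : ℕ → EE m → ℝ} (hf : LHa α f) (hg : LHa α g) (a b : ℝ) :
    LHa α (fun n x => a * f n x + b * g n x) := by
  intro R
  obtain ⟨M, hM0, hM⟩ := hf R
  obtain ⟨N, hN0, hN⟩ := hg R
  refine ⟨|a| * M + |b| * N, by positivity, fun n x y hx hy => ?_⟩
  have h1 := hM n x y hx hy
  have h2 := hN n x y hx hy
  rw [show a * f n y + b * g n y - (a * f n x + b * g n x) =
    a * (f n y - f n x) + b * (g n y - g n x) by ring]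
  refine (abs_add_le _ _).trans ?_
  rw [abs_mul, abs_mul, _root_.add_mul, mul_assoc, mul_assoc]
  gcongr

lemma LB.add_mul {m : ℕ} {f g : ℕ → EE m → ℝ} (hf : LB f) (hg : LB g) (a b : ℝ) :
    LB (fun n x => a * f n x + b * g n x) := by
  intro R
  obtain ⟨M, hM0, hM⟩ := hf R
  obtain ⟨N, hN0, hN⟩ := hg R
  refine ⟨|a| * M + |b| * N, by positivity, fun n x hx => ?_⟩
  have h1 := hM n x hx
  have h2 := hN n x hx
  refine (abs_add_le _ _).trans ?_
  rw [abs_mul, abs_mul]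
  gcongr

lemma LHa_of_C1 {m : ℕ} {g : EE m → ℝ} (hg : ContDiff ℝ 1 g) : LHa (1/2) (fun _ : ℕ => g) := by
  refine LHa_of_grad (fun _ => C1.diff hg) fun R => ?_
  obtain ⟨A, hA⟩ := (isCompact_closedBall (0 : EE m) R).exists_bound_of_continuousOn (gradient_continuous hg).continuousOn
  exact ⟨max A 0, le_max_right _ _, fun n x hx => by
    rw [abs_norm]; exact (hA x (by simpa using hx)).trans (le_max_left _ _)⟩

lemma LB_of_cont {m : ℕ} {g : EE m → ℝ} (hg : Continuous g) : LB (fun _ : ℕ => g) := by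
  intro R
  obtain ⟨A, hA⟩ := (isCompact_closedBall (0 : EE m) R).exists_bound_of_continuousOn hg.continuousOn
  exact ⟨max A 0, le_max_right _ _, fun n x hx => (hA x (by simpa using hx)).trans (le_max_left _ _)⟩

lemma LB_of_bdd {m : ℕ} {g : ℕ → EE m → ℝ} {S : ℝ} (h : ∀ n x, |g n x| ≤ S) : LB g := fun R =>
  ⟨S, (abs_nonneg _).trans (h 0 0), fun n x _ => h n x⟩

lemma LB.congr {m : ℕ} {f g : ℕ → EE m → ℝ} (hf : LB f) (h : ∀ n x, f n x = g n x) : LB g := by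
  have : f = g := by funext n x; exact h n x
  rwa [← this]

lemma LHa.congr {m : ℕ} {α : ℝ} {f g : ℕ → EE m → ℝ} (hf : LHa α f) (h : ∀ n x, f n x = g n x) : LHa α g := by
  have : f = g := by funext n x; exact h n x
  rwa [← this]

/-- shifting families -/
lemma LHa.unshift {m : ℕ} {α : ℝ} {f : ℕ → EE m → ℝ} (h0 : f 0 = 0) (h : LHa α (fun n => f (n+1))) :
    LHa α f := by
  intro R
  obtain ⟨M, hM0, hM⟩ := h R
  refine ⟨M, hM0, fun n x y hx hy => ?_⟩
  cases n with
  | zero => rw [h0]; simp; positivity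
  | succ k => exact hM k x y hx hy

/-- one step of the inner iteration -/
noncomputable def TT {m : ℕ} (K : ℝ) (H g φ : EE m → ℝ) : EE m → ℝ :=
  GG K (fun x => g x - H (gradient φ x))

lemma inner_exists {m : ℕ} (hm : 1 ≤ m) {H : EE m → ℝ} (hH : Cut H) (hH0 : H 0 = 0) {L : ℝ}
    (hL0 : 0 ≤ L) (hHb : ∀ p, |H p| ≤ L) (hL : ∀ p q, |H p - H q| ≤ L * ‖p - q‖) {K : ℝ} (hK : 0 < K)
    (hKL : L * (Real.sqrt (Real.pi / K) * c1 m) ≤ 1/2) {g : EE m → ℝ} (hg : CB1 g) :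
    ∃ φ : EE m → ℝ, ContDiff ℝ 2 φ ∧ (∃ S, ∀ x, |φ x| ≤ S) ∧
      ∀ x, K * φ x - (1/2) * lpl φ x + H (gradient φ x) = g x := by
  have hc := c1_nonneg m
  set c : ℝ := Real.sqrt (Real.pi / K) * c1 m with hcdef
  have hc0 : 0 ≤ c := by positivity
  set P : ℕ → EE m → ℝ := fun n => (TT K H g)^[n] 0 with hP
  have hPs : ∀ n, P (n+1) = TT K H g (P n) := fun n => Function.iterate_succ_apply' _ _ _
  have hP0 : P 0 = 0 := rfl
  have hpd0 : ∀ v : EE m, pd v (0 : EE m → ℝ) = fun _ => 0 := by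
    intro v; funext x; unfold pd
    rw [show (0 : EE m → ℝ) = fun _ => 0 from rfl]; simp
  have hzero : CB1 (fun _ : EE m => (0:ℝ)) := ⟨contDiff_const, 0, by simp⟩
  have hinv : ∀ n, ContDiff ℝ 2 (P n) ∧ ∀ v, CB1 (pd v (P n)) := by
    intro n
    induction n with
    | zero =>
      rw [hP0]
      refine ⟨contDiff_const, fun v => ?_⟩
      rw [hpd0]; exact hzero
    | succ n ih =>
      rw [hPs]
      have := hg.sub (H_CB1 hH ih.1 ih.2)
      exact ⟨GG_C2 hK this, GG_pd_CB1 hK this⟩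
  have hF : ∀ n, CB1 (fun x => g x - H (gradient (P n) x)) := fun n =>
    hg.sub (H_CB1 hH (hinv n).1 (hinv n).2)
  obtain ⟨B, hB⟩ := hg.2
  have hB0 : 0 ≤ B := (abs_nonneg _).trans (hB 0).1
  have hFb : ∀ n x, |g x - H (gradient (P n) x)| ≤ B + L := fun n x =>
    (abs_sub _ _).trans (add_le_add (hB x).1 (hHb _))
  have hgrad : ∀ n x, ‖gradient (P (n+1)) x‖ ≤ (B + L) * c := by
    intro n x
    refine grad_le (by positivity) fun v => ?_
    rw [hPs]
    refine (GG_pd_bound hK (hF n) (by positivity) (hFb n) v x).trans (le_of_eq ?_)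
    rw [hcdef]; ring
  have hbd : ∀ n x, |P (n+1) x| ≤ (B + L) * ∫ p, |k0 K p| ∂(nu m) := by
    intro n x
    rw [hPs]
    exact AA_bound (k0_int hK) (hFb n) x
  have hg0 : ∀ x, gradient (P 0) x = 0 := by
    intro x; rw [hP0, gradient_sum]; simp [hpd0]
  -- contraction
  have hcon : ∀ n x, ‖gradient (P (n+1)) x - gradient (P n) x‖ ≤ ((B + L) * c) * (1/2) ^ n := by
    intro n
    induction n with
    | zero => intro x; rw [hg0, sub_zero]; simpa using hgrad 0 x
    | succ n ih =>
      intro x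
      rw [← gradient_sub' (C2.diff (hinv (n+2)).1) (C2.diff (hinv (n+1)).1)]
      refine grad_le (by positivity) fun v => ?_
      have e : (fun x => P (n+2) x - P (n+1) x) = GG K (fun x => (g x - H (gradient (P (n+1)) x)) - (g x - H (gradient (P n) x))) := by
        funext x
        rw [← GG_sub hK (hF (n+1)) (hF n), hPs (n+1), hPs n]; rfl
      rw [e]
      refine (GG_pd_bound hK ((hF (n+1)).sub (hF n)) (B := L * (((B + L) * c) * (1/2) ^ n)) (by positivity) (fun y => ?_) v x).trans ?_
      · rw [show (g y - H (gradient (P (n+1)) y)) - (g y - H (gradient (P n) y)) = -(H (gradient (P (n+1)) y) - H (gradient (P n) y)) by ring, abs_neg]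
        refine (hL _ _).trans ?_
        gcongr
        exact ih y
      · rw [← hcdef, pow_succ]
        have h0 : 0 ≤ ((B + L) * c) * (1/2) ^ n * ‖v‖ := by positivity
        calc _ = (L * c) * (((B + L) * c) * (1/2) ^ n * ‖v‖) := by ring
          _ ≤ (1/2) * (((B + L) * c) * (1/2) ^ n * ‖v‖) := by gcongr
          _ = _ := by ring
  have heq : ∀ n x, lpl (P (n+1)) x = 2 * K * P (n+1) x + (2 * H (gradient (P n) x) + (-2) * g x) := by
    intro n x
    have := GG_eq hK (hF n) x
    have e : P (n+1) = GG K (fun x => g x - H (gradient (P n) x)) := hPs n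
    rw [← e] at this
    linarith
  have hb1 : LB (fun n x => ‖gradient (P (n+1)) x‖) :=
    LB_of_bdd (fun n x => by rw [abs_norm]; exact hgrad n x)
  have hb0 : LB (fun n => P (n+1)) := LB_of_bdd hbd
  have hFam : Fam (fun n => P (n+1)) :=
    { c2 := fun n => (hinv (n+1)).1
      l1 := fun n => by
        have : lpl (P (n+1)) = fun x => 2 * K * P (n+1) x + (2 * H (gradient (P n) x) + (-2) * g x) := by
          funext x; exact heq n x
        rw [this]
        exact (contDiff_const.mul (C2.c1 (hinv (n+1)).1)).add ((contDiff_const.mul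
          (hH.1.comp (gradient_contDiff (hinv n).1))).add (contDiff_const.mul hg.1))
      b0 := hb0
      b1 := hb1
      b2 := by
        have h1 : LB (fun n x => 2 * H (gradient (P n) x) + (-2) * g x) :=
          (LB_of_bdd (g := fun n x => H (gradient (P n) x)) fun n x => hHb _).add_mul
            (LB_of_cont hg.1.continuous) _ _
        exact (hb0.add_mul h1 (2 * K) 1).congr fun n x => by rw [heq n x]; ring }
  obtain ⟨ψ, h2, t0, t1, t2⟩ := hFam.compact hm (fun hv => by
    have h1 : LHa (1/2) (fun n x => H (gradient (P n) x)) := by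
      refine LHa.unshift ?_ (LHa_comp hH.1 hb1 hv)
      funext x; rw [hg0, hH0]; rfl
    have h3 := h1.add_mul (LHa_of_C1 hg.1) 2 (-2)
    have h4 := LHa_of_grad (fun n => C2.diff (hinv (n+1)).1) hb1
    exact (h4.add_mul h3 (2 * K) 1).congr fun n x => by rw [heq n x]; ring) (hyperfilter ℕ)
  refine ⟨ψ, h2, ⟨(B + L) * ∫ p, |k0 K p| ∂(nu m), fun x => le_of_tendsto (t0 x).abs (Eventually.of_forall fun n => hbd n x)⟩, fun x => ?_⟩
  have tg := grad_tendsto fun v => t1 v x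
  have td : Tendsto (fun n => gradient (P (n+1)) x - gradient (P n) x) (hyperfilter ℕ : Filter ℕ) (𝓝 0) := by
    have : Tendsto (fun n => gradient (P (n+1)) x - gradient (P n) x) atTop (𝓝 0) := by
      refine squeeze_zero_norm (fun n => hcon n x) ?_
      simpa using (tendsto_pow_atTop_nhds_zero_of_lt_one (by norm_num : (0:ℝ) ≤ 1/2) (by norm_num)).const_mul ((B + L) * c)
    exact this.mono_left Nat.hyperfilter_le_atTop
  have tg2 : Tendsto (fun n => gradient (P n) x) (hyperfilter ℕ : Filter ℕ) (𝓝 (gradient ψ x)) := by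
    simpa using tg.sub td
  have tH : Tendsto (fun n => H (gradient (P n) x)) (hyperfilter ℕ : Filter ℕ) (𝓝 (H (gradient ψ x))) :=
    (hH.1.continuous.tendsto _).comp tg2
  have := ((t0 x).const_mul (2 * K)).add ((tH.const_mul 2).add_const ((-2) * g x))
  have hu := tendsto_nhds_unique ((t2 x).congr fun n => heq n x) this
  linarith

/-- comparison -/
lemma comparison {m : ℕ} {H : EE m → ℝ} {L : ℝ} (hL0 : 0 ≤ L) {φ ψ g g' : EE m → ℝ}
    (hφ : ContDiff ℝ 2 φ) (hψ : ContDiff ℝ 2 ψ)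
    (hL : ∀ x, |H (gradient φ x) - H (gradient ψ x)| ≤ L * ‖gradient φ x - gradient ψ x‖) {K S S' A : ℝ}
    (hK : 0 < K) (hS : ∀ x, |φ x| ≤ S) (hS' : ∀ x, |ψ x| ≤ S')
    (h1 : ∀ x, K * φ x - (1/2) * lpl φ x + H (gradient φ x) ≤ g x)
    (h2 : ∀ x, g' x ≤ K * ψ x - (1/2) * lpl ψ x + H (gradient ψ x))
    (hA : ∀ x, g x - g' x ≤ A) : ∀ x, K * (φ x - ψ x) ≤ A :=
  max_principle (hφ.sub hψ) hK hL0 (fun x => (abs_sub _ _).trans (add_le_add (hS x) (hS' x)))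
    (fun x => by
      rw [lp_sub hφ hψ, gradient_sub' (C2.diff hφ) (C2.diff hψ)]
      have := abs_le.1 (hL x)
      linarith [h1 x, h2 x, hA x, this.1])

end

section
open Filter Topology MeasureTheory Set

/-- invariants of the outer iteration -/
def OInv {m : ℕ} (S G : ℝ) (φ : EE m → ℝ) : Prop :=
  ContDiff ℝ 2 φ ∧ (∀ x, |φ x| ≤ S) ∧ ∀ x y, |φ x - φ y| ≤ G * ‖x - y‖

lemma OInv.grad {m : ℕ} {S G : ℝ} (hG : 0 ≤ G) {φ : EE m → ℝ} (h : OInv S G φ) (x : EE m) :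
    ‖gradient φ x‖ ≤ G := by
  rw [norm_gradient]
  exact norm_fderiv_le_of_lip' ℝ hG (Eventually.of_forall fun y => by
    rw [Real.norm_eq_abs]; exact h.2.2 y x)

lemma gradient_zero' {m : ℕ} (x : EE m) : gradient (fun _ : EE m => (0:ℝ)) x = 0 := by
  unfold gradient; simp

lemma lpl_zero {m : ℕ} (x : EE m) : lpl (fun _ : EE m => (0:ℝ)) x = 0 := by
  unfold lpl pd; simp

lemma gradient_cst {m : ℕ} (c : ℝ) (x : EE m) : gradient (fun _ : EE m => c) x = 0 := by
  unfold gradient; simp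

lemma lpl_const {m : ℕ} (c : ℝ) (x : EE m) : lpl (fun _ : EE m => c) x = 0 := by
  unfold lpl pd; simp

lemma outer_step {m : ℕ} (hm : 1 ≤ m) {H : EE m → ℝ} (hH : Cut H) (hH0 : H 0 = 0) {L : ℝ}
    (hL0 : 0 ≤ L) (hHb : ∀ p, |H p| ≤ L) (hL : ∀ p q, |H p - H q| ≤ L * ‖p - q‖) {K : ℝ} (hK : 0 < K)
    (hKL : L * (Real.sqrt (Real.pi / K) * c1 m) ≤ 1/2) {h : EE m → ℝ} (hh : ContDiff ℝ 1 h)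
    {ε S G : ℝ} (hε : 0 < ε) (hεK : ε < K) (hG : 0 ≤ G) (hB : ∀ x, |h x| ≤ ε * S)
    (hG' : ∀ x y, |h x - h y| ≤ ε * G * ‖x - y‖) {φ : EE m → ℝ} (hφ : OInv S G φ) :
    ∃ φ' : EE m → ℝ, OInv S G φ' ∧
      ∀ x, K * φ' x - (1/2) * lpl φ' x + H (gradient φ' x) = h x + (K - ε) * φ x := by
  have cbh : CB1 h := ⟨hh, max (ε * S) (ε * G), fun x => ⟨(hB x).trans (le_max_left _ _),
    (norm_fderiv_le_of_lip' ℝ (by positivity) (Eventually.of_forall fun y => by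
      rw [Real.norm_eq_abs]; exact hG' y x)).trans (le_max_right _ _)⟩⟩
  have cbφ : CB1 φ := ⟨C2.c1 hφ.1, max S G, fun x => ⟨(hφ.2.1 x).trans (le_max_left _ _), by
    rw [← norm_gradient]; exact (hφ.grad hG x).trans (le_max_right _ _)⟩⟩
  obtain ⟨u, u2, ⟨T, hT⟩, ue⟩ := inner_exists hm hH hH0 hL0 hHb hL hK hKL (cbh.add_const_mul cbφ (K - ε))
  have hKε : 0 < K - ε := by linarith
  refine ⟨u, ⟨u2, fun x => ?_, ?_⟩, ue⟩
  · rw [abs_le]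
    have z2 : ContDiff ℝ 2 (fun _ : EE m => (0:ℝ)) := contDiff_const
    have a1 := comparison (H := H) (g := fun x => h x + (K - ε) * φ x) (g' := fun _ => 0) hL0 u2 z2 (fun x => hL _ _) hK hT (S' := 0) (by simp) (fun x => (ue x).le)
      (fun x => by rw [gradient_zero', lpl_zero, hH0]; simp) (A := K * S) (fun x => by
        have := abs_le.1 (hB x)
        have := mul_le_mul_of_nonneg_left (abs_le.1 (hφ.2.1 x)).2 hKε.le
        linarith) x
    have a2 := comparison (H := H) (g' := fun x => h x + (K - ε) * φ x) (g := fun _ => 0) hL0 z2 u2 (fun x => hL _ _) hK (S := 0) (by simp) hT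
      (fun x => by rw [gradient_zero', lpl_zero, hH0]; simp) (fun x => (ue x).ge) (A := K * S) (fun x => by
        have := abs_le.1 (hB x)
        have := mul_le_mul_of_nonneg_left (abs_le.1 (hφ.2.1 x)).1 hKε.le
        linarith) x
    constructor
    · have := le_of_mul_le_mul_left a2 hK; linarith
    · have := le_of_mul_le_mul_left a1 hK; linarith
  · have key : ∀ z x, u (x + z) - u x ≤ G * ‖z‖ := by
      intro z x
      have s2 : ContDiff ℝ 2 (fun x => u (x + z)) := u2.comp (contDiff_id.add contDiff_const)
      have := comparison (H := H) (g := fun x => h (x + z) + (K - ε) * φ (x + z))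
        (g' := fun x => h x + (K - ε) * φ x) hL0 s2 u2 (fun x => hL _ _) hK (fun x => hT _) hT
        (fun x => by rw [gradient_shift, lp_shift]; exact (ue _).le) (fun x => (ue x).ge)
        (A := K * (G * ‖z‖)) (fun x => by
          have b1 := (abs_le.1 (hG' (x + z) x)).2
          have b2 := mul_le_mul_of_nonneg_left (abs_le.1 (hφ.2.2 (x + z) x)).2 hKε.le
          rw [add_sub_cancel_left] at b1 b2
          linarith) x
      exact le_of_mul_le_mul_left this hK
    intro x y
    rw [abs_le]
    have k1 := key (x - y) y
    have k2 := key (y - x) x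
    rw [add_sub_cancel] at k1 k2
    rw [norm_sub_rev y x] at k2
    constructor <;> linarith

lemma outer_exists {m : ℕ} (hm : 1 ≤ m) {H : EE m → ℝ} (hH : Cut H) (hH0 : H 0 = 0)
    {h : EE m → ℝ} (hh : ContDiff ℝ 1 h)
    {ε S G : ℝ} (hε : 0 < ε) (hG : 0 ≤ G) (hB : ∀ x, |h x| ≤ ε * S)
    (hG' : ∀ x y, |h x - h y| ≤ ε * G * ‖x - y‖) :
    ∃ φ : EE m → ℝ, OInv S G φ ∧ ∀ x, ε * φ x - (1/2) * lpl φ x + H (gradient φ x) = h x := by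
  have hS0 : 0 ≤ S := by
    have := (abs_nonneg _).trans (hB 0); exact nonneg_of_mul_nonneg_right this hε
  obtain ⟨L, hL0, hHb, -, hL⟩ := hH.lip
  obtain ⟨K, hK, hεK, hKL⟩ : ∃ K, 0 < K ∧ ε < K ∧ L * (Real.sqrt (Real.pi / K) * c1 m) ≤ 1/2 := by
    have t : Tendsto (fun K : ℝ => L * (Real.sqrt (Real.pi / K) * c1 m)) atTop (𝓝 (L * (Real.sqrt 0 * c1 m))) := by
      have t1 : Tendsto (fun K : ℝ => Real.pi / K) atTop (𝓝 0) := tendsto_const_nhds.div_atTop tendsto_id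
      exact (((Real.continuous_sqrt.tendsto 0).comp t1).mul_const _).const_mul _
    rw [Real.sqrt_zero, zero_mul, mul_zero] at t
    have := ((t.eventually (ge_mem_nhds (by norm_num : (0:ℝ) < 1/2))).and ((eventually_gt_atTop 0).and (eventually_gt_atTop ε))).exists
    obtain ⟨K, a, b, c⟩ := this
    exact ⟨K, b, c, a⟩
  have step : ∀ φ : {φ : EE m → ℝ // OInv S G φ}, ∃ φ' : {φ : EE m → ℝ // OInv S G φ},
      ∀ x, K * φ'.1 x - (1/2) * lpl φ'.1 x + H (gradient φ'.1 x) = h x + (K - ε) * φ.1 x := by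
    intro φ
    obtain ⟨u, hu, e⟩ := outer_step hm hH hH0 hL0 hHb hL hK hKL hh hε hεK hG hB hG' φ.2
    exact ⟨⟨u, hu⟩, e⟩
  choose T hT using step
  let z : {φ : EE m → ℝ // OInv S G φ} := ⟨fun _ => 0, contDiff_const, by simpa using hS0, fun x y => by simp; positivity⟩
  set Q : ℕ → {φ : EE m → ℝ // OInv S G φ} := fun n => T^[n] z with hQ
  have hQs : ∀ n, Q (n+1) = T (Q n) := fun n => Function.iterate_succ_apply' _ _ _
  set P : ℕ → EE m → ℝ := fun n => (Q n).1 with hP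
  have hinv : ∀ n, OInv S G (P n) := fun n => (Q n).2
  have he : ∀ n x, K * P (n+1) x - (1/2) * lpl (P (n+1)) x + H (gradient (P (n+1)) x) = h x + (K - ε) * P n x := by
    intro n x
    have := hT (Q n) x
    rw [← hQs] at this; exact this
  have hKε : 0 < K - ε := by linarith
  set q : ℝ := (K - ε) / K with hq
  have hq0 : 0 ≤ q := by positivity
  have hq1 : q < 1 := by rw [hq, div_lt_one hK]; linarith
  have hqK : K * q = K - ε := by rw [hq]; field_simp
  have hcon : ∀ n x, |P (n+1) x - P n x| ≤ (2 * S) * q ^ n := by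
    intro n
    induction n with
    | zero => intro x; simpa [two_mul] using (abs_sub _ _).trans (add_le_add ((hinv 1).2.1 x) ((hinv 0).2.1 x))
    | succ n ih =>
      have key : ∀ a b, (∀ x, |P a x - P b x| ≤ (2 * S) * q ^ n) → ∀ x, P (a+1) x - P (b+1) x ≤ (2 * S) * q ^ (n+1) := by
        intro a b hab x
        have := comparison (H := H) (g := fun x => h x + (K - ε) * P a x)
          (g' := fun x => h x + (K - ε) * P b x) hL0 (hinv (a+1)).1 (hinv (b+1)).1 (fun x => hL _ _) hK (hinv (a+1)).2.1 (hinv (b+1)).2.1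
          (fun x => (he a x).le) (fun x => (he b x).ge) (A := K * ((2 * S) * q ^ (n+1))) (fun x => by
            have := mul_le_mul_of_nonneg_left (abs_le.1 (hab x)).2 hKε.le
            have e2 : K * ((2 * S) * q ^ (n+1)) = (K - ε) * ((2 * S) * q ^ n) := by rw [← hqK]; ring
            rw [e2]; linarith) x
        exact le_of_mul_le_mul_left this hK
      intro x
      rw [abs_le]
      have k1 := key (n+1) n ih x
      have k2 := key n (n+1) (fun x => by rw [abs_sub_comm]; exact ih x) x
      constructor <;> linarith
  have hgrad : ∀ n x, ‖gradient (P n) x‖ ≤ G := fun n x => (hinv n).grad hG x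
  have heq : ∀ n x, lpl (P (n+1)) x = 2 * K * P (n+1) x + (2 * H (gradient (P (n+1)) x) + 1 * ((-2) * h x + (-2 * (K - ε)) * P n x)) := by
    intro n x
    have := he n x
    linarith
  have hb1 : ∀ k, LB (fun n x => ‖gradient (P (n+k)) x‖) := fun k =>
    LB_of_bdd (fun n x => by rw [abs_norm]; exact hgrad _ x)
  have hb0 : ∀ k, LB (fun n => P (n+k)) := fun k => LB_of_bdd (fun n x => (hinv _).2.1 x)
  have hFam : Fam (fun n => P (n+1)) :=
    { c2 := fun n => (hinv (n+1)).1
      l1 := fun n => by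
        have : lpl (P (n+1)) = fun x => 2 * K * P (n+1) x + (2 * H (gradient (P (n+1)) x) + 1 * ((-2) * h x + (-2 * (K - ε)) * P n x)) := by
          funext x; exact heq n x
        rw [this]
        exact (contDiff_const.mul (C2.c1 (hinv (n+1)).1)).add ((contDiff_const.mul
          (hH.1.comp (gradient_contDiff (hinv (n+1)).1))).add (contDiff_const.mul ((contDiff_const.mul hh).add (contDiff_const.mul (C2.c1 (hinv n).1)))))
      b0 := hb0 1
      b1 := hb1 1
      b2 := by
        have h1 : LB (fun n x => 2 * H (gradient (P (n+1)) x) + 1 * ((-2) * h x + (-2 * (K - ε)) * P n x)) :=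
          (LB_of_bdd (g := fun n x => H (gradient (P (n+1)) x)) fun n x => hHb _).add_mul
            ((LB_of_cont hh.continuous).add_mul (hb0 0) _ _) _ _
        exact ((hb0 1).add_mul h1 (2 * K) 1).congr fun n x => by rw [heq n x]; ring }
  obtain ⟨ψ, h2, t0, t1, t2⟩ := hFam.compact hm (fun hv => by
    have h1 : LHa (1/2) (fun n x => H (gradient (P (n+1)) x)) := LHa_comp hH.1 (hb1 1) hv
    have l1 : LHa (1/2) (fun n => P (n+1)) := LHa_of_grad (fun n => C2.diff (hinv (n+1)).1) (hb1 1)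
    have l0 : LHa (1/2) (fun n => P n) := LHa_of_grad (fun n => C2.diff (hinv n).1) (hb1 0)
    have h3 := h1.add_mul ((LHa_of_C1 hh).add_mul l0 (-2) (-2 * (K - ε))) 2 1
    exact (l1.add_mul h3 (2 * K) 1).congr fun n x => by rw [heq n x]; ring) (hyperfilter ℕ)
  refine ⟨ψ, ⟨h2, fun x => le_of_tendsto (t0 x).abs (Eventually.of_forall fun n => (hinv _).2.1 x),
    fun x y => le_of_tendsto ((t0 x).sub (t0 y)).abs (Eventually.of_forall fun n => (hinv _).2.2 x y)⟩, fun x => ?_⟩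
  have tg := grad_tendsto fun v => t1 v x
  have td : Tendsto (fun n => P (n+1) x - P n x) (hyperfilter ℕ : Filter ℕ) (𝓝 0) := by
    have : Tendsto (fun n => P (n+1) x - P n x) atTop (𝓝 0) := by
      refine squeeze_zero_norm (fun n => hcon n x) ?_
      simpa using (tendsto_pow_atTop_nhds_zero_of_lt_one hq0 hq1).const_mul (2 * S)
    exact this.mono_left Nat.hyperfilter_le_atTop
  have tp2 : Tendsto (fun n => P n x) (hyperfilter ℕ : Filter ℕ) (𝓝 (ψ x)) := by
    simpa using (t0 x).sub td
  have tH : Tendsto (fun n => H (gradient (P (n+1)) x)) (hyperfilter ℕ : Filter ℕ) (𝓝 (H (gradient ψ x))) :=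
    (hH.1.continuous.tendsto _).comp tg
  have := ((t0 x).const_mul (2 * K)).add ((tH.const_mul 2).add (((tp2.const_mul (-2 * (K - ε))).const_add ((-2) * h x)).const_mul 1))
  have hu := tendsto_nhds_unique ((t2 x).congr fun n => heq n x) this
  linarith

/-- the Hamiltonian -/
noncomputable def hamil (m : ℕ) (θ : ℝ) (p : EE m) : ℝ := (1/θ) * ‖p‖ ^ θ

lemma hamil_C1 {m : ℕ} {θ : ℝ} (hθ : 1 < θ) : ContDiff ℝ 1 (hamil m θ) :=
  contDiff_const.mul (contDiff_norm_rpow hθ)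

lemma hamil_zero {m : ℕ} {θ : ℝ} (hθ : 1 < θ) : hamil m θ 0 = 0 := by
  unfold hamil; rw [norm_zero, Real.zero_rpow (by linarith)]; simp

lemma hamil_nonneg {m : ℕ} {θ : ℝ} (hθ : 1 < θ) (p : EE m) : 0 ≤ hamil m θ p := by
  unfold hamil; positivity

/-- the discounted problem with compactly supported right-hand side -/
lemma disc_exists {m : ℕ} (hm : 1 ≤ m) {θ : ℝ} (hθ : 1 < θ) {h : EE m → ℝ} (hh : Cut h)
    (hh0 : ∀ x, 0 ≤ h x) {ε : ℝ} (hε : 0 < ε) :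
    ∃ φ : EE m → ℝ, ContDiff ℝ 2 φ ∧ (∃ G, ∀ x, |φ x| ≤ G ∧ ‖gradient φ x‖ ≤ G) ∧ (∀ x, 0 ≤ φ x) ∧
      ∀ x, ε * φ x - (1/2) * lpl φ x + hamil m θ (gradient φ x) = h x := by
  obtain ⟨B, hB0, hB, -, hL⟩ := hh.lip
  set G := B / ε with hG
  have hG0 : 0 ≤ G := by positivity
  have eG : ε * G = B := by rw [hG]; field_simp
  obtain ⟨χ, χ3, χc, χ1, -, -, -⟩ := exists_cut m G hG0
  have hH : Cut (fun p => χ p * hamil m θ p) :=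
    ⟨(χ3.of_le (by norm_num)).mul (hamil_C1 hθ), χc.mul_right⟩
  obtain ⟨φ, hφ, e⟩ := outer_exists hm hH (by simp [hamil_zero hθ]) hh.1 hε hG0 (S := G) (by rwa [eG]) (by rwa [eG])
  have e' : ∀ x, ε * φ x - (1/2) * lpl φ x + hamil m θ (gradient φ x) = h x := by
    intro x
    have h1 := χ1 (gradient φ x) (by have := hφ.grad hG0 x; linarith)
    have := e x
    simp only [h1, one_mul] at this
    exact this
  obtain ⟨L, hL0, -, hLL⟩ := lip_ball (hamil_C1 (m := m) hθ) G
  refine ⟨φ, hφ.1, ⟨G, fun x => ⟨hφ.2.1 x, hφ.grad hG0 x⟩⟩, fun x => ?_, e'⟩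
  have := comparison (H := hamil m θ) (g := fun _ => 0) (g' := h) hL0 (contDiff_const (c := (0:ℝ))) hφ.1 (fun x => hLL _ _ (by rw [gradient_zero']; simpa using hG0) (hφ.grad hG0 x)) hε (S := 0) (by simp) hφ.2.1 (fun x => by rw [gradient_zero', lpl_zero, hamil_zero hθ]; simp) (fun x => (e' x).ge) (A := 0) (fun x => by linarith [hh0 x]) x
  have : 0 ≤ ε * φ x := by linarith
  exact nonneg_of_mul_nonneg_right this hε

end

section
open Filter Topology MeasureTheory Set

lemma pd_sum {m : ℕ} {ι : Type*} (s : Finset ι) {F : ι → EE m → ℝ} (h : ∀ i, Differentiable ℝ (F i))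
    (v : EE m) : pd v (fun x => ∑ i ∈ s, F i x) = fun x => ∑ i ∈ s, pd v (F i) x := by
  funext x; unfold pd; rw [fderiv_fun_sum (fun i _ => h i x)]; simp

lemma lp_sum {m : ℕ} {ι : Type*} (s : Finset ι) {F : ι → EE m → ℝ} (h : ∀ i, ContDiff ℝ 2 (F i))
    (x : EE m) : lpl (fun x => ∑ i ∈ s, F i x) x = ∑ i ∈ s, lpl (F i) x := by
  unfold lpl
  simp only [pd_sum s (fun i => C2.diff (h i))]
  rw [Finset.sum_comm]
  refine Finset.sum_congr rfl fun j _ => ?_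
  rw [pd_sum s (fun i => C1.diff (pd_contDiff (h i) _))]

/-- difference quotient -/
noncomputable def dq {m : ℕ} (s : ℝ) (v : EE m) (F : EE m → ℝ) : EE m → ℝ :=
  fun x => s⁻¹ * (F (x + s • v) - F x)

lemma shift_C {m : ℕ} {n : WithTop ℕ∞} {F : EE m → ℝ} (h : ContDiff ℝ n F) (z : EE m) :
    ContDiff ℝ n (fun x => F (x + z)) := h.comp (contDiff_id.add contDiff_const)

lemma dq_contDiff {m : ℕ} {s : ℝ} {v : EE m} {F : EE m → ℝ} {n : WithTop ℕ∞} (h : ContDiff ℝ n F) :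
    ContDiff ℝ n (dq s v F) :=
  contDiff_const.mul ((shift_C h _).sub h)

lemma pd_dq {m : ℕ} {s : ℝ} {v : EE m} {F : EE m → ℝ} (h : ContDiff ℝ 1 F) (u : EE m) :
    pd u (dq s v F) = dq s v (pd u F) := by
  unfold dq
  rw [pd_const_mul (φ := fun x => F (x + s • v) - F x) (C1.diff ((shift_C h _).sub h)),
    pd_sub (C1.diff (shift_C h _)) (C1.diff h), pd_shift]

lemma lp_dq {m : ℕ} {s : ℝ} {v : EE m} {F : EE m → ℝ} (h : ContDiff ℝ 2 F) (x : EE m) :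
    lpl (dq s v F) x = dq s v (lpl F) x := by
  unfold dq
  rw [lp_const_mul (φ := fun x => F (x + s • v) - F x) ((shift_C h _).sub h),
    lp_sub (shift_C h _) h, lp_shift]

lemma dq_tendsto {m : ℕ} {F : EE m → ℝ} (h : ContDiff ℝ 1 F) (v : EE m) {l : Filter ℕ} {s : ℕ → ℝ}
    (hs : ∀ n, 0 < s n) (hs0 : Tendsto s l (𝓝 0)) {x : ℕ → EE m} {y : EE m} (hx : Tendsto x l (𝓝 y)) :
    Tendsto (fun n => dq (s n) v F (x n)) l (𝓝 (pd v F y)) := by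
  have key : ∀ n, ∃ c ∈ Ioo 0 (s n), pd v F (x n + c • v) = dq (s n) v F (x n) := by
    intro n
    obtain ⟨c, hc, e⟩ := exists_hasDerivAt_eq_slope (fun t : ℝ => F (x n + t • v)) (fun t => pd v F (x n + t • v)) (hs n)
      (h.continuous.comp (by fun_prop)).continuousOn (fun t _ => hasDerivAt_line (C1.diff h) _ _ _)
    refine ⟨c, hc, ?_⟩
    rw [e]; unfold dq
    simp; ring
  choose c hc hce using key
  have hc0 : Tendsto c l (𝓝 0) := squeeze_zero (fun n => (hc n).1.le) (fun n => (hc n).2.le) hs0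
  have : Tendsto (fun n => x n + c n • v) l (𝓝 (y + (0:ℝ) • v)) := hx.add (hc0.smul_const v)
  rw [zero_smul, add_zero] at this
  exact (((pd_continuous h v).tendsto y).comp this).congr fun n => hce n

/-- point at which the (differentiated) equation gives the Bernstein inequality -/
lemma bern_point {m : ℕ} {φ : EE m → ℝ} (h2 : ContDiff ℝ 2 φ) (l1 : ContDiff ℝ 1 (lpl φ)) {x0 : EE m}
    {ζ : EE m → ℝ} (hζ : ContDiff ℝ 2 ζ) (hζ0 : ζ x0 = 1) (hζ1 : ∀ x, ‖x - x0‖ = 1 → ζ x = 0)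
    (hp : gradient φ x0 ≠ 0) :
    ∃ x, ‖x - x0‖ ≤ 1 ∧ ‖gradient φ x0‖ ^ 2 ≤ ζ x * ‖gradient φ x‖ ^ 2 ∧
      (∀ v, ζ x * (∑ i, 2 * (pd (ee i) φ x * pd v (pd (ee i) φ) x)) + pd v ζ x * ‖gradient φ x‖ ^ 2 = 0) ∧
      ζ x * (∑ i, (2 * ∑ j, (pd (ee j) (pd (ee i) φ) x * pd (ee j) (pd (ee i) φ) x) + 2 * (pd (ee i) φ x * pd (ee i) (lpl φ) x)))
        + 2 * (∑ j, pd (ee j) ζ x * (∑ i, 2 * (pd (ee i) φ x * pd (ee j) (pd (ee i) φ) x))) + lpl ζ x * ‖gradient φ x‖ ^ 2 ≤ 0 := by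
  set s : ℕ → ℝ := fun n => 1 / ((n:ℝ) + 1) with hs
  have hs0 : ∀ n, 0 < s n := fun n => by positivity
  set l : Filter ℕ := (hyperfilter ℕ : Filter ℕ) with hl
  have hst : Tendsto s l (𝓝 0) := tendsto_one_div_add_atTop_nhds_zero_nat.mono_left Nat.hyperfilter_le_atTop
  set δ : ℕ → Fin m → EE m → ℝ := fun n i => dq (s n) (ee i) φ with hδ
  have δ2 : ∀ n i, ContDiff ℝ 2 (δ n i) := fun n i => dq_contDiff h2
  set w : ℕ → EE m → ℝ := fun n x => ∑ i, δ n i x * δ n i x with hw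
  have w2 : ∀ n, ContDiff ℝ 2 (w n) := fun n => ContDiff.sum fun i _ => (δ2 n i).mul (δ2 n i)
  have hpw : ∀ n v x, pd v (w n) x = ∑ i, 2 * (δ n i x * dq (s n) (ee i) (pd v φ) x) := by
    intro n v x
    simp only [hw]
    rw [pd_sum _ (fun i => (C2.diff (δ2 n i)).fun_mul (C2.diff (δ2 n i)))]
    refine Finset.sum_congr rfl fun i _ => ?_
    rw [pd_mul (C2.diff (δ2 n i)) (C2.diff (δ2 n i))]
    simp only [hδ, pd_dq (C2.c1 h2)]; ring
  have hlw : ∀ n x, lpl (w n) x = ∑ i, (2 * ∑ j, (dq (s n) (ee i) (pd (ee j) φ) x * dq (s n) (ee i) (pd (ee j) φ) x) + 2 * (δ n i x * dq (s n) (ee i) (lpl φ) x)) := by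
    intro n x
    simp only [hw]
    rw [lp_sum _ (fun i => (δ2 n i).mul (δ2 n i))]
    refine Finset.sum_congr rfl fun i _ => ?_
    rw [lp_mul (δ2 n i) (δ2 n i)]
    simp only [hδ, pd_dq (C2.c1 h2), lp_dq h2]; ring
  have hmax : ∀ n, ∃ x ∈ Metric.closedBall x0 1, ∀ y ∈ Metric.closedBall x0 1, ζ y * w n y ≤ ζ x * w n x := by
    intro n
    obtain ⟨x, hx, h⟩ := (isCompact_closedBall x0 (1:ℝ)).exists_isMaxOn ⟨x0, by simp⟩
      (f := fun x => ζ x * w n x) (hζ.continuous.mul (w2 n).continuous).continuousOn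
    exact ⟨x, hx, fun y hy => h hy⟩
  choose X hX hXm using hmax
  obtain ⟨x, hx, hxl⟩ := (isCompact_closedBall x0 (1:ℝ)).ultrafilter_le_nhds ((hyperfilter ℕ).map X) (by
    rw [le_principal_iff]; exact Ultrafilter.mem_map.2 (Filter.mem_of_superset univ_mem fun n _ => hX n))
  have hXt : Tendsto X l (𝓝 x) := hxl
  have tζ : Tendsto (fun n => ζ (X n)) l (𝓝 (ζ x)) := (hζ.continuous.tendsto x).comp hXt
  have tδ : ∀ i, Tendsto (fun n => δ n i (X n)) l (𝓝 (pd (ee i) φ x)) := fun i =>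
    dq_tendsto (C2.c1 h2) _ hs0 hst hXt
  have comm : ∀ u v, pd v (pd u φ) x = pd u (pd v φ) x := by
    intro u v
    have hd : DifferentiableAt ℝ (fderiv ℝ φ) x :=
      (h2.fderiv_right (m := 1) (by norm_num)).differentiable (by norm_num) x
    have e : ∀ u v, pd v (pd u φ) x = fderiv ℝ (fderiv ℝ φ) x v u := by
      intro u v
      unfold pd
      rw [fderiv_clm_apply hd (differentiableAt_const u)]; simp
    rw [e, e]
    have : IsSymmSndFDerivAt ℝ φ x := (h2.contDiffAt).isSymmSndFDerivAt (by simp)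
    exact this v u
  have tδδ : ∀ i v, Tendsto (fun n => dq (s n) (ee i) (pd v φ) (X n)) l (𝓝 (pd v (pd (ee i) φ) x)) := fun i v => by
    rw [comm]; exact dq_tendsto (pd_contDiff h2 v) _ hs0 hst hXt
  have tl : ∀ i, Tendsto (fun n => dq (s n) (ee i) (lpl φ) (X n)) l (𝓝 (pd (ee i) (lpl φ) x)) := fun i =>
    dq_tendsto l1 _ hs0 hst hXt
  have tpζ : ∀ v, Tendsto (fun n => pd v ζ (X n)) l (𝓝 (pd v ζ x)) := fun v =>
    ((pd_continuous (C2.c1 hζ) v).tendsto x).comp hXt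
  have tlζ : Tendsto (fun n => lpl ζ (X n)) l (𝓝 (lpl ζ x)) := ((lp_continuous hζ).tendsto x).comp hXt
  have hgw : ∀ y, ‖gradient φ y‖ ^ 2 = ∑ i, pd (ee i) φ y * pd (ee i) φ y := by
    intro y; rw [norm_sq_gradient]; simp [sq]
  have tw : Tendsto (fun n => w n (X n)) l (𝓝 (‖gradient φ x‖ ^ 2)) := by
    rw [hgw]; exact tendsto_finsetSum _ fun i _ => (tδ i).mul (tδ i)
  have tw0 : Tendsto (fun n => w n x0) l (𝓝 (‖gradient φ x0‖ ^ 2)) := by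
    rw [hgw]
    exact tendsto_finsetSum _ fun i _ => (dq_tendsto (C2.c1 h2) _ hs0 hst tendsto_const_nhds).mul (dq_tendsto (C2.c1 h2) _ hs0 hst tendsto_const_nhds)
  have tpw : ∀ v, Tendsto (fun n => pd v (w n) (X n)) l (𝓝 (∑ i, 2 * (pd (ee i) φ x * pd v (pd (ee i) φ) x))) := by
    intro v
    simp only [hpw]
    exact tendsto_finsetSum _ fun i _ => ((tδ i).mul (tδδ i v)).const_mul 2
  have tlw : Tendsto (fun n => lpl (w n) (X n)) l (𝓝 (∑ i, (2 * ∑ j, (pd (ee j) (pd (ee i) φ) x * pd (ee j) (pd (ee i) φ) x) + 2 * (pd (ee i) φ x * pd (ee i) (lpl φ) x)))) := by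
    simp only [hlw]
    exact tendsto_finsetSum _ fun i _ => ((tendsto_finsetSum _ fun j _ => ((tδδ i _).mul (tδδ i _))).const_mul 2).add (((tδ i).mul (tl i)).const_mul 2)
  have hpos : 0 < ‖gradient φ x0‖ ^ 2 := by have := norm_pos_iff.2 hp; positivity
  have hloc : ∀ᶠ n in l, IsLocalMax (fun x => ζ x * w n x) (X n) := by
    filter_upwards [tw0.eventually (lt_mem_nhds hpos)] with n hn
    have h1 := hXm n x0 (by simp)
    rw [hζ0, one_mul] at h1
    have hlt : dist (X n) x0 < 1 := by
      refine lt_of_le_of_ne (hX n) fun hne => ?_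
      rw [hζ1 (X n) (by rw [← dist_eq_norm]; exact hne)] at h1
      linarith
    have : Metric.ball x0 1 ∈ 𝓝 (X n) := Metric.isOpen_ball.mem_nhds hlt
    filter_upwards [this] with y hy
    exact hXm n y (Metric.ball_subset_closedBall hy)
  refine ⟨x, by rw [← dist_eq_norm]; exact hx, ?_, fun v => ?_, ?_⟩
  · refine le_of_tendsto_of_tendsto tw0 (tζ.mul tw) (Eventually.of_forall fun n => ?_)
    have h1 := hXm n x0 (by simp)
    rwa [hζ0, one_mul] at h1
  · refine tendsto_nhds_unique ((tζ.mul (tpw v)).add ((tpζ v).mul tw)) ((tendsto_const_nhds (x := (0:ℝ))).congr' ?_)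
    filter_upwards [hloc] with n hn
    have := localMax_pd hn v
    rw [pd_mul (C2.diff hζ) (C2.diff (w2 n))] at this
    exact this.symm
  · refine le_of_tendsto ((((tζ.mul tlw).add ((tendsto_finsetSum Finset.univ fun j _ => (tpζ (ee j)).mul (tpw (ee j))).const_mul 2))).add (tlζ.mul tw)) ?_
    filter_upwards [hloc] with n hn
    have := localMax_lp (hζ.mul (w2 n)) hn
    rwa [lp_mul hζ (w2 n)] at this

end

section
open Filter Topology MeasureTheory Set

/-- localisation function -/
noncomputable def et {m : ℕ} (x0 : EE m) (x : EE m) : ℝ := 1 - ‖x + -x0‖ ^ 2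

lemma et_C {m : ℕ} {n : WithTop ℕ∞} (x0 : EE m) : ContDiff ℝ n (et x0) :=
  contDiff_const.sub (shift_C contDiff_normsq (-x0))

lemma pd_et {m : ℕ} (x0 v : EE m) : pd v (et x0) = fun x => -2 * inner ℝ (x + -x0) v := by
  have h1 : Differentiable ℝ (fun x : EE m => ‖x + -x0‖ ^ 2) := C1.diff (shift_C contDiff_normsq (-x0))
  have := pd_sub (differentiable_const (1:ℝ)) h1 v
  have e : et x0 = fun x => 1 - ‖x + -x0‖ ^ 2 := rfl
  rw [e, this, pd_shift (fun x : EE m => ‖x‖ ^ 2), pd_normsq]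
  funext x
  unfold pd; simp

lemma pdpd_et {m : ℕ} (x0 v : EE m) (x : EE m) : pd v (pd v (et x0)) x = -2 * inner ℝ v v := by
  rw [pd_et]
  have h1 : Differentiable ℝ (fun x : EE m => (inner ℝ (x + -x0) v : ℝ)) :=
    (differentiable_innerL v).comp (differentiable_id.add_const _)
  rw [pd_const_mul h1, pd_shift (fun x : EE m => (inner ℝ x v : ℝ)), pd_inner]

lemma pd_pow {m : ℕ} {g : EE m → ℝ} (h : Differentiable ℝ g) (v : EE m) (n : ℕ) :
    pd v (fun x => g x ^ (n+1)) = fun x => ((n:ℝ) + 1) * g x ^ n * pd v g x := by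
  funext x; unfold pd
  rw [fderiv_fun_pow _ (h x)]; simp

lemma bern_ineq {m : ℕ} {φ : EE m → ℝ} (h2 : ContDiff ℝ 2 φ) (l1 : ContDiff ℝ 1 (lpl φ)) (x0 : EE m)
    (j : ℕ) (hp : gradient φ x0 ≠ 0) :
    ∃ x η, ‖x - x0‖ ≤ 1 ∧ 0 < η ∧ η ≤ 1 ∧ ‖gradient φ x0‖ ^ 2 ≤ η ^ (j+2) * ‖gradient φ x‖ ^ 2 ∧
      (∀ v, η * (∑ i, pd (ee i) φ x * pd v (pd (ee i) φ) x) = ((j:ℝ) + 2) * inner ℝ (x - x0) v * ‖gradient φ x‖ ^ 2) ∧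
      η ^ 2 * ((∑ i, ∑ j, pd (ee j) (pd (ee i) φ) x ^ 2) + ∑ i, pd (ee i) φ x * pd (ee i) (lpl φ) x)
        ≤ (4 * ((j:ℝ) + 2) ^ 2 + m * ((j:ℝ) + 2)) * ‖gradient φ x‖ ^ 2 := by
  have hη : Differentiable ℝ (et x0) := C1.diff (et_C x0)
  have hζ : ContDiff ℝ 2 (fun x => et x0 x ^ (j+2)) := (et_C x0).pow _
  obtain ⟨x, hx, hW, hv, hT⟩ := bern_point h2 l1 hζ (x0 := x0) (by simp [et]) (by
    intro x hx; rw [sub_eq_add_neg] at hx; simp [et, hx]) hp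
  set η := et x0 x with hηd
  set k : ℝ := (j:ℝ) + 2 with hk
  have hk0 : 0 < k := by positivity
  set W := ‖gradient φ x‖ ^ 2 with hWd
  have hW0 : 0 ≤ W := by positivity
  have hpos : 0 < ‖gradient φ x0‖ ^ 2 := by have := norm_pos_iff.2 hp; positivity
  have hx' : ‖x + -x0‖ ≤ 1 := by rwa [← sub_eq_add_neg]
  have hη0 : 0 ≤ η := by
    rw [hηd]; unfold et; nlinarith [norm_nonneg (x + -x0)]
  have hη1 : η ≤ 1 := by
    rw [hηd]; unfold et; nlinarith [norm_nonneg (x + -x0)]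
  have hηp : 0 < η := by
    refine lt_of_le_of_ne hη0 fun h => ?_
    rw [← h] at hW
    simp at hW; exact hp hW
  have epd : ∀ v, pd v (fun x => et x0 x ^ (j+2)) x = -2 * k * η ^ (j+1) * inner ℝ (x - x0) v := by
    intro v
    rw [pd_pow hη v (j+1), pd_et, sub_eq_add_neg]; simp only [← hηd]; push_cast; rw [hk]; ring
  have epp : ∀ i, pd (ee i) (pd (ee i) (fun x => et x0 x ^ (j+2))) x ≥ -2 * k * η ^ (j+1) := by
    intro i
    rw [pd_pow hη _ (j+1)]
    have d1 : Differentiable ℝ (fun x => (((j+1:ℕ):ℝ) + 1) * et x0 x ^ (j+1)) := (hη.fun_pow _).const_mul _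
    have d2 : Differentiable ℝ (pd (ee i) (et x0)) := C1.diff (pd_contDiff (et_C x0) _)
    rw [pd_mul d1 d2, pd_const_mul (φ := fun x => et x0 x ^ (j+1)) (hη.fun_pow _), pd_pow hη _ j]
    simp only [pdpd_et, ← hηd, real_inner_self_eq_norm_sq, norm_ee]
    push_cast
    have : 0 ≤ ((j:ℝ) + 1 + 1) * (((j:ℝ) + 1) * η ^ j * pd (ee i) (et x0) x) * pd (ee i) (et x0) x := by
      have : ((j:ℝ) + 1 + 1) * (((j:ℝ) + 1) * η ^ j * pd (ee i) (et x0) x) * pd (ee i) (et x0) x = ((j:ℝ) + 1 + 1) * (((j:ℝ) + 1) * η ^ j) * (pd (ee i) (et x0) x)^2 := by ring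
      rw [this]; positivity
    rw [hk]; linarith
  have elp : lpl (fun x => et x0 x ^ (j+2)) x ≥ -2 * k * m * η ^ (j+1) := by
    unfold lpl
    have := Finset.sum_le_sum fun i (_ : i ∈ (Finset.univ : Finset (Fin m))) => epp i
    simp only [Finset.sum_const, Finset.card_univ, Fintype.card_fin, nsmul_eq_mul] at this
    linarith
  have hv' : ∀ v, η * (∑ i, pd (ee i) φ x * pd v (pd (ee i) φ) x) = k * inner ℝ (x - x0) v * W := by
    intro v
    have := hv v
    rw [epd v, ← Finset.mul_sum] at this
    have h3 : 2 * η ^ (j+1) * (η * (∑ i, pd (ee i) φ x * pd v (pd (ee i) φ) x) - k * inner ℝ (x - x0) v * W) = 0 := by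
      rw [← this]; ring
    have h4 : 2 * η ^ (j+1) ≠ 0 := by positivity
    have := (mul_eq_zero.1 h3).resolve_left h4
    linarith
  refine ⟨x, η, hx, hηp, hη1, hW, hv', ?_⟩
  have hcross : η * (∑ l : Fin m, pd (ee l) (fun x => et x0 x ^ (j+2)) x * (∑ i, 2 * (pd (ee i) φ x * pd (ee l) (pd (ee i) φ) x))) ≥ - 4 * k ^ 2 * η ^ (j+1) * W := by
    have e : ∀ l : Fin m, η * (pd (ee l) (fun x => et x0 x ^ (j+2)) x * (∑ i, 2 * (pd (ee i) φ x * pd (ee l) (pd (ee i) φ) x))) = (- 4 * k^2 * η ^ (j+1) * W) * (x - x0) l ^ 2 := by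
      intro l
      have hl := hv' (ee l)
      have hin : inner ℝ (x - x0) (ee l) = (x - x0) l := by
        rw [ee, EuclideanSpace.inner_single_right]; simp
      rw [epd, ← Finset.mul_sum]
      rw [hin] at hl ⊢
      calc _ = (-2 * k * η ^ (j+1) * (x - x0) l) * 2 * (η * (∑ i, pd (ee i) φ x * pd (ee l) (pd (ee i) φ) x)) := by ring
        _ = _ := by rw [hl]; ring
    rw [Finset.mul_sum, Finset.sum_congr rfl fun l _ => e l, ← Finset.mul_sum]
    have e3 : ∑ l, (x - x0) l ^ 2 = ‖x - x0‖ ^ 2 := by rw [EuclideanSpace.norm_sq_eq]; simp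
    rw [e3]
    have e4 : ‖x - x0‖ ^ 2 ≤ 1 := by nlinarith [norm_nonneg (x - x0)]
    have e5 : 0 ≤ 4 * k^2 * η ^ (j+1) * W := by positivity
    nlinarith
  set T := ∑ i, ∑ j, pd (ee j) (pd (ee i) φ) x ^ 2 with hTd
  set P := ∑ i, pd (ee i) φ x * pd (ee i) (lpl φ) x with hPd
  have eT : ∑ i : Fin m, (2 * ∑ j : Fin m, (pd (ee j) (pd (ee i) φ) x * pd (ee j) (pd (ee i) φ) x) + 2 * (pd (ee i) φ x * pd (ee i) (lpl φ) x)) = 2 * (T + P) := by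
    rw [Finset.sum_add_distrib, ← Finset.mul_sum, ← Finset.mul_sum, hTd, hPd]
    simp only [sq]; ring
  rw [eT] at hT
  have h5 := mul_le_mul_of_nonneg_right elp hW0
  have h6 := mul_le_mul_of_nonneg_left h5 hη0
  have h7 := mul_le_mul_of_nonneg_left hT hη0
  have h8 : 2 * η ^ (j+1) * (η ^ 2 * (T + P) - (4 * k ^ 2 + m * k * η) * W) ≤ 0 := by
    have r1 : η * (η ^ (j+2) * (2 * (T + P))) = 2 * η ^ (j+1) * (η ^ 2 * (T + P)) := by ring
    have r2 : η * (-2 * k * m * η ^ (j+1) * W) = - (2 * η ^ (j+1) * (m * k * η * W)) := by ring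
    simp only [mul_add, mul_zero] at h7
    rw [r2] at h6
    nlinarith
  have h9 : η ^ 2 * (T + P) - (4 * k ^ 2 + m * k * η) * W ≤ 0 := by
    by_contra hc
    push Not at hc
    have : 0 < 2 * η ^ (j+1) := by positivity
    have := mul_pos this hc
    linarith
  have h10 : m * k * η * W ≤ m * k * W := by
    have : m * k * W * η ≤ m * k * W * 1 := mul_le_mul_of_nonneg_left hη1 (by positivity)
    linarith
  linarith

end

section
open Filter Topology MeasureTheory Set

lemma sum_pd_mul {m : ℕ} (φ F : EE m → ℝ) (x : EE m) :
    ∑ i, pd (ee i) φ x * pd (ee i) F x = pd (gradient φ x) F x := by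
  rw [← inner_gradient, PiLp.inner_apply]
  simp [gradient_apply']

lemma pd_self {m : ℕ} (φ : EE m → ℝ) (x : EE m) : pd (gradient φ x) φ x = ‖gradient φ x‖ ^ 2 := by
  rw [← inner_gradient, real_inner_self_eq_norm_sq]

lemma pd_hamil {m : ℕ} {θ : ℝ} (hθ : 1 < θ) {φ : EE m → ℝ} (h2 : ContDiff ℝ 2 φ) (x v : EE m)
    (hx : 0 < ‖gradient φ x‖) :
    ‖gradient φ x‖ ^ 2 * pd v (fun y => hamil m θ (gradient φ y)) x =
      ‖gradient φ x‖ ^ θ * ∑ i, pd (ee i) φ x * pd v (pd (ee i) φ) x := by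
  set g : EE m → ℝ := fun y => ∑ i, pd (ee i) φ y * pd (ee i) φ y with hg
  have hgn : ∀ y, g y = ‖gradient φ y‖ ^ 2 := by
    intro y; rw [norm_sq_gradient]; simp [hg, sq]
  have dD : ∀ i : Fin m, Differentiable ℝ (pd (ee i) φ) := fun i => C1.diff (pd_contDiff h2 _)
  have hgd : Differentiable ℝ g := Differentiable.fun_sum fun i _ => (dD i).fun_mul (dD i)
  have e1 : (fun y => hamil m θ (gradient φ y)) = fun y => (1/θ) * g y ^ (θ/2) := by
    funext y
    unfold hamil
    rw [hgn, ← Real.rpow_natCast, ← Real.rpow_mul (norm_nonneg _)]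
    congr 2; push_cast; ring
  have hgx : g x ≠ 0 := by rw [hgn]; positivity
  have h3 : HasFDerivAt (fun y => (1/θ) * g y ^ (θ/2)) ((1/θ) • ((θ/2 * g x ^ (θ/2 - 1)) • fderiv ℝ g x)) x :=
    ((hgd x).hasFDerivAt.rpow_const (Or.inl hgx)).const_mul _
  have h4 : pd v (fun y => (1/θ) * g y ^ (θ/2)) x = (1/2) * g x ^ (θ/2 - 1) * pd v g x := by
    unfold pd
    rw [h3.fderiv]
    simp only [smul_apply, smul_eq_mul]
    field_simp
  have h5 : pd v g x = 2 * ∑ i, pd (ee i) φ x * pd v (pd (ee i) φ) x := by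
    rw [hg, pd_sum _ (fun i => (dD i).fun_mul (dD i)), Finset.mul_sum]
    refine Finset.sum_congr rfl fun i _ => ?_
    rw [pd_mul (dD i) (dD i)]; ring
  have h6 : ‖gradient φ x‖ ^ 2 * g x ^ (θ/2 - 1) = ‖gradient φ x‖ ^ θ := by
    rw [hgn, ← Real.rpow_natCast, ← Real.rpow_mul (norm_nonneg _), ← Real.rpow_add hx]
    congr 1; push_cast; ring
  rw [e1, h4, h5, ← h6]; ring

lemma trace_ineq {m : ℕ} (φ : EE m → ℝ) (x : EE m) :
    lpl φ x ^ 2 ≤ m * ∑ i, ∑ j, pd (ee j) (pd (ee i) φ) x ^ 2 := by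
  unfold lpl
  have h1 := sq_sum_le_card_mul_sum_sq (s := (Finset.univ : Finset (Fin m))) (f := fun i => pd (ee i) (pd (ee i) φ) x)
  simp only [Finset.card_univ, Fintype.card_fin] at h1
  refine h1.trans ?_
  gcongr with i
  exact Finset.single_le_sum (f := fun j => pd (ee j) (pd (ee i) φ) x ^ 2) (fun j _ => sq_nonneg _) (Finset.mem_univ i)

lemma bern_alg {θ M N Cc k q y η X : ℝ} (hX : X = η * y) (hN : 0 ≤ N) (hM : 0 ≤ M) (hC : 0 ≤ Cc) (hk : 0 ≤ k)
    (h : X ^ 2 ≤ N * (Cc + 2 * k * X + 2 * M)) : X ≤ 1 + N * (Cc + 2 * k + 2 * M) := by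
  by_contra hc
  push Not at hc
  have h0 : 0 ≤ N * (Cc + 2 * k + 2 * M) := by positivity
  have h1 : 1 < X := by linarith
  have h2 : N * (Cc + 2 * k * X + 2 * M) ≤ N * ((Cc + 2 * k + 2 * M) * X) := by
    gcongr
    nlinarith
  nlinarith

set_option maxHeartbeats 1000000 in
lemma bern_bound {m : ℕ} (hm : 1 ≤ m) {θ : ℝ} (hθ : 1 < θ) {M : ℝ} (hM : 0 ≤ M) : ∃ C : ℝ, 0 ≤ C ∧
    ∀ (ε : ℝ) (φ h : EE m → ℝ) (x0 : EE m), 0 ≤ ε → ContDiff ℝ 2 φ → ContDiff ℝ 1 h → (∀ x, 0 ≤ φ x) →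
      (∀ x, ε * φ x - (1/2) * lpl φ x + hamil m θ (gradient φ x) = h x) →
      (∀ x, ‖x - x0‖ ≤ 1 → |h x| ≤ M ∧ ‖gradient h x‖ ≤ M) → ‖gradient φ x0‖ ≤ C := by
  obtain ⟨j, hj⟩ := exists_nat_gt (2 / (θ - 1))
  have hθ1 : 0 < θ - 1 := by linarith
  set k : ℝ := (j:ℝ) + 2 with hk
  have hk0 : 0 < k := by positivity
  have hkθ : 2 ≤ (θ - 1) * k := by
    rw [div_lt_iff₀ hθ1] at hj
    rw [hk]; nlinarith
  set Cc : ℝ := 4 * k ^ 2 + m * k with hC1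
  have hC10 : 0 ≤ Cc := by positivity
  set N : ℝ := θ ^ 2 * m with hN
  have hm0 : (0:ℝ) < m := by exact_mod_cast hm
  have hN0 : 0 < N := by positivity
  set B : ℝ := 1 + N * (Cc + 2 * k + 2 * M) with hB
  have hB0 : 0 ≤ B := by positivity
  set C : ℝ := B ^ (j+2) + 1 + (2 * M * θ) ^ 2 with hC
  have hC1' : 1 ≤ C := by have := pow_nonneg hB0 (j+2); have := sq_nonneg (2 * M * θ); linarith
  refine ⟨C, by linarith, fun ε φ h x0 hε h2 hh hφ he hb => ?_⟩
  by_cases hp0 : gradient φ x0 = 0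
  · rw [hp0, norm_zero]; linarith
  have elp : lpl φ = fun x => 2 * (ε * φ x + hamil m θ (gradient φ x) - h x) := by
    funext x; have := he x; linarith
  have dφ : ContDiff ℝ 1 (fun x => ε * φ x) := contDiff_const.mul (C2.c1 h2)
  have dH : ContDiff ℝ 1 (fun x => hamil m θ (gradient φ x)) := (hamil_C1 hθ).comp (gradient_contDiff h2)
  have l1 : ContDiff ℝ 1 (lpl φ) := by
    rw [elp]; exact contDiff_const.mul ((dφ.add dH).sub hh)
  obtain ⟨x, η, hx, hη, hη1, hW, hv, hT⟩ := bern_ineq h2 l1 x0 j hp0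
  suffices hs : ‖gradient φ x0‖ ^ 2 ≤ C by
    have : ‖gradient φ x0‖ ^ 2 ≤ C ^ 2 := hs.trans (by nlinarith)
    exact (sq_le_sq₀ (norm_nonneg _) (by linarith)).1 this
  refine hW.trans ?_
  set q := ‖gradient φ x‖ with hq
  have hq0 : 0 ≤ q := norm_nonneg _
  have hηk : η ^ (j+2) ≤ 1 := pow_le_one₀ hη.le hη1
  have hηq : η ^ (j+2) * q ^ 2 ≤ q ^ 2 := by nlinarith [sq_nonneg q]
  have hBp := pow_nonneg hB0 (j+2)
  have hMp := sq_nonneg (2 * M * θ)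
  rcases lt_or_ge q 1 with hq1 | hq1
  · nlinarith
  have hqp : 0 < q := by linarith
  set y := q ^ (θ - 1) with hy
  have hy0 : 0 < y := Real.rpow_pos_of_pos hqp _
  have hqθ : q ^ θ = q * y := by
    rw [hy, ← Real.rpow_one_add' hq0 (by linarith)]; congr 1; ring
  rcases lt_or_ge (q ^ θ) (2 * M * θ) with hqM | hqM
  · have : q ≤ q ^ θ := by
      conv_lhs => rw [← Real.rpow_one q]
      exact Real.rpow_le_rpow_of_exponent_le hq1 hθ.le
    have : q ^ 2 ≤ (2 * M * θ) ^ 2 := by gcongr; linarith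
    linarith
  obtain ⟨hb1, hb2⟩ := hb x hx
  -- the Laplacian from below
  have hlap : q * y / θ ≤ lpl φ x := by
    rw [elp]
    have a1 := (abs_le.1 hb1).2
    have a2 : 0 ≤ ε * φ x := mul_nonneg hε (hφ x)
    have a3 : hamil m θ (gradient φ x) = q * y / θ := by unfold hamil; rw [← hq, hqθ]; ring
    have a4 : 2 * M ≤ q * y / θ := by rw [le_div_iff₀ (by linarith), ← hqθ]; exact hqM
    show _ ≤ 2 * (ε * φ x + hamil m θ (gradient φ x) - h x)
    rw [a3]; linarith
  have htr := trace_ineq φ x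
  set T := ∑ i, ∑ j, pd (ee j) (pd (ee i) φ) x ^ 2 with hTd
  have hT2 : (q * y) ^ 2 ≤ N * T := by
    have : (q * y / θ) ^ 2 ≤ m * T := (pow_le_pow_left₀ (by positivity) hlap 2).trans htr
    rw [div_pow, div_le_iff₀ (by positivity)] at this
    rw [hN]; linarith
  rw [sum_pd_mul] at hT
  set v := gradient φ x with hvd
  have hP : pd v (lpl φ) x = 2 * (ε * q ^ 2 + pd v (fun x => hamil m θ (gradient φ x)) x - pd v h x) := by
    rw [elp, pd_const_mul (φ := fun x => ε * φ x + hamil m θ (gradient φ x) - h x) (C1.diff ((dφ.add dH).sub hh)), pd_sub (φ := fun x => ε * φ x + hamil m θ (gradient φ x)) (C1.diff (dφ.add dH)) (C1.diff hh), pd_add (C1.diff dφ) (C1.diff dH), pd_const_mul (C2.diff h2)]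
    simp only [hvd, hq, pd_self]
  have hPh : pd v h x ≤ M * q := by
    refine (le_abs_self _).trans ((abs_pd_le h v x).trans ?_)
    rw [hq]; gcongr
  have hHp : - (k * q ^ 2 * y) ≤ η * pd v (fun x => hamil m θ (gradient φ x)) x := by
    have b1 := pd_hamil hθ h2 x v hqp
    rw [← hvd, ← hq] at b1
    have b2 := hv v
    have b3 : |(inner ℝ (x - x0) v : ℝ)| ≤ 1 * q := (abs_real_inner_le_norm _ _).trans (by rw [hq]; gcongr)
    have b4 := (abs_le.1 b3).1
    set I := pd v (fun x => hamil m θ (gradient φ x)) x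
    have b5 : q ^ 2 * (η * I) = q ^ 2 * (k * inner ℝ (x - x0) v * q ^ θ) := by
      calc q ^ 2 * (η * I) = η * (q ^ 2 * I) := by ring
        _ = q ^ θ * (η * (∑ i, pd (ee i) φ x * pd v (pd (ee i) φ) x)) := by rw [b1]; ring
        _ = _ := by rw [b2]; ring
    have b6 := mul_left_cancel₀ (by positivity : q ^ 2 ≠ 0) b5
    rw [b6, hqθ]
    have : 0 ≤ k * (q * y) := by positivity
    nlinarith
  rw [hP] at hT
  set I := pd v (fun x => hamil m θ (gradient φ x)) x with hI
  have hεq : 0 ≤ ε * q ^ 2 := by positivity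
  set X := η * y with hXd
  have hX0 : 0 < X := by positivity
  have hmain : q ^ 2 * X ^ 2 ≤ q ^ 2 * (N * (Cc + 2 * k * X + 2 * M)) := by
    have c1 : η ^ 2 * (q * y) ^ 2 ≤ N * (η ^ 2 * T) := by
      calc _ ≤ η ^ 2 * (N * T) := by gcongr
        _ = _ := by ring
    have c2 : η ^ 2 * T ≤ Cc * q ^ 2 + 2 * (k * q ^ 2 * y) * η + 2 * M * q ^ 2 := by
      have d1 : η ^ 2 * (2 * (ε * q ^ 2)) ≥ 0 := by positivity
      have d2 := mul_le_mul_of_nonneg_left hHp hη.le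
      have d3 : η ^ 2 * pd v h x ≤ M * q ^ 2 := by
        calc η ^ 2 * pd v h x ≤ η ^ 2 * (M * q) := by gcongr
          _ ≤ 1 * (M * q) := by gcongr; exact pow_le_one₀ hη.le hη1
          _ ≤ M * q ^ 2 := by nlinarith [mul_nonneg hM hq0]
      nlinarith
    calc q ^ 2 * X ^ 2 = η ^ 2 * (q * y) ^ 2 := by rw [hXd]; ring
      _ ≤ N * (η ^ 2 * T) := c1
      _ ≤ N * (Cc * q ^ 2 + 2 * (k * q ^ 2 * y) * η + 2 * M * q ^ 2) := by gcongr
      _ = _ := by rw [hXd]; ring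
  have hXB : X ≤ B := bern_alg (θ := θ) (q := q) hXd hN0.le hM hC10 hk0.le (le_of_mul_le_mul_left hmain (by positivity))
  have hyk : q ^ 2 ≤ y ^ (j+2) := by
    rw [hy, ← Real.rpow_natCast, ← Real.rpow_natCast, ← Real.rpow_mul hq0]
    apply Real.rpow_le_rpow_of_exponent_le hq1
    push_cast
    exact hkθ
  have : η ^ (j+2) * q ^ 2 ≤ B ^ (j+2) := by
    calc η ^ (j+2) * q ^ 2 ≤ η ^ (j+2) * y ^ (j+2) := by gcongr
      _ = X ^ (j+2) := by rw [hXd, mul_pow]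
      _ ≤ _ := by gcongr
  linarith

end

section
open Filter Topology MeasureTheory Set

lemma pd_ridge {m : ℕ} {u u' : ℝ → ℝ} (h : ∀ t, HasDerivAt u (u' t) t) (e v : EE m) :
    pd v (fun x => u (inner ℝ x e)) = fun x => inner ℝ v e * u' (inner ℝ x e) := by
  funext x
  have h1 : HasFDerivAt (fun x : EE m => (inner ℝ x e : ℝ)) (fderiv ℝ (fun x : EE m => (inner ℝ x e : ℝ)) x) x :=
    (differentiable_innerL e x).hasFDerivAt
  have h2 := (h (inner ℝ x e)).comp_hasFDerivAt x h1
  have h3 := congrFun (pd_inner v e) x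
  unfold pd at h3 ⊢
  have h4 : fderiv ℝ (fun x : EE m => u (inner ℝ x e)) x = _ := h2.fderiv
  rw [h4, smul_apply, h3, smul_eq_mul, mul_comm]

lemma small_eps {m : ℕ} (hm : 1 ≤ m) {θ : ℝ} (hθ : 1 < θ) {h : EE m → ℝ} (hh : Cut h)
    {τ : ℝ} (hτ : 0 < τ) : ∃ ε, 0 < ε ∧ ε ≤ τ ∧ ∀ (φ : EE m → ℝ), ContDiff ℝ 2 φ →
      (∃ G, ∀ x, |φ x| ≤ G ∧ ‖gradient φ x‖ ≤ G) →
      (∀ x, ε * φ x - (1/2) * lpl φ x + hamil m θ (gradient φ x) = h x) → ε * φ 0 ≤ 2 * τ := by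
  obtain ⟨M, hM0, hM, -, -⟩ := hh.lip
  obtain ⟨R, hR0, hR⟩ : ∃ R > 0, ∀ x, R ≤ ‖x‖ → h x = 0 := by
    obtain ⟨R, hR⟩ := hh.2.isCompact.isBounded.subset_ball 0
    refine ⟨max R 1, by positivity, fun x hx => image_eq_zero_of_notMem_tsupport fun hx' => ?_⟩
    have := hR hx'
    rw [mem_ball_zero_iff] at this
    exact absurd ((le_max_left _ _).trans hx) (not_le.2 this)
  -- the slope
  obtain ⟨S, hS0, hS⟩ : ∃ S : ℝ, 0 < S ∧ M ≤ (1/θ) * (S/2) ^ θ := by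
    have t : Tendsto (fun S : ℝ => (S/2) ^ θ) atTop atTop :=
      (tendsto_rpow_atTop (by linarith)).comp (tendsto_id.atTop_div_const (by norm_num))
    obtain ⟨S, h1, h2⟩ := ((t.eventually_ge_atTop (θ * M)).and (eventually_gt_atTop 0)).exists
    refine ⟨S, h2, ?_⟩
    rw [one_div, le_inv_mul_iff₀ (by linarith)]; exact h1
  obtain ⟨δ, hδ0, hδR, hδS⟩ : ∃ δ : ℝ, 0 < δ ∧ δ * R ≤ 1 ∧ S * δ ≤ τ := by
    refine ⟨min (1/R) (τ/S), by positivity, ?_, ?_⟩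
    · calc _ ≤ (1/R) * R := by gcongr; exact min_le_left _ _
        _ = 1 := by field_simp
    · calc _ ≤ S * (τ/S) := by gcongr; exact min_le_right _ _
        _ = τ := by field_simp
  have hπ := Real.pi_pos
  set E : ℝ := (S/δ) * Real.pi with hE
  have hE0 : 0 < E := by positivity
  refine ⟨min τ (τ/E), by positivity, min_le_left _ _, ?_⟩
  set ε := min τ (τ/E) with hεd
  have hε : 0 < ε := by positivity
  have hεE : ε * E ≤ τ := by
    calc _ ≤ (τ/E) * E := by gcongr; exact min_le_right _ _
      _ = τ := by field_simp
  intro φ h2 ⟨G, hG⟩ he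
  set u : ℝ → ℝ := fun t => τ/ε + (S/δ) * (Real.arctan (δ * t) + Real.pi/2) with hu
  set u' : ℝ → ℝ := fun t => S / (1 + (δ * t)^2) with hu'
  set u'' : ℝ → ℝ := fun t => S * (-(2 * (δ * t) * δ)) / (1 + (δ * t)^2)^2 with hu''
  have d0 : ∀ t : ℝ, HasDerivAt (fun t : ℝ => δ * t) δ t := fun t => by
    simpa using (hasDerivAt_id t).const_mul δ
  have d1 : ∀ t, HasDerivAt u (u' t) t := fun t => by
    have := (((d0 t).arctan.add_const (Real.pi/2)).const_mul (S/δ)).const_add (τ/ε)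
    refine this.congr_deriv ?_
    simp only [hu']; field_simp
  have d2 : ∀ t, HasDerivAt u' (u'' t) t := fun t => by
    have hne : (1 + (δ * t)^2) ≠ 0 := by positivity
    have := ((((d0 t).pow 2).const_add 1).fun_inv hne).const_mul S
    refine (this.congr_deriv ?_).congr_of_eventuallyEq (Eventually.of_forall fun s => ?_)
    · simp only [hu'']; simp; ring
    · simp [hu', div_eq_mul_inv]
  let i0 : Fin m := ⟨0, hm⟩
  set e : EE m := ee i0 with hedef
  set ψ : EE m → ℝ := fun x => u (inner ℝ x e) with hψ
  have uC : ContDiff ℝ 2 u := by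
    rw [hu]
    exact contDiff_const.add (contDiff_const.mul (((Real.contDiff_arctan.comp (contDiff_const.mul contDiff_id))).add contDiff_const))
  have ψ2 : ContDiff ℝ 2 ψ := uC.comp (contDiff_id.inner ℝ contDiff_const)
  have ψpd : ∀ v, pd v ψ = fun x => inner ℝ v e * u' (inner ℝ x e) := fun v => pd_ridge d1 e v
  have dd : Differentiable ℝ (fun x : EE m => u' (inner ℝ x e)) := fun x =>
    DifferentiableAt.comp (g := u') x (d2 (inner ℝ x e)).differentiableAt (differentiable_innerL e x)
  have ψg : ∀ x, gradient ψ x = u' (inner ℝ x e) • e := by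
    intro x
    apply ext_inner_right ℝ
    intro v
    rw [inner_gradient, ψpd, inner_smul_left, real_inner_comm]; simp [mul_comm]
  have ψl : ∀ x, lpl ψ x = u'' (inner ℝ x e) := by
    intro x
    unfold lpl
    simp only [ψpd, pd_const_mul dd, pd_ridge d2]
    have : ∀ i, (inner ℝ (ee i) e : ℝ) = if i = i0 then 1 else 0 := by
      intro i
      rw [hedef, ee, ee, EuclideanSpace.inner_single_right]; simp [eq_comm]
    simp [this]
  have hne : ‖e‖ = 1 := norm_ee _
  have hu'0 : ∀ t, 0 < u' t := fun t => by simp only [hu']; positivity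
  have hu'S : ∀ t, u' t ≤ S := fun t => by
    simp only [hu']; apply div_le_self hS0.le; nlinarith [sq_nonneg (δ * t)]
  have hψn : ∀ x, ‖gradient ψ x‖ = u' (inner ℝ x e) := fun x => by
    rw [ψg, norm_smul, hne, mul_one, Real.norm_eq_abs, abs_of_pos (hu'0 _)]
  have hu''b : ∀ t, u'' t ≤ S * δ := fun t => by
    simp only [hu'']
    rw [div_le_iff₀ (by positivity)]
    have : -(2 * (δ * t)) ≤ (1 + (δ * t)^2)^2 := by nlinarith [sq_nonneg (δ * t + 1), sq_nonneg (δ * t), sq_nonneg ((δ*t)^2)]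
    have h3 : 0 < S * δ := by positivity
    nlinarith
  have hA : ∀ t, 0 ≤ Real.arctan t + Real.pi/2 ∧ Real.arctan t + Real.pi/2 ≤ Real.pi := fun t =>
    ⟨by linarith [Real.neg_pi_div_two_lt_arctan t], by linarith [Real.arctan_lt_pi_div_two t]⟩
  have hub : ∀ t, τ/ε ≤ u t ∧ u t ≤ τ/ε + E := fun t => by
    have := hA (δ * t)
    constructor
    · have : 0 ≤ (S/δ) * (Real.arctan (δ * t) + Real.pi/2) := mul_nonneg (by positivity) this.1
      simp only [hu]; linarith
    · simp only [hu, hE]; gcongr; exact this.2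
  have hsup : ∀ x, h x ≤ ε * ψ x - (1/2) * lpl ψ x + hamil m θ (gradient ψ x) := by
    intro x
    rw [ψl]
    have a1 : τ ≤ ε * ψ x := by
      have := mul_le_mul_of_nonneg_left (hub (inner ℝ x e)).1 hε.le
      rwa [mul_div_cancel₀ _ hε.ne'] at this
    have a2 := hu''b (inner ℝ x e)
    have a3 := hamil_nonneg hθ (gradient ψ x)
    rcases le_or_gt R ‖x‖ with hx | hx
    · rw [hR x hx]; linarith
    · have b1 : |(inner ℝ x e : ℝ)| ≤ R := by
        refine (abs_real_inner_le_norm _ _).trans ?_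
        rw [hne]; linarith
      have b2 : (δ * inner ℝ x e)^2 ≤ 1 := by
        rw [sq_le_one_iff_abs_le_one, abs_mul, abs_of_pos hδ0]
        exact (mul_le_mul_of_nonneg_left b1 hδ0.le).trans hδR
      have b3 : S/2 ≤ u' (inner ℝ x e) := by
        simp only [hu']
        gcongr; linarith
      have b4 : M ≤ hamil m θ (gradient ψ x) := by
        unfold hamil
        rw [hψn]
        refine hS.trans ?_
        gcongr
      have := (abs_le.1 (hM x)).2
      linarith
  obtain ⟨L, hL0, -, hLL⟩ := lip_ball (hamil_C1 (m := m) hθ) (max G S)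
  have := comparison (H := hamil m θ) (g := h) (g' := h) hL0 h2 ψ2 (fun x => hLL _ _ ((hG x).2.trans (le_max_left _ _))
    (by rw [hψn]; exact (hu'S _).trans (le_max_right _ _))) hε (fun x => (hG x).1) (S' := τ/ε + E) (fun x => by
      have := hub (inner ℝ x e)
      have h0 : 0 < τ/ε := by positivity
      rw [abs_le]; exact ⟨by show _ ≤ u _; linarith, this.2⟩) (fun x => (he x).le) hsup (A := 0) (by simp) 0
  have h5 : ε * ψ 0 ≤ ε * (τ/ε + E) := mul_le_mul_of_nonneg_left (hub _).2 hε.le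
  have h6 : ε * (τ/ε + E) = τ + ε * E := by rw [mul_add, mul_div_cancel₀ _ hε.ne']
  rw [h6] at h5
  rw [mul_sub] at this
  linarith

end

section
open Filter Topology MeasureTheory Set

/-- mollification -/
noncomputable def molli {m : ℕ} (b : ContDiffBump (0 : EE m)) (h : EE m → ℝ) : EE m → ℝ :=
  fun x => ∫ t, b.normed volume t * h (x - t)

lemma molli_C1 {m : ℕ} (b : ContDiffBump (0 : EE m)) {h : EE m → ℝ} (hc : Continuous h) :
    ContDiff ℝ 1 (molli b h) :=
  b.hasCompactSupport_normed.contDiff_convolution_left (ContinuousLinearMap.lsmul ℝ ℝ) (n := 1)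
    (by exact_mod_cast b.contDiff_normed (n := 1)) hc.locallyIntegrable

lemma molli_int {m : ℕ} (b : ContDiffBump (0 : EE m)) {h : EE m → ℝ} (hc : Continuous h) (x : EE m) :
    Integrable (fun t => b.normed volume t * h (x - t)) :=
  (b.continuous_normed.mul (hc.comp (by fun_prop))).integrable_of_hasCompactSupport b.hasCompactSupport_normed.mul_right

lemma bump_bound {m : ℕ} (b : ContDiffBump (0 : EE m)) (hb : b.rOut ≤ 1) {F : EE m → ℝ} {M : ℝ}
    (hM : ∀ t, ‖t‖ ≤ 1 → |F t| ≤ M) : |∫ t, b.normed volume t * F t| ≤ M := by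
  have h1 : ∀ t, ‖b.normed volume t * F t‖ ≤ b.normed volume t * M := by
    intro t
    rw [norm_mul, Real.norm_of_nonneg (b.nonneg_normed t)]
    by_cases ht : ‖t‖ ≤ 1
    · exact mul_le_mul_of_nonneg_left (hM t ht) (b.nonneg_normed t)
    · have : b.normed volume t = 0 := by
        by_contra h
        have h2 : t ∈ Function.support (b.normed volume) := h
        rw [b.support_normed_eq, mem_ball_zero_iff] at h2
        push Not at ht; linarith
      rw [this]; simp
  have := norm_integral_le_of_norm_le (b.integrable_normed.mul_const M) (Eventually.of_forall h1)
  rwa [integral_mul_const, b.integral_normed, one_mul] at this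

lemma approx_rhs {m : ℕ} {h : EE m → ℝ} (hL : LocallyLipschitz h) (h0 : ∀ x, 0 ≤ h x) :
    ∃ g : ℕ → EE m → ℝ, (∀ n, Cut (g n)) ∧ (∀ n x, 0 ≤ g n x) ∧
      (∀ x, Tendsto (fun n => g n x) atTop (𝓝 (h x))) ∧
      ∀ R, ∃ M, 0 ≤ M ∧ ∀ n x, ‖x‖ ≤ R → |g n x| ≤ M ∧ ‖gradient (g n) x‖ ≤ M := by
  have hc : Continuous h := hL.continuous
  let b : ℕ → ContDiffBump (0 : EE m) := fun n => ⟨1/(2*((n:ℝ)+1)), 1/((n:ℝ)+1), by positivity, by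
    apply one_div_lt_one_div_of_lt <;> nlinarith [(Nat.cast_nonneg n : (0:ℝ) ≤ n)]⟩
  have hb : ∀ n, (b n).rOut ≤ 1 := fun n => by
    show 1/((n:ℝ)+1) ≤ 1
    rw [div_le_one (by positivity)]; linarith [(Nat.cast_nonneg n : (0:ℝ) ≤ n)]
  obtain ⟨χ, χ3, χc, χ1, -, χ0, χle⟩ := exists_cut m 0 le_rfl
  have χC : Cut χ := ⟨χ3.of_le (by norm_num), χc⟩
  obtain ⟨L, hL0, -, -, χL⟩ := χC.lip
  set c : ℕ → ℝ := fun n => ((n:ℝ)+1)⁻¹ with hcdef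
  have c0 : ∀ n, 0 < c n := fun n => by positivity
  have c1 : ∀ n, c n ≤ 1 := fun n => by
    apply inv_le_one_of_one_le₀; linarith [(Nat.cast_nonneg n : (0:ℝ) ≤ n)]
  have ct : Tendsto c atTop (𝓝 0) := by
    have := tendsto_one_div_add_atTop_nhds_zero_nat (𝕜 := ℝ)
    simpa [hcdef] using this
  set k : ℕ → EE m → ℝ := fun n => molli (b n) h with hk
  set g : ℕ → EE m → ℝ := fun n x => χ (c n • x) * k n x with hg
  have gcut : ∀ n, Cut (g n) := fun n => by
    refine ⟨((χC.1.comp (contDiff_const_smul (c n))).mul (molli_C1 _ hc)), ?_⟩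
    have : HasCompactSupport (fun x : EE m => χ (c n • x)) :=
      χc.comp_smul (c0 n).ne'
    exact this.mul_right
  have kn0 : ∀ n x, 0 ≤ k n x := fun n x =>
    integral_nonneg fun t => mul_nonneg ((b n).nonneg_normed t) (h0 _)
  refine ⟨g, gcut, fun n x => mul_nonneg (χ0 _) (kn0 n x), fun x => ?_, fun R => ?_⟩
  · have t1 : Tendsto (fun n => k n x) atTop (𝓝 (h x)) := by
      refine ContDiffBump.convolution_tendsto_right_of_continuous (μ := volume) (φ := b) ?_ hc x
      exact tendsto_one_div_add_atTop_nhds_zero_nat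
    refine t1.congr' ?_
    have t2 : Tendsto (fun n => ‖c n • x‖) atTop (𝓝 0) := by
      have := (ct.smul_const x).norm
      simpa using this
    filter_upwards [t2.eventually (gt_mem_nhds zero_lt_one)] with n hn
    simp only [hg]
    rw [χ1 _ (by simpa using hn), one_mul]
  · have hcomp := isCompact_closedBall (0 : EE m) (R + 2)
    obtain ⟨A, hA⟩ := hcomp.exists_bound_of_continuousOn hc.continuousOn
    obtain ⟨Λ, hΛ⟩ := (hL.locallyLipschitzOn (s := Metric.closedBall (0 : EE m) (R+2))).exists_lipschitzOnWith_of_compact hcomp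
    set M0 := max A 0 with hM0
    have hM00 : 0 ≤ M0 := le_max_right _ _
    have hin : ∀ x t : EE m, ‖x‖ ≤ R + 1 → ‖t‖ ≤ 1 → x - t ∈ Metric.closedBall (0 : EE m) (R+2) := by
      intro x t hx ht
      rw [mem_closedBall_zero_iff]; exact (norm_sub_le _ _).trans (by linarith)
    have kb : ∀ n x, ‖x‖ ≤ R + 1 → |k n x| ≤ M0 := fun n x hx =>
      bump_bound (b n) (hb n) fun t ht => (hA _ (hin x t hx ht)).trans (le_max_left _ _)
    have kl : ∀ n x y, ‖x‖ ≤ R + 1 → ‖y‖ ≤ R + 1 → |k n x - k n y| ≤ Λ * ‖x - y‖ := by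
      intro n x y hx hy
      have e : k n x - k n y = ∫ t, (b n).normed volume t * (h (x - t) - h (y - t)) := by
        simp only [hk, molli]
        rw [← integral_sub (molli_int _ hc x) (molli_int _ hc y)]
        congr 1; funext t; ring
      rw [e]
      refine bump_bound (b n) (hb n) fun t ht => ?_
      have := hΛ.norm_sub_le (hin x t hx ht) (hin y t hy ht)
      rwa [sub_sub_sub_cancel_right] at this
    have gl : ∀ n x y, ‖x‖ ≤ R + 1 → ‖y‖ ≤ R + 1 → |g n x - g n y| ≤ (L * M0 + Λ) * ‖x - y‖ := by
      intro n x y hx hy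
      have e : g n x - g n y = (χ (c n • x) - χ (c n • y)) * k n x + χ (c n • y) * (k n x - k n y) := by
        simp only [hg]; ring
      rw [e]
      refine (abs_add_le _ _).trans ?_
      rw [abs_mul, abs_mul, abs_of_nonneg (χ0 (c n • y)), add_mul]
      have a1 : |χ (c n • x) - χ (c n • y)| ≤ L * ‖x - y‖ := by
        refine (χL _ _).trans ?_
        rw [← smul_sub, norm_smul, Real.norm_of_nonneg (c0 n).le]
        have := mul_le_mul_of_nonneg_right (c1 n) (norm_nonneg (x - y))
        rw [one_mul] at this
        gcongr
      have a2 : |χ (c n • x) - χ (c n • y)| * |k n x| ≤ (L * ‖x - y‖) * M0 := by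
        gcongr; exact kb n x hx
      have a3 : χ (c n • y) * |k n x - k n y| ≤ 1 * (Λ * ‖x - y‖) := by
        gcongr
        · exact χle _
        · exact kl n x y hx hy
      linarith
    have hΛ0 : (0:ℝ) ≤ Λ := Λ.2
    refine ⟨max M0 (L * M0 + Λ), le_max_of_le_left hM00, fun n x hx => ⟨?_, ?_⟩⟩
    · refine le_trans ?_ (le_max_left _ _)
      simp only [hg]
      rw [abs_mul, abs_of_nonneg (χ0 _)]
      calc _ ≤ 1 * M0 := by
            gcongr
            · exact χle _
            · exact kb n x (by linarith)
        _ = M0 := one_mul _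
    · refine le_trans ?_ (le_max_right _ _)
      rw [norm_gradient]
      refine norm_fderiv_le_of_lip' ℝ (by positivity) ?_
      have : Metric.ball (0 : EE m) (R+1) ∈ 𝓝 x := Metric.isOpen_ball.mem_nhds (by rw [mem_ball_zero_iff]; linarith)
      filter_upwards [this] with y hy
      rw [mem_ball_zero_iff] at hy
      exact gl n y x hy.le (by linarith)

end

open Filter Topology MeasureTheory Set

lemma ergodic_exists {m : ℕ} (hm : 1 ≤ m) {θ : ℝ} (hθ : 1 < θ) {h : EE m → ℝ} (hL : LocallyLipschitz h)
    (h0 : ∀ x, 0 ≤ h x) : ∃ ψ : EE m → ℝ, ContDiff ℝ 2 ψ ∧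
      ∀ x, -(1/2) * lpl ψ x + hamil m θ (gradient ψ x) = h x := by
  obtain ⟨g, gc, g0, gt, gb⟩ := approx_rhs hL h0
  set τ : ℕ → ℝ := fun n => 1 / ((n:ℝ) + 1) with hτd
  have hτ : ∀ n, 0 < τ n := fun n => by positivity
  have hτ1 : ∀ n, τ n ≤ 1 := fun n => by
    rw [hτd]; simp only; rw [div_le_one (by positivity)]; linarith [(Nat.cast_nonneg n : (0:ℝ) ≤ n)]
  have hτt : Tendsto τ atTop (𝓝 0) := tendsto_one_div_add_atTop_nhds_zero_nat
  choose ε hε hετ hεφ using fun n => small_eps hm hθ (gc n) (hτ n)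
  choose φ φ2 φb φ0 φe using fun n => disc_exists hm hθ (gc n) (g0 n) (hε n)
  set u : ℕ → EE m → ℝ := fun n x => φ n x - φ n 0 with hu
  have u2 : ∀ n, ContDiff ℝ 2 (u n) := fun n => (φ2 n).sub contDiff_const
  have ug : ∀ n x, gradient (u n) x = gradient (φ n) x := fun n x => by
    simp only [hu]
    rw [gradient_sub' (C2.diff (φ2 n)) (differentiable_const _), gradient_cst, sub_zero]
  have ul : ∀ n x, lpl (u n) x = lpl (φ n) x := fun n x => by
    simp only [hu]
    rw [lp_sub (φ2 n) contDiff_const, lpl_const, sub_zero]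
  set e : ℕ → EE m → ℝ := fun n x => ε n * φ n x with he
  have heq : ∀ n x, lpl (u n) x = 2 * e n x + 1 * (2 * hamil m θ (gradient (u n) x) + (-2) * g n x) := by
    intro n x
    rw [ul, ug]; have := φe n x; simp only [he]; linarith
  have hb1 : LB (fun n x => ‖gradient (u n) x‖) := by
    intro R
    obtain ⟨M, hM0, hM⟩ := gb (R + 1)
    obtain ⟨C, hC0, hC⟩ := bern_bound hm hθ hM0
    refine ⟨C, hC0, fun n x hx => ?_⟩
    rw [abs_norm, ug]
    refine hC (ε n) (φ n) (g n) x (hε n).le (φ2 n) (gc n).1 (φ0 n) (φe n) fun y hy => hM n y ?_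
    have : ‖y‖ ≤ ‖y - x‖ + ‖x‖ := by simpa using norm_add_le (y - x) x
    linarith
  have hb0 : LB u := by
    intro R
    obtain ⟨C, hC0, hC⟩ := hb1 R
    refine ⟨C * |R|, by positivity, fun n x hx => ?_⟩
    have hR : 0 ≤ R := (norm_nonneg x).trans hx
    have := (convex_closedBall (0 : EE m) R).norm_image_sub_le_of_norm_fderiv_le (𝕜 := ℝ) (f := u n) (C := C)
      (x := 0) (y := x) (fun y _ => C2.diff (u2 n) y) (fun y hy => by
        rw [← norm_gradient]; have := hC n y (by simpa using hy); rwa [abs_norm] at this)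
      (by simpa using hR) (by simpa using hx)
    have e0 : u n 0 = 0 := by simp [hu]
    rw [e0, sub_zero, sub_zero, Real.norm_eq_abs] at this
    refine this.trans ?_
    gcongr; exact hx.trans (le_abs_self R)
  have eb : ∀ n x, |e n x| ≤ τ n * (2 + |u n x|) := by
    intro n x
    have a1 : 0 ≤ e n x := mul_nonneg (hε n).le (φ0 n x)
    rw [abs_of_nonneg a1]
    have a2 := hεφ n (φ n) (φ2 n) (φb n) (φe n)
    have a3 : ε n * (φ n x - φ n 0) ≤ τ n * |φ n x - φ n 0| :=
      (mul_le_mul_of_nonneg_left (le_abs_self _) (hε n).le).trans (mul_le_mul_of_nonneg_right (hετ n) (abs_nonneg _))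
    simp only [he, hu]
    linarith
  have ebd : LB e := by
    intro R
    obtain ⟨C, hC0, hC⟩ := hb0 R
    refine ⟨2 + C, by positivity, fun n x hx => (eb n x).trans ?_⟩
    have a := hC n x hx
    calc τ n * (2 + |u n x|) ≤ 1 * (2 + C) := by
          gcongr; exact hτ1 n
      _ = _ := one_mul _
  have egr : LB (fun n x => ‖gradient (e n) x‖) := by
    intro R
    obtain ⟨C, hC0, hC⟩ := hb1 R
    refine ⟨C, hC0, fun n x hx => ?_⟩
    rw [abs_norm]
    have a := hC n x hx
    rw [abs_norm, ug] at a
    refine grad_le hC0 fun v => ?_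
    simp only [he]
    rw [pd_const_mul (C2.diff (φ2 n)), abs_mul, abs_of_pos (hε n)]
    calc ε n * |pd v (φ n) x| ≤ 1 * (C * ‖v‖) := by
          gcongr
          · exact (hετ n).trans (hτ1 n)
          · exact (abs_pd_le _ _ _).trans (by gcongr)
      _ = _ := one_mul _
  have gLB : LB g := fun R => by
    obtain ⟨M, a, b⟩ := gb R
    exact ⟨M, a, fun n x hx => (b n x hx).1⟩
  have gLB1 : LB (fun n x => ‖gradient (g n) x‖) := fun R => by
    obtain ⟨M, a, b⟩ := gb R
    exact ⟨M, a, fun n x hx => by rw [abs_norm]; exact (b n x hx).2⟩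
  have hFam : Fam u :=
    { c2 := u2
      l1 := fun n => by
        have : lpl (u n) = fun x => 2 * e n x + 1 * (2 * hamil m θ (gradient (u n) x) + (-2) * g n x) := by
          funext x; exact heq n x
        rw [this]
        exact (contDiff_const.mul (contDiff_const.mul (C2.c1 (φ2 n)))).add (contDiff_const.mul ((contDiff_const.mul
          ((hamil_C1 hθ).comp (gradient_contDiff (u2 n)))).add (contDiff_const.mul (gc n).1)))
      b0 := hb0
      b1 := hb1
      b2 := (ebd.add_mul ((LB_comp (hamil_C1 hθ) hb1).add_mul gLB 2 (-2)) 2 1).congr fun n x => (heq n x).symm }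
  obtain ⟨ψ, h2, t0, t1, t2⟩ := hFam.compact hm (fun hv => by
    have h1 := LHa_comp (hamil_C1 (m := m) hθ) hb1 hv
    have h3 := LHa_of_grad (fun n => C2.diff ((contDiff_const (c := ε n)).mul (φ2 n))) egr
    have h4 := LHa_of_grad (fun n => C1.diff (gc n).1) gLB1
    exact (h3.add_mul (h1.add_mul h4 2 (-2)) 2 1).congr fun n x => (heq n x).symm) (hyperfilter ℕ)
  refine ⟨ψ, h2, fun x => ?_⟩
  have tg := grad_tendsto fun v => t1 v x
  have te : Tendsto (fun n => e n x) (hyperfilter ℕ : Filter ℕ) (𝓝 0) := by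
    have := (hτt.mono_left Nat.hyperfilter_le_atTop).mul ((t0 x).abs.const_add 2)
    rw [zero_mul] at this
    exact squeeze_zero_norm (fun n => eb n x) this
  have tH : Tendsto (fun n => hamil m θ (gradient (u n) x)) (hyperfilter ℕ : Filter ℕ) (𝓝 (hamil m θ (gradient ψ x))) :=
    ((hamil_C1 hθ).continuous.tendsto _).comp tg
  have tgg := (gt x).mono_left Nat.hyperfilter_le_atTop
  have := (te.const_mul 2).add (((tH.const_mul 2).add (tgg.const_mul (-2))).const_mul 1)
  have hu := tendsto_nhds_unique ((t2 x).congr fun n => heq n x) this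
  linarith

theorem stmt2 (m : ℕ) (hm : 1 ≤ m) (θ : ℝ) (hθ : 1 < θ)
    (f : EuclideanSpace ℝ (Fin m) → ℝ) (hf : LocallyLipschitz f) (hbd : BddBelow (Set.range f)) :
    (∀ lam ≤ sInf (Set.range f), ∃ φ, IsSolution θ f lam φ) ∧
      {p : ℝ × (EuclideanSpace ℝ (Fin m) → ℝ) | IsSolution θ f p.1 p.2}.Infinite := by
  have key : ∀ lam ≤ sInf (Set.range f), ∃ φ, IsSolution θ f lam φ := by
    intro lam hlam
    have hL : LocallyLipschitz (fun x => f x - lam) := by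
      intro x
      obtain ⟨K, t, ht, hK⟩ := hf x
      refine ⟨K, t, ht, fun a ha b hb => ?_⟩
      have := hK ha hb
      simpa [edist_dist, Real.dist_eq] using this
    obtain ⟨ψ, h2, he⟩ := ergodic_exists hm hθ hL (fun x => by
      have := csInf_le hbd (Set.mem_range_self x); linarith)
    refine ⟨ψ, h2, fun y => ?_⟩
    have := he y
    rw [lap_eq_lp h2]
    unfold hamil at this
    exact this
  refine ⟨key, ?_⟩
  choose! Φ hΦ using key
  have : (Set.Iic (sInf (Set.range f))).Infinite := Set.Iic_infinite _
  refine (this.image (f := fun l => (l, Φ l)) fun a _ b _ hab => (Prod.mk.inj hab).1).mono ?_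
  rintro _ ⟨l, hl, rfl⟩
  exact hΦ l hl
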